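/- arXiv:hep-th/9212152 — 3 statements merged into one kernel-verified Lean document; each statement's English description precedes it below -/
import Mathlib

section
/- Let λ be a partition and N a positive integer. Then the number of semistandard Young tableaux of shape λ with entries in {1, …, N} equals ∑_{ν} ∏_{k,n ≥ 1} C(P_n^{(k)}(ν,N) + m_n(ν^{(k)}), m_n(ν^{(k)})), where the sum is over all admissible collections ν of partitions for (λ, N) and C(a, b) denotes the ordinary binomial coefficient. -/
open scoped BigOperators

/-- A partition, 0-indexed: `p i` is the part `λ_{i+1}`; weakly decreasing, eventually zero. -/
def IsPartition (p : ℕ → ℕ) : Prop :=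
  (∀ i, p (i + 1) ≤ p i) ∧ ∃ N, p N = 0

/-- `|λ| = ∑ᵢ λᵢ`. -/
noncomputable def psize (p : ℕ → ℕ) : ℕ := ∑ᶠ i, p i

/-- The conjugate: `conj p j = λ'_j = #{i : λᵢ ≥ j}` (meaningful for `j ≥ 1`). -/
noncomputable def conj (p : ℕ → ℕ) (j : ℕ) : ℕ := Nat.card {i : ℕ | j ≤ p i}

/-- `Q_n(μ) = ∑_{1 ≤ j ≤ n} μ'_j`. -/
noncomputable def Qstat (p : ℕ → ℕ) (n : ℕ) : ℕ := ∑ j ∈ Finset.Icc 1 n, conj p j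

/-- `m_n(ν) = ν'_n - ν'_{n+1}`. -/
noncomputable def mstat (p : ℕ → ℕ) (n : ℕ) : ℕ := conj p n - conj p (n + 1)

/-- `∑_{j ≥ k+1} λ_j`, where `λ_j = p (j-1)`. -/
noncomputable def tailsum (p : ℕ → ℕ) (k : ℕ) : ℕ := ∑ᶠ t : ℕ, p (t + k)

/-- `P_n^{(k)}(ν, N) = n(N+1)·δ_{k,1} + Q_n(ν^{(k-1)}) - 2·Q_n(ν^{(k)}) + Q_n(ν^{(k+1)})`,
where `ν^{(k)} = ν k` (meaningful for `k ≥ 1`). -/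
noncomputable def Padm (N : ℕ) (ν : ℕ → ℕ → ℕ) (k n : ℕ) : ℤ :=
  (if k = 1 then (n : ℤ) * (N + 1) else 0) +
    (Qstat (ν (k - 1)) n : ℤ) - 2 * Qstat (ν k) n + Qstat (ν (k + 1)) n

/-- An admissible collection of partitions `ν = (ν^{(1)}, ν^{(2)}, …)` for `(λ, N)`:
`ν^{(0)}` is the empty partition, each `ν^{(k)}` is a partition with
`|ν^{(k)}| = ∑_{j ≥ k} λ_j`, and `P_n^{(k)}(ν, N) ≥ 0` for all `k, n ≥ 1`. -/
def IsAdmissible (p : ℕ → ℕ) (N : ℕ) (ν : ℕ → ℕ → ℕ) : Prop :=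
  ν 0 = (fun _ => 0) ∧
    (∀ k, 1 ≤ k → IsPartition (ν k)) ∧
    (∀ k, 1 ≤ k → psize (ν k) = tailsum p (k - 1)) ∧
    (∀ k n, 1 ≤ k → 1 ≤ n → 0 ≤ Padm N ν k n)

/-- A semistandard Young tableau of shape `λ` (0-indexed rows/columns: the box in row `r`,
column `c` belongs to the diagram iff `c < p r`) with entries in `{1, …, n}`. -/
structure SSYT (p : ℕ → ℕ) (n : ℕ) where
  entry : ℕ → ℕ → ℕ
  pos : ∀ r c, c < p r → 1 ≤ entry r c
  le_bound : ∀ r c, c < p r → entry r c ≤ n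
  row_weak : ∀ r c₁ c₂, c₁ ≤ c₂ → c₂ < p r → entry r c₁ ≤ entry r c₂
  col_strict : ∀ r₁ r₂ c, r₁ < r₂ → c < p r₂ → entry r₁ c < entry r₂ c
  zero_outside : ∀ r c, p r ≤ c → entry r c = 0

namespace RiggedConfiguration

open Finset

/-- `∑ j ≤ L, min n j * m j`: the number of boxes in the first `n` columns of the partition
with `m j` parts of size `j`. -/
def colSum (L : ℕ) (m : ℕ → ℕ) (n : ℕ) : ℤ :=
  ∑ j ∈ range (L + 1), ((min n j : ℕ) : ℤ) * (m j : ℤ)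

/-- The vacancy numbers attached to the multiplicities `m k n` and to the source term `B` at the
first node. -/
def vac (L : ℕ) (B : ℕ → ℤ) (m : ℕ → ℕ → ℕ) (k n : ℕ) : ℤ :=
  (if k = 1 then B n else 0) + colSum L (m (k - 1)) n - 2 * colSum L (m k) n
    + colSum L (m (k + 1)) n

/-- The multiplicities of a family of multisets of labels. -/
def mult (X : ℕ → ℕ → Multiset ℕ) (k n : ℕ) : ℕ := (X k n).card

/-- `X k n` is the multiset of riggings of the strings of length `n` at the node `k`. -/
structure IsRC (L : ℕ) (B a : ℕ → ℤ) (X : ℕ → ℕ → Multiset ℕ) : Prop where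
  node_zero : ∀ n, X 0 n = 0
  length_zero : ∀ k, X k 0 = 0
  length_le : ∀ k n, L < n → X k n = 0
  size : ∀ k, 1 ≤ k → ∑ j ∈ range (L + 1), (j : ℤ) * (mult X k j : ℤ) = a k
  label_le : ∀ k n y, y ∈ X k n → (y : ℤ) ≤ vac L B (mult X) k n

/-- Source terms for which the vacancy numbers are well behaved. -/
structure IsSource (B : ℕ → ℤ) : Prop where
  zero : B 0 = 0
  concave : ∀ n, B n + B (n + 2) ≤ 2 * B (n + 1)
  unbounded : ∀ C, ∃ n₀, ∀ n, n₀ ≤ n → C ≤ B n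

/-- `a k` is the sum of the parts of a partition from the `k`-th part on. -/
def IsTailSum (a : ℕ → ℤ) : Prop := ∀ k, 1 ≤ k → 0 ≤ a k - 2 * a (k + 1) + a (k + 2)

lemma colSum_zero (L : ℕ) (m : ℕ → ℕ) : colSum L m 0 = 0 := by simp [colSum]

lemma colSum_of_zero (L : ℕ) {m : ℕ → ℕ} (h : ∀ n, m n = 0) (n : ℕ) : colSum L m n = 0 := by
  simp [colSum, h]

lemma colSum_second_diff {L : ℕ} {m : ℕ → ℕ} (hm : ∀ n, L < n → m n = 0) (n : ℕ) :
    colSum L m n + colSum L m (n + 2) + m (n + 1) = 2 * colSum L m (n + 1) := by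
  have h1 : ((m (n + 1) : ℕ) : ℤ)
      = ∑ j ∈ range (L + 1), (if j = n + 1 then ((m j : ℕ) : ℤ) else 0) := by
    rw [Finset.sum_ite_eq']
    split_ifs with h
    · rfl
    · rw [hm (n + 1) (by simpa using h)]; rfl
  unfold colSum
  rw [h1, ← sum_add_distrib, ← sum_add_distrib, mul_sum]
  refine sum_congr rfl fun j _ => ?_
  split_ifs with h
  · subst h
    rw [min_eq_left (by omega), min_eq_right (by omega), min_eq_left le_rfl]
    push_cast; ring
  · rcases lt_or_gt_of_ne h with h | h
    · rw [min_eq_right (by omega), min_eq_right (by omega), min_eq_right (by omega)]; ring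
    · rw [min_eq_left (by omega), min_eq_left (by omega), min_eq_left (by omega)]
      push_cast; ring

lemma colSum_of_le {L n : ℕ} (m : ℕ → ℕ) (h : L ≤ n) :
    colSum L m n = ∑ j ∈ range (L + 1), (j : ℤ) * (m j : ℤ) := by
  refine sum_congr rfl fun j hj => ?_
  rw [min_eq_right (by have := mem_range.1 hj; omega)]

variable {L : ℕ} {B a : ℕ → ℤ} {X : ℕ → ℕ → Multiset ℕ}

lemma vac_zero (hB : IsSource B) (m : ℕ → ℕ → ℕ) (k : ℕ) : vac L B m k 0 = 0 := by
  simp [vac, colSum_zero, hB.zero]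

lemma IsRC.mult_eq_zero (h : IsRC L B a X) (k n : ℕ) (hn : L < n) : mult X k n = 0 := by
  simp [mult, h.length_le k n hn]

lemma IsRC.vac_second_diff (h : IsRC L B a X) (k n : ℕ) :
    vac L B (mult X) k n + vac L B (mult X) k (n + 2) + mult X (k - 1) (n + 1)
      + mult X (k + 1) (n + 1) + (if k = 1 then 2 * B (n + 1) - B n - B (n + 2) else 0)
      = 2 * vac L B (mult X) k (n + 1) + 2 * mult X k (n + 1) := by
  have h1 := colSum_second_diff (h.mult_eq_zero (k - 1)) n
  have h2 := colSum_second_diff (h.mult_eq_zero k) n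
  have h3 := colSum_second_diff (h.mult_eq_zero (k + 1)) n
  unfold vac
  split_ifs <;> linarith

lemma IsRC.mult_zero (h : IsRC L B a X) (n : ℕ) : mult X 0 n = 0 := by
  simp [mult, h.node_zero]

lemma IsRC.colSum_eq (h : IsRC L B a X) {k n : ℕ} (hk : 1 ≤ k) (hn : L ≤ n) :
    colSum L (mult X k) n = a k := by
  rw [colSum_of_le _ hn, h.size k hk]

lemma IsRC.vac_eq (h : IsRC L B a X) {k n : ℕ} (hk : 1 ≤ k) (hn : L ≤ n) :
    vac L B (mult X) (k + 1) n = a k - 2 * a (k + 1) + a (k + 2) := by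
  unfold vac
  rw [if_neg (by omega), Nat.add_sub_cancel, h.colSum_eq hk hn, h.colSum_eq (by omega) hn,
    h.colSum_eq (by omega) hn]
  ring

lemma IsRC.vac_one_eq (h : IsRC L B a X) {n : ℕ} (hn : L ≤ n) :
    vac L B (mult X) 1 n = B n - 2 * a 1 + a 2 := by
  unfold vac
  rw [if_pos rfl, Nat.sub_self, colSum_of_zero L h.mult_zero, h.colSum_eq le_rfl hn,
    h.colSum_eq (by omega) hn]
  ring

lemma IsRC.exists_vac_one_pos (h : IsRC L B a X) (hB : IsSource B) :
    ∃ n₀, ∀ n, n₀ ≤ n → 1 ≤ vac L B (mult X) 1 n := by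
  obtain ⟨n₀, hn₀⟩ := hB.unbounded (2 * a 1 - a 2 + 1)
  refine ⟨max n₀ L, fun n hn => ?_⟩
  rw [h.vac_one_eq (le_trans (le_max_right _ _) hn)]
  linarith [hn₀ n (le_trans (le_max_left _ _) hn)]

lemma IsRC.vac_nonneg_of_mem (h : IsRC L B a X) {k n : ℕ} (hm : mult X k n ≠ 0) :
    0 ≤ vac L B (mult X) k n := by
  obtain ⟨y, hy⟩ := Multiset.card_pos_iff_exists_mem.1 (Nat.pos_of_ne_zero hm)
  exact le_trans (Int.natCast_nonneg y) (h.label_le k n y hy)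

/-- Vacancy numbers are nonnegative at every length once they bound the labels. -/
lemma IsRC.vac_nonneg (h : IsRC L B a X) (hB : IsSource B) (ha : IsTailSum a) {k : ℕ}
    (hk : 1 ≤ k) (n : ℕ) : 0 ≤ vac L B (mult X) k n := by
  by_contra hneg
  have hex : ∃ n, vac L B (mult X) k n < 0 := ⟨n, not_le.1 hneg⟩
  classical
  obtain ⟨n₁, hn₁, hmin⟩ : ∃ n₁, vac L B (mult X) k n₁ < 0 ∧
      ∀ j < n₁, 0 ≤ vac L B (mult X) k j :=
    ⟨Nat.find hex, Nat.find_spec hex, fun j hj => not_lt.1 (Nat.find_min hex hj)⟩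
  have hpos : n₁ ≠ 0 := by
    rintro rfl
    rw [vac_zero hB] at hn₁
    exact lt_irrefl _ hn₁
  obtain ⟨n₂, rfl⟩ := Nat.exists_eq_succ_of_ne_zero hpos
  have hdec : ∀ i, vac L B (mult X) k (n₂ + i + 1) < 0 ∧
      vac L B (mult X) k (n₂ + i + 1) ≤ vac L B (mult X) k (n₂ + i) := by
    intro i
    induction i with
    | zero =>
      have := hmin n₂ (Nat.lt_succ_self _)
      exact ⟨hn₁, le_trans hn₁.le this⟩
    | succ i ih =>
      have h2 := h.vac_second_diff k (n₂ + i)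
      have h3 : mult X k (n₂ + i + 1) = 0 := by
        by_contra hm
        exact absurd (h.vac_nonneg_of_mem hm) (not_le.2 ih.1)
      rw [h3] at h2
      have h4 : (0 : ℤ) ≤
          if k = 1 then 2 * B (n₂ + i + 1) - B (n₂ + i) - B (n₂ + i + 2) else 0 := by
        split_ifs
        · linarith [hB.concave (n₂ + i)]
        · exact le_rfl
      have h5 : vac L B (mult X) k (n₂ + (i + 1) + 1) ≤ vac L B (mult X) k (n₂ + (i + 1)) := by
        have e1 : n₂ + (i + 1) + 1 = n₂ + i + 2 := by ring
        have e2 : n₂ + (i + 1) = n₂ + i + 1 := by ring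
        rw [e1, e2]
        push_cast at h2
        have := Int.natCast_nonneg (mult X (k - 1) (n₂ + i + 1))
        have := Int.natCast_nonneg (mult X (k + 1) (n₂ + i + 1))
        linarith [ih.2]
      exact ⟨lt_of_le_of_lt h5 ih.1, h5⟩
  rcases Nat.lt_or_ge k 2 with hk2 | hk2
  · obtain rfl : k = 1 := by omega
    obtain ⟨n₀, hn₀⟩ := h.exists_vac_one_pos hB
    have h1 := hn₀ (n₂ + n₀ + 1) (by omega)
    linarith [(hdec n₀).1]
  · obtain ⟨k, rfl⟩ : ∃ k', k = k' + 1 := ⟨k - 1, by omega⟩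
    have h1 := h.vac_eq (k := k) (n := n₂ + L + 1) (by omega) (by omega)
    linarith [(hdec L).1, ha k (by omega)]

/-- The node `k` carries a singular string of length `n`, strings of length zero being singular
by convention. -/
def Sing (L : ℕ) (B : ℕ → ℤ) (X : ℕ → ℕ → Multiset ℕ) (k n : ℕ) : Prop :=
  n = 0 ∨ ∃ y ∈ X k n, (y : ℤ) = vac L B (mult X) k n

lemma IsRC.label_lt (h : IsRC L B a X) {k n y : ℕ} (hs : ¬ Sing L B X k n) (hy : y ∈ X k n) :
    (y : ℤ) < vac L B (mult X) k n :=
  lt_of_le_of_ne (h.label_le k n y hy) fun he => hs (Or.inr ⟨y, hy, he⟩)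

lemma Sing.mult_pos {k n : ℕ} (h : Sing L B X k n) (hn : n ≠ 0) : 0 < mult X k n := by
  rcases h with h | ⟨y, hy, -⟩
  · exact absurd h hn
  · exact Multiset.card_pos_iff_exists_mem.2 ⟨y, hy⟩

lemma Sing.toNat_mem {k n : ℕ} (h : Sing L B X k n) (hn : n ≠ 0) :
    (vac L B (mult X) k n).toNat ∈ X k n ∧ 0 ≤ vac L B (mult X) k n := by
  rcases h with h | ⟨y, hy, he⟩
  · exact absurd h hn
  · rw [← he]
    simpa using hy

lemma IsRC.le_of_sing (h : IsRC L B a X) {k n : ℕ} (hs : Sing L B X k n) : n ≤ L := by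
  by_contra hn
  have := hs.mult_pos (by omega)
  rw [h.mult_eq_zero k n (by omega)] at this
  exact lt_irrefl _ this

/-- Positivity of a vacancy number with no singular string propagates from its neighbours. -/
lemma IsRC.vac_pos (h : IsRC L B a X) (hB : IsSource B) (ha : IsTailSum a) {k n : ℕ}
    (hk : 1 ≤ k) (hs : ¬ Sing L B X k (n + 1))
    (hsrc : 1 ≤ vac L B (mult X) k n ∨ 1 ≤ vac L B (mult X) k (n + 2) ∨
      0 < mult X (k - 1) (n + 1) ∨ 0 < mult X (k + 1) (n + 1) ∨
      (k = 1 ∧ B n + B (n + 2) + 1 ≤ 2 * B (n + 1))) :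
    1 ≤ vac L B (mult X) k (n + 1) := by
  by_cases hm : mult X k (n + 1) = 0
  · have h2 := h.vac_second_diff k n
    have h0 := h.vac_nonneg hB ha hk n
    have h1 := h.vac_nonneg hB ha hk (n + 2)
    have h4 : (0 : ℤ) ≤ if k = 1 then 2 * B (n + 1) - B n - B (n + 2) else 0 := by
      split_ifs
      · linarith [hB.concave n]
      · exact le_rfl
    rw [hm] at h2
    rcases hsrc with hh | hh | hh | hh | ⟨rfl, hh⟩
    · omega
    · omega
    · omega
    · omega
    · rw [if_pos rfl] at h2
      omega
  · obtain ⟨y, hy⟩ := Multiset.card_pos_iff_exists_mem.1 (Nat.pos_of_ne_zero hm)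
    have := h.label_lt hs hy
    omega

/-- Upward propagation of positivity. -/
lemma IsRC.vac_pos_up (h : IsRC L B a X) (hB : IsSource B) (ha : IsTailSum a) {k j : ℕ}
    (hk : 1 ≤ k)
    (hsrc : 0 < mult X (k - 1) (j + 1) ∨ (k = 1 ∧ B j + B (j + 2) + 1 ≤ 2 * B (j + 1)))
    (i : ℕ) (hs : ∀ n, j + 1 ≤ n → n ≤ j + i + 1 → ¬ Sing L B X k n) :
    1 ≤ vac L B (mult X) k (j + i + 1) := by
  induction i with
  | zero =>
    refine h.vac_pos hB ha hk (hs _ le_rfl le_rfl) ?_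
    rcases hsrc with hh | hh
    · exact Or.inr (Or.inr (Or.inl hh))
    · exact Or.inr (Or.inr (Or.inr (Or.inr hh)))
  | succ i ih =>
    exact h.vac_pos hB ha hk (hs _ (by omega) le_rfl)
      (Or.inl (ih fun n h1 h2 => hs n h1 (by omega)))

/-- Downward propagation of positivity. -/
lemma IsRC.vac_pos_down (h : IsRC L B a X) (hB : IsSource B) (ha : IsTailSum a) {k j : ℕ}
    (hk : 1 ≤ k) (i : ℕ)
    (hsrc : 0 < mult X (k + 1) (j + i + 1) ∨ 1 ≤ vac L B (mult X) k (j + i + 2))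
    (hs : ∀ n, j + 1 ≤ n → n ≤ j + i + 1 → ¬ Sing L B X k n) :
    1 ≤ vac L B (mult X) k (j + 1) := by
  induction i generalizing j with
  | zero =>
    refine h.vac_pos hB ha hk (hs _ le_rfl le_rfl) ?_
    rcases hsrc with hh | hh
    · exact Or.inr (Or.inr (Or.inr (Or.inl hh)))
    · exact Or.inr (Or.inl hh)
  | succ i ih =>
    refine h.vac_pos hB ha hk (hs _ le_rfl (by omega)) (Or.inr (Or.inl ?_))
    refine ih (j := j + 1) ?_ fun n h1 h2 => hs n (by omega) (by omega)
    rw [show j + 1 + i + 1 = j + (i + 1) + 1 by ring, show j + 1 + i + 2 = j + (i + 1) + 2 by ring]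
    exact hsrc

/-- `ℓ` records the lengths of the strings selected greedily from below at the nodes `1, …, d`,
and no string can be selected at the node `d + 1`. -/
structure IsMinChain (L : ℕ) (B : ℕ → ℤ) (X : ℕ → ℕ → Multiset ℕ) (s d : ℕ) (ℓ : ℕ → ℕ) :
    Prop where
  start : ℓ 0 = s + 1
  off : ∀ k, d < k → ℓ k = 0
  mono : ∀ k, k < d → ℓ k ≤ ℓ (k + 1)
  sing : ∀ k, k < d → Sing L B X (k + 1) (ℓ (k + 1))
  nonsing : ∀ k n, k ≤ d → ℓ k ≤ n → ¬ (k + 1 ≤ d ∧ ℓ (k + 1) ≤ n) → ¬ Sing L B X (k + 1) n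

/-- The lengths `ℓ k - 1` are those of the strings selected greedily from above at the nodes
`d, …, 1`. -/
structure IsMaxChain (L : ℕ) (B : ℕ → ℤ) (Y : ℕ → ℕ → Multiset ℕ) (s d : ℕ) (ℓ : ℕ → ℕ) :
    Prop where
  start : ℓ 0 = s + 1
  off : ∀ k, d < k → ℓ k = 0
  mono : ∀ k, k < d → ℓ k ≤ ℓ (k + 1)
  sing : ∀ k, k < d → Sing L B Y (k + 1) (ℓ (k + 1) - 1)
  nonsing : ∀ k n, k < d → ℓ (k + 1) ≤ n → ¬ (k + 2 ≤ d ∧ ℓ (k + 2) ≤ n) → ¬ Sing L B Y (k + 1) n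

/-- The label taken away from the strings of length `ℓ k` at the node `k`. -/
def removed (d : ℕ) (ℓ : ℕ → ℕ) (V : ℕ → ℕ → ℤ) (k n : ℕ) : Multiset ℕ :=
  if 1 ≤ k ∧ k ≤ d ∧ n = ℓ k then {(V k n).toNat} else 0

/-- The label given to the string of length `ℓ k - 1` at the node `k`. -/
def added (d : ℕ) (ℓ : ℕ → ℕ) (W : ℕ → ℕ → ℤ) (k n : ℕ) : Multiset ℕ :=
  if 1 ≤ k ∧ k ≤ d ∧ n + 1 = ℓ k ∧ 1 ≤ n then {(W k n).toNat} else 0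

/-- `Y` arises from `X` by shortening the strings recorded by `ℓ`. -/
def Move (d : ℕ) (ℓ : ℕ → ℕ) (V W : ℕ → ℕ → ℤ) (X Y : ℕ → ℕ → Multiset ℕ) : Prop :=
  ∀ k n, X k n + added d ℓ W k n = Y k n + removed d ℓ V k n

/-- The indicator of `ℓ k ≤ n`, for `k ≤ d`. -/
def reach (d : ℕ) (ℓ : ℕ → ℕ) (k n : ℕ) : ℤ := if k ≤ d ∧ ℓ k ≤ n then 1 else 0

lemma sum_of_shorten {L l : ℕ} (hl : 1 ≤ l) (hL : l ≤ L) {m m' : ℕ → ℕ}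
    (h : ∀ n, m n + (if n + 1 = l ∧ 1 ≤ n then 1 else 0) = m' n + (if n = l then 1 else 0))
    (f : ℕ → ℤ) (hf : f 0 = 0) :
    ∑ j ∈ range (L + 1), f j * (m' j : ℤ)
      = ∑ j ∈ range (L + 1), f j * (m j : ℤ) - f l + f (l - 1) := by
  have h1 : f l = ∑ j ∈ range (L + 1), (if j = l then f j else 0) := by
    rw [Finset.sum_ite_eq', if_pos (mem_range.2 (by omega))]
  have h2 : f (l - 1) = ∑ j ∈ range (L + 1), (if j = l - 1 then f j else 0) := by
    rw [Finset.sum_ite_eq', if_pos (mem_range.2 (by omega))]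
  rw [h1, h2, ← sum_sub_distrib, ← sum_add_distrib]
  refine sum_congr rfl fun j _ => ?_
  have hj := h j
  rcases Nat.eq_zero_or_pos j with rfl | hj0
  · simp [hf]
  · have h3 : ((m j : ℕ) : ℤ) + (if j = l - 1 then 1 else 0)
        = (m' j : ℤ) + (if j = l then 1 else 0) := by
      have e : (j + 1 = l ∧ 1 ≤ j) ↔ j = l - 1 := by omega
      simp only [e] at hj
      exact_mod_cast hj
    have h4 : (m' j : ℤ) = (m j : ℤ) + (if j = l - 1 then 1 else 0) - (if j = l then 1 else 0) := by
      linarith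
    rw [h4]
    split_ifs <;> ring

section Move

variable {d s : ℕ} {ℓ : ℕ → ℕ} {V W : ℕ → ℕ → ℤ} {Y : ℕ → ℕ → Multiset ℕ} {B' a' : ℕ → ℤ}

lemma Move.mult_eq (h : Move d ℓ V W X Y) {k : ℕ} (hk : 1 ≤ k) (hkd : k ≤ d) (n : ℕ) :
    mult X k n + (if n + 1 = ℓ k ∧ 1 ≤ n then 1 else 0)
      = mult Y k n + (if n = ℓ k then 1 else 0) := by
  have := congrArg Multiset.card (h k n)
  simp only [Multiset.card_add, added, removed, hk, hkd, true_and] at this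
  unfold mult
  split_ifs at this ⊢ <;> simpa using this

lemma Move.eq_of_not (h : Move d ℓ V W X Y) {k : ℕ} (hk : ¬ (1 ≤ k ∧ k ≤ d)) (n : ℕ) :
    X k n = Y k n := by
  have := h k n
  rw [added, removed, if_neg (by tauto), if_neg (by tauto)] at this
  simpa using this

lemma Move.sum_eq (h : Move d ℓ V W X Y) (hℓ : ∀ k, 1 ≤ k → k ≤ d → 1 ≤ ℓ k ∧ ℓ k ≤ L) (k : ℕ)
    (f : ℕ → ℤ) (hf : f 0 = 0) :
    ∑ j ∈ range (L + 1), f j * (mult Y k j : ℤ) = ∑ j ∈ range (L + 1), f j * (mult X k j : ℤ)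
      - if 1 ≤ k ∧ k ≤ d then f (ℓ k) - f (ℓ k - 1) else 0 := by
  split_ifs with hk
  · rw [sum_of_shorten (hℓ k hk.1 hk.2).1 (hℓ k hk.1 hk.2).2 (h.mult_eq hk.1 hk.2) f hf]
    ring
  · rw [sub_zero]
    refine sum_congr rfl fun j _ => ?_
    rw [mult, mult, h.eq_of_not hk]

lemma Move.colSum_eq (h : Move d ℓ V W X Y) (hℓ : ∀ k, 1 ≤ k → k ≤ d → 1 ≤ ℓ k ∧ ℓ k ≤ L)
    (k n : ℕ) :
    colSum L (mult Y k) n = colSum L (mult X k) n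
      - if 1 ≤ k then reach d ℓ k n else 0 := by
  unfold colSum
  rw [h.sum_eq hℓ k (fun j => ((min n j : ℕ) : ℤ)) (by simp)]
  congr 1
  unfold reach
  by_cases hk : 1 ≤ k
  · by_cases hkd : k ≤ d
    · have := hℓ k hk hkd
      simp only [hk, hkd, true_and, and_self, if_true]
      split_ifs with hn
      · rw [min_eq_right hn, min_eq_right (by omega)]
        omega
      · rw [min_eq_left (by omega), min_eq_left (by omega)]
        ring
    · simp [hkd]
  · simp [hk]

lemma Move.vac_eq (h : Move d ℓ V W X Y) (hℓ : ∀ k, 1 ≤ k → k ≤ d → 1 ≤ ℓ k ∧ ℓ k ≤ L)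
    (hstart : ℓ 0 = s + 1) (hB : ∀ n, B' n = B n - if s + 1 ≤ n then 1 else 0) {k : ℕ}
    (hk : 1 ≤ k) (n : ℕ) :
    vac L B' (mult Y) k n = vac L B (mult X) k n
      - reach d ℓ (k - 1) n + 2 * reach d ℓ k n - reach d ℓ (k + 1) n := by
  unfold vac
  rw [h.colSum_eq hℓ (k - 1), h.colSum_eq hℓ k, h.colSum_eq hℓ (k + 1)]
  simp only [hk, Nat.le_add_left, if_true]
  rcases Nat.lt_or_ge k 2 with hk2 | hk2
  · obtain rfl : k = 1 := by omega
    have h0 : reach d ℓ 0 n = if s + 1 ≤ n then 1 else 0 := by simp [reach, hstart]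
    simp only [Nat.sub_self, h0, hB, if_true]
    norm_num
    ring
  · have h1 : 1 ≤ k - 1 := by omega
    have h2 : k ≠ 1 := by omega
    simp only [h1, h2, if_true, if_false]
    ring

lemma Move.size_eq (h : Move d ℓ V W X Y) (hℓ : ∀ k, 1 ≤ k → k ≤ d → 1 ≤ ℓ k ∧ ℓ k ≤ L)
    (k : ℕ) :
    ∑ j ∈ range (L + 1), (j : ℤ) * (mult Y k j : ℤ)
      = ∑ j ∈ range (L + 1), (j : ℤ) * (mult X k j : ℤ) - if 1 ≤ k ∧ k ≤ d then 1 else 0 := by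
  rw [h.sum_eq hℓ k (fun j => (j : ℤ)) (by simp)]
  congr 1
  split_ifs with hk
  · have := hℓ k hk.1 hk.2
    omega
  · rfl

lemma le_of_ladder (hstart : ℓ 0 = s + 1) (hmono : ∀ k, k < d → ℓ k ≤ ℓ (k + 1)) {k : ℕ}
    (hk : k ≤ d) : 1 ≤ ℓ k := by
  induction k with
  | zero => omega
  | succ k ih => exact le_trans (ih (by omega)) (hmono k (by omega))

/-- Along a ladder the indicators decrease with the node. -/
lemma reach_cases (hmono : ∀ k, k < d → ℓ k ≤ ℓ (k + 1)) (k n : ℕ) :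
    (reach d ℓ k n = 1 ∧ reach d ℓ (k + 1) n = 1 ∧ k + 1 ≤ d ∧ ℓ k ≤ n ∧ ℓ (k + 1) ≤ n) ∨
    (reach d ℓ k n = 1 ∧ reach d ℓ (k + 1) n = 0 ∧ k ≤ d ∧ ℓ k ≤ n ∧
      ¬ (k + 1 ≤ d ∧ ℓ (k + 1) ≤ n)) ∨
    (reach d ℓ k n = 0 ∧ reach d ℓ (k + 1) n = 0 ∧ ¬ (k ≤ d ∧ ℓ k ≤ n) ∧
      ¬ (k + 1 ≤ d ∧ ℓ (k + 1) ≤ n)) := by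
  unfold reach
  by_cases h1 : k + 1 ≤ d ∧ ℓ (k + 1) ≤ n
  · have h2 : k ≤ d ∧ ℓ k ≤ n := ⟨by omega, le_trans (hmono k (by omega)) h1.2⟩
    left
    simp [h1, h2]
  · by_cases h2 : k ≤ d ∧ ℓ k ≤ n
    · right; left
      simp [h2]
      omega
    · right; right
      simp only [if_neg h1, if_neg h2]
      tauto

end Move

section Bijection

variable {d s : ℕ} {ℓ : ℕ → ℕ} {Y : ℕ → ℕ → Multiset ℕ} {B' a' : ℕ → ℤ}

lemma IsMinChain.vac_pos (hmin : IsMinChain L B X s d ℓ) (hX : IsRC L B a X) (hB : IsSource B)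
    (ha : IsTailSum a) (hstrict : B s + B (s + 2) + 1 ≤ 2 * B (s + 1)) {k n : ℕ} (hk : k ≤ d)
    (hn : ℓ k ≤ n) (hn' : ¬ (k + 1 ≤ d ∧ ℓ (k + 1) ≤ n)) :
    1 ≤ vac L B (mult X) (k + 1) n := by
  have hpos := le_of_ladder hmin.start hmin.mono hk
  obtain ⟨j, hj⟩ : ∃ j, ℓ k = j + 1 := ⟨ℓ k - 1, by omega⟩
  obtain ⟨i, rfl⟩ : ∃ i, n = j + i + 1 := ⟨n - (j + 1), by omega⟩
  refine hX.vac_pos_up hB ha (by omega) ?_ i fun m h1 h2 => ?_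
  · rcases Nat.eq_zero_or_pos k with rfl | hk0
    · right
      have : j = s := by have := hmin.start; omega
      subst this
      exact ⟨rfl, hstrict⟩
    · left
      obtain ⟨k, rfl⟩ : ∃ k', k = k' + 1 := ⟨k - 1, by omega⟩
      have := (hmin.sing k (by omega)).mult_pos (by omega)
      rwa [hj] at this
  · refine hmin.nonsing k m hk (by omega) fun h => hn' ⟨h.1, by omega⟩

lemma IsMaxChain.vac_pos (hmax : IsMaxChain L B' Y s d ℓ) (hY : IsRC L B' a' Y)
    (hB : IsSource B') (ha : IsTailSum a) (hta : IsTailSum a')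
    (ha' : ∀ k, 1 ≤ k → a' k = a k - if k ≤ d then 1 else 0) {k n : ℕ} (hk : k < d)
    (hn : ℓ (k + 1) ≤ n) (hn' : ¬ (k + 2 ≤ d ∧ ℓ (k + 2) ≤ n)) :
    1 ≤ vac L B' (mult Y) (k + 1) n := by
  have hpos := le_of_ladder hmax.start hmax.mono (k := k + 1) (by omega)
  obtain ⟨j, rfl⟩ : ∃ j, n = j + 1 := ⟨n - 1, by omega⟩
  rcases Nat.lt_or_ge (k + 1) d with hd | hd
  · have h2 : ¬ ℓ (k + 2) ≤ j + 1 := fun h => hn' ⟨hd, h⟩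
    obtain ⟨i, hi⟩ : ∃ i, ℓ (k + 2) = j + i + 2 := ⟨ℓ (k + 2) - j - 2, by omega⟩
    refine hY.vac_pos_down hB hta (by omega) i (Or.inl ?_) fun m h3 h4 => ?_
    · have h5 := hmax.sing (k + 1) hd
      rw [show k + 1 + 1 = k + 2 from rfl, hi] at h5
      exact h5.mult_pos (by omega)
    · exact hmax.nonsing k m hk (by omega) fun h => by omega
  · obtain rfl : d = k + 1 := by omega
    have hinf : ∃ n₀, ∀ n, n₀ ≤ n → 1 ≤ vac L B' (mult Y) (k + 1) n := by
      rcases Nat.eq_zero_or_pos k with rfl | hk0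
      · exact hY.exists_vac_one_pos hB
      · refine ⟨L, fun n hn => ?_⟩
        rw [hY.vac_eq hk0 hn, ha' k (by omega), ha' (k + 1) (by omega), ha' (k + 2) (by omega),
          if_pos (by omega), if_pos (by omega), if_neg (by omega)]
        linarith [ha k hk0]
    obtain ⟨n₀, hn₀⟩ := hinf
    refine hY.vac_pos_down hB hta (by omega) n₀ (Or.inr (hn₀ _ (by omega))) fun m h3 h4 => ?_
    exact hmax.nonsing k m hk (by omega) fun h => by omega

/-- Removing a box from each string of the chain selected from below. -/
lemma IsMinChain.exists_move (hmin : IsMinChain L B X s d ℓ) (hX : IsRC L B a X)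
    (hB : IsSource B) (ha : IsTailSum a) (hstrict : B s + B (s + 2) + 1 ≤ 2 * B (s + 1))
    (hBB : ∀ n, B' n = B n - if s + 1 ≤ n then 1 else 0)
    (ha' : ∀ k, 1 ≤ k → a' k = a k - if k ≤ d then 1 else 0) :
    ∃ Y, IsRC L B' a' Y ∧ IsMaxChain L B' Y s d ℓ ∧
      Move d ℓ (vac L B (mult X)) (vac L B' (mult Y)) X Y := by
  classical
  have hℓ : ∀ k, 1 ≤ k → k ≤ d → 1 ≤ ℓ k ∧ ℓ k ≤ L := by
    intro k hk hkd
    refine ⟨le_of_ladder hmin.start hmin.mono hkd, ?_⟩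
    obtain ⟨k, rfl⟩ : ∃ k', k = k' + 1 := ⟨k - 1, by omega⟩
    exact hX.le_of_sing (hmin.sing k (by omega))
  let V := vac L B (mult X)
  let W : ℕ → ℕ → ℤ := fun k n =>
    V k n - reach d ℓ (k - 1) n + 2 * reach d ℓ k n - reach d ℓ (k + 1) n
  let Y : ℕ → ℕ → Multiset ℕ := fun k n => X k n - removed d ℓ V k n + added d ℓ W k n
  have hsub : ∀ k n, removed d ℓ V k n ≤ X k n := by
    intro k n
    unfold removed
    split_ifs with h
    · obtain ⟨h1, h2, rfl⟩ := h
      obtain ⟨k, rfl⟩ : ∃ k', k = k' + 1 := ⟨k - 1, by omega⟩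
      have := hℓ (k + 1) h1 h2
      exact Multiset.singleton_le.2 ((hmin.sing k (by omega)).toNat_mem (by omega)).1
    · exact Multiset.zero_le _
  have hmove : Move d ℓ V W X Y := by
    intro k n
    change _ = X k n - removed d ℓ V k n + added d ℓ W k n + removed d ℓ V k n
    rw [add_right_comm, tsub_add_cancel_of_le (hsub k n)]
  have hvac : ∀ k n, 1 ≤ k → vac L B' (mult Y) k n = W k n := fun k n hk =>
    hmove.vac_eq hℓ hmin.start hBB hk n
  have hadd : ∀ k n, added d ℓ (vac L B' (mult Y)) k n = added d ℓ W k n := by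
    intro k n
    unfold added
    split_ifs with h
    · rw [hvac k n h.1]
    · rfl
  have hmove' : Move d ℓ V (vac L B' (mult Y)) X Y := fun k n => by
    rw [hadd]; exact hmove k n
  have hmemY : ∀ k n y, y ∈ Y k n → y ∈ X k n ∨ y ∈ added d ℓ W k n := by
    intro k n y hy
    rcases Multiset.mem_add.1 hy with hy | hy
    · exact Or.inl (Multiset.mem_of_le tsub_le_self hy)
    · exact Or.inr hy
  refine ⟨Y, ⟨?_, ?_, ?_, ?_, ?_⟩, ⟨hmin.start, hmin.off, hmin.mono, ?_, ?_⟩, hmove'⟩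
  · intro n
    rw [← hmove.eq_of_not (by omega), hX.node_zero]
  · intro k
    change X k 0 - removed d ℓ V k 0 + added d ℓ W k 0 = 0
    rw [hX.length_zero, added, if_neg (by omega)]
    simp
  · intro k n hn
    change X k n - removed d ℓ V k n + added d ℓ W k n = 0
    rw [hX.length_le k n hn, added, if_neg]
    · simp
    · rintro ⟨h1, h2, h3, h4⟩
      have := hℓ k h1 h2
      omega
  · intro k hk
    rw [hmove.size_eq hℓ, hX.size k hk, ha' k hk]
    simp [hk]
  · intro k n y hy
    rcases Nat.eq_zero_or_pos k with rfl | hk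
    · rw [← hmove.eq_of_not (by omega), hX.node_zero] at hy
      simp at hy
    rw [hvac k n hk]
    obtain ⟨k, rfl⟩ : ∃ k', k = k' + 1 := ⟨k - 1, by omega⟩
    change (y : ℤ) ≤ V (k + 1) n - reach d ℓ (k + 1 - 1) n + 2 * reach d ℓ (k + 1) n
      - reach d ℓ (k + 1 + 1) n
    rw [Nat.add_sub_cancel]
    rcases hmemY _ _ _ hy with hy | hy
    · have hle : (y : ℤ) ≤ V (k + 1) n := hX.label_le _ _ _ hy
      have hc2 := reach_cases hmin.mono (k + 1) n
      rcases reach_cases hmin.mono k n with hc | hc | hc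
      · omega
      · have : (y : ℤ) < V (k + 1) n :=
          hX.label_lt (hmin.nonsing k n hc.2.2.1 hc.2.2.2.1 hc.2.2.2.2) hy
        omega
      · omega
    · unfold added at hy
      split_ifs at hy with h
      · obtain ⟨h1, h2, h3, h4⟩ := h
        have hge : 0 ≤ W (k + 1) n := by
          change 0 ≤ V (k + 1) n - reach d ℓ (k + 1 - 1) n + 2 * reach d ℓ (k + 1) n
            - reach d ℓ (k + 1 + 1) n
          rw [Nat.add_sub_cancel]
          have hV0 : 0 ≤ V (k + 1) n := hX.vac_nonneg hB ha h1 n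
          have hc2 := reach_cases hmin.mono (k + 1) n
          rcases reach_cases hmin.mono k n with hc | hc | hc
          · omega
          · have : 1 ≤ V (k + 1) n :=
              hmin.vac_pos hX hB ha hstrict hc.2.2.1 hc.2.2.2.1 hc.2.2.2.2
            omega
          · omega
        rw [Multiset.mem_singleton] at hy
        have : (y : ℤ) = W (k + 1) n := by rw [hy, Int.toNat_of_nonneg hge]
        rw [this]
        change V (k + 1) n - reach d ℓ (k + 1 - 1) n + 2 * reach d ℓ (k + 1) n
            - reach d ℓ (k + 1 + 1) n ≤ _
        rw [Nat.add_sub_cancel]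
      · simp at hy
  · intro k hk
    have hl := hℓ (k + 1) (by omega) (by omega)
    by_cases h1 : ℓ (k + 1) = 1
    · left; omega
    · right
      have hpos : 0 ≤ W (k + 1) (ℓ (k + 1) - 1) := by
        change 0 ≤ V (k + 1) _ - reach d ℓ (k + 1 - 1) _ + 2 * reach d ℓ (k + 1) _
            - reach d ℓ (k + 1 + 1) _
        rw [Nat.add_sub_cancel]
        have hV0 : 0 ≤ V (k + 1) (ℓ (k + 1) - 1) := hX.vac_nonneg hB ha (by omega) _
        have hc2 := reach_cases hmin.mono (k + 1) (ℓ (k + 1) - 1)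
        rcases reach_cases hmin.mono k (ℓ (k + 1) - 1) with hc | hc | hc
        · omega
        · have : 1 ≤ V (k + 1) (ℓ (k + 1) - 1) :=
              hmin.vac_pos hX hB ha hstrict hc.2.2.1 hc.2.2.2.1 hc.2.2.2.2
          omega
        · omega
      refine ⟨(W (k + 1) (ℓ (k + 1) - 1)).toNat, ?_, ?_⟩
      · refine Multiset.mem_add.2 (Or.inr ?_)
        rw [added, if_pos ⟨by omega, by omega, by omega, by omega⟩]
        exact Multiset.mem_singleton_self _
      · rw [hvac _ _ (by omega), Int.toNat_of_nonneg hpos]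
  · intro k n hk hn hn' hs
    have hl := hℓ (k + 1) (by omega) (by omega)
    rcases hs with hs | ⟨y, hy, he⟩
    · omega
    · rw [hvac _ _ (by omega)] at he
      change (y : ℤ) = V (k + 1) n - reach d ℓ (k + 1 - 1) n + 2 * reach d ℓ (k + 1) n
            - reach d ℓ (k + 1 + 1) n at he
      rw [Nat.add_sub_cancel] at he
      rcases hmemY _ _ _ hy with hy | hy
      · have hle : (y : ℤ) ≤ V (k + 1) n := hX.label_le _ _ _ hy
        have hc := reach_cases hmin.mono k n
        have hc2 := reach_cases hmin.mono (k + 1) n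
        simp only [show k + 1 + 1 = k + 2 from rfl] at hc2 he
        omega
      · rw [added, if_neg (by omega)] at hy
        simp at hy

end Bijection

section Inverse

variable {d s : ℕ} {ℓ ℓ' : ℕ → ℕ} {X' Y Y' : ℕ → ℕ → Multiset ℕ} {B' a' : ℕ → ℤ}

/-- Adding a box to each string of the chain selected from above. -/
lemma IsMaxChain.exists_move (hmax : IsMaxChain L B' Y s d ℓ) (hY : IsRC L B' a' Y)
    (hB : IsSource B') (ha : IsTailSum a) (hta : IsTailSum a') (haL : ∀ k, 1 ≤ k → a k ≤ L)
    (hBB : ∀ n, B' n = B n - if s + 1 ≤ n then 1 else 0)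
    (ha' : ∀ k, 1 ≤ k → a' k = a k - if k ≤ d then 1 else 0) :
    ∃ X, IsRC L B a X ∧ IsMinChain L B X s d ℓ ∧
      Move d ℓ (vac L B (mult X)) (vac L B' (mult Y)) X Y := by
  classical
  have hℓ : ∀ k, 1 ≤ k → k ≤ d → 1 ≤ ℓ k ∧ ℓ k ≤ L := by
    intro k hk hkd
    have h1 := le_of_ladder hmax.start hmax.mono hkd
    refine ⟨h1, ?_⟩
    have hsz := hY.size k hk
    rw [ha' k hk, if_pos hkd] at hsz
    have hterm : ∀ j ∈ range (L + 1), 0 ≤ (j : ℤ) * (mult Y k j : ℤ) := fun j _ => by positivity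
    have hL := haL k hk
    by_cases hl : ℓ k = 1
    · have := sum_nonneg hterm
      omega
    · obtain ⟨k, rfl⟩ : ∃ k', k = k' + 1 := ⟨k - 1, by omega⟩
      have hs := hmax.sing k (by omega)
      have hle := hY.le_of_sing hs
      have hm := hs.mult_pos (by omega)
      have h2 := single_le_sum hterm (mem_range.2 (Nat.lt_succ_of_le hle))
      have h3 : ((ℓ (k + 1) - 1 : ℕ) : ℤ) ≤ ((ℓ (k + 1) - 1 : ℕ) : ℤ)
          * (mult Y (k + 1) (ℓ (k + 1) - 1) : ℤ) :=
        le_mul_of_one_le_right (by positivity) (by exact_mod_cast hm)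
      omega
  let W := vac L B' (mult Y)
  let V : ℕ → ℕ → ℤ := fun k n =>
    W k n + reach d ℓ (k - 1) n - 2 * reach d ℓ k n + reach d ℓ (k + 1) n
  let X : ℕ → ℕ → Multiset ℕ := fun k n => Y k n - added d ℓ W k n + removed d ℓ V k n
  have hsub : ∀ k n, added d ℓ W k n ≤ Y k n := by
    intro k n
    unfold added
    split_ifs with h
    · obtain ⟨h1, h2, h3, h4⟩ := h
      obtain ⟨k, rfl⟩ : ∃ k', k = k' + 1 := ⟨k - 1, by omega⟩
      obtain rfl : n = ℓ (k + 1) - 1 := by omega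
      exact Multiset.singleton_le.2 ((hmax.sing k (by omega)).toNat_mem (by omega)).1
    · exact Multiset.zero_le _
  have hmove : Move d ℓ V W X Y := by
    intro k n
    change Y k n - added d ℓ W k n + removed d ℓ V k n + added d ℓ W k n = _
    rw [add_right_comm, tsub_add_cancel_of_le (hsub k n)]
  have hvac : ∀ k n, 1 ≤ k → vac L B (mult X) k n = V k n := fun k n hk => by
    have := hmove.vac_eq hℓ hmax.start hBB hk n
    change vac L B (mult X) k n = vac L B' (mult Y) k n + _ - _ + _
    linarith
  have hrem : ∀ k n, removed d ℓ (vac L B (mult X)) k n = removed d ℓ V k n := by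
    intro k n
    unfold removed
    split_ifs with h
    · rw [hvac k n h.1]
    · rfl
  have hmove' : Move d ℓ (vac L B (mult X)) W X Y := fun k n => by
    rw [hrem]; exact hmove k n
  have hmemX : ∀ k n y, y ∈ X k n → y ∈ Y k n ∨ y ∈ removed d ℓ V k n := by
    intro k n y hy
    rcases Multiset.mem_add.1 hy with hy | hy
    · exact Or.inl (Multiset.mem_of_le tsub_le_self hy)
    · exact Or.inr hy
  have hV : ∀ k n, V (k + 1) n
      = W (k + 1) n + reach d ℓ k n - 2 * reach d ℓ (k + 1) n + reach d ℓ (k + 2) n := by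
    intro k n
    rfl
  have hge : ∀ k, k < d → 0 ≤ V (k + 1) (ℓ (k + 1)) := by
    intro k hk
    rw [hV]
    have hW0 : 0 ≤ W (k + 1) (ℓ (k + 1)) := hY.vac_nonneg hB hta (by omega) _
    have hc := reach_cases hmax.mono k (ℓ (k + 1))
    have hc2 := reach_cases hmax.mono (k + 1) (ℓ (k + 1))
    simp only [show k + 1 + 1 = k + 2 from rfl] at hc2
    by_cases hn : k + 2 ≤ d ∧ ℓ (k + 2) ≤ ℓ (k + 1)
    · omega
    · have : 1 ≤ W (k + 1) (ℓ (k + 1)) :=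
        hmax.vac_pos hY hB ha hta ha' hk le_rfl hn
      omega
  refine ⟨X, ⟨?_, ?_, ?_, ?_, ?_⟩, ⟨hmax.start, hmax.off, hmax.mono, ?_, ?_⟩, hmove'⟩
  · intro n
    rw [hmove.eq_of_not (by omega), hY.node_zero]
  · intro k
    change Y k 0 - added d ℓ W k 0 + removed d ℓ V k 0 = 0
    rw [hY.length_zero, removed, if_neg]
    · simp
    · rintro ⟨h1, h2, h3⟩
      have := hℓ k h1 h2
      omega
  · intro k n hn
    change Y k n - added d ℓ W k n + removed d ℓ V k n = 0
    rw [hY.length_le k n hn, removed, if_neg]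
    · simp
    · rintro ⟨h1, h2, h3⟩
      have := hℓ k h1 h2
      omega
  · intro k hk
    have := hmove.size_eq hℓ k
    rw [hY.size k hk, ha' k hk] at this
    simp only [hk, true_and] at this
    linarith
  · intro k n y hy
    rcases Nat.eq_zero_or_pos k with rfl | hk
    · rw [hmove.eq_of_not (by omega), hY.node_zero] at hy
      simp at hy
    rw [hvac k n hk]
    obtain ⟨k, rfl⟩ : ∃ k', k = k' + 1 := ⟨k - 1, by omega⟩
    rcases hmemX _ _ _ hy with hy | hy
    · rw [hV]
      have hle : (y : ℤ) ≤ W (k + 1) n := hY.label_le _ _ _ hy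
      have hc := reach_cases hmax.mono k n
      rcases reach_cases hmax.mono (k + 1) n with hc2 | hc2 | hc2
      all_goals simp only [show k + 1 + 1 = k + 2 from rfl] at hc2
      · omega
      · have : (y : ℤ) < W (k + 1) n :=
          hY.label_lt (hmax.nonsing k n (by omega) hc2.2.2.2.1 hc2.2.2.2.2) hy
        omega
      · omega
    · unfold removed at hy
      split_ifs at hy with h
      · obtain ⟨h1, h2, rfl⟩ := h
        rw [Multiset.mem_singleton] at hy
        rw [hy, Int.toNat_of_nonneg (hge k (by omega))]
      · simp at hy
  · intro k hk
    right
    refine ⟨(V (k + 1) (ℓ (k + 1))).toNat, ?_, ?_⟩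
    · refine Multiset.mem_add.2 (Or.inr ?_)
      rw [removed, if_pos ⟨by omega, by omega, rfl⟩]
      exact Multiset.mem_singleton_self _
    · rw [hvac _ _ (by omega), Int.toNat_of_nonneg (hge k hk)]
  · intro k n hk hn hn' hs
    have hl := le_of_ladder hmax.start hmax.mono hk
    rcases hs with hs | ⟨y, hy, he⟩
    · omega
    · rw [hvac _ _ (by omega), hV] at he
      rcases hmemX _ _ _ hy with hy | hy
      · have hle : (y : ℤ) ≤ W (k + 1) n := hY.label_le _ _ _ hy
        have hc := reach_cases hmax.mono k n
        have hc2 := reach_cases hmax.mono (k + 1) n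
        simp only [show k + 1 + 1 = k + 2 from rfl] at hc2
        omega
      · rw [removed, if_neg] at hy
        · simp at hy
        · rintro ⟨-, h2, rfl⟩
          exact hn' ⟨h2, le_rfl⟩

lemma IsMinChain.le_of (h : IsMinChain L B X s d ℓ) (h' : IsMinChain L B X s d ℓ') {k : ℕ}
    (hk : k < d) (he : ℓ k = ℓ' k) : ℓ (k + 1) ≤ ℓ' (k + 1) := by
  by_contra hlt
  refine h.nonsing k (ℓ' (k + 1)) hk.le ?_ (by omega) (h'.sing k hk)
  rw [he]
  exact h'.mono k hk

lemma IsMinChain.unique (h : IsMinChain L B X s d ℓ) (h' : IsMinChain L B X s d ℓ') : ℓ = ℓ' := by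
  have : ∀ k, k ≤ d → ℓ k = ℓ' k := by
    intro k
    induction k with
    | zero => intro _; rw [h.start, h'.start]
    | succ k ih =>
      intro hk
      have he := ih (by omega)
      exact le_antisymm (h.le_of h' (by omega) he) (h'.le_of h (by omega) he.symm)
  funext k
  rcases Nat.lt_or_ge d k with hk | hk
  · rw [h.off k hk, h'.off k hk]
  · exact this k hk

lemma IsMaxChain.le_of (h : IsMaxChain L B Y s d ℓ) (h' : IsMaxChain L B Y s d ℓ') {k : ℕ}
    (hk : k < d) (he : k + 2 ≤ d → ℓ (k + 2) = ℓ' (k + 2)) : ℓ (k + 1) ≤ ℓ' (k + 1) := by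
  by_contra hlt
  refine h'.nonsing k (ℓ (k + 1) - 1) hk (by omega) (fun hc => ?_) (h.sing k hk)
  have h1 := he hc.1
  have h2 := h.mono (k + 1) (by omega)
  simp only [show k + 1 + 1 = k + 2 from rfl] at h2
  omega

lemma IsMaxChain.unique (h : IsMaxChain L B Y s d ℓ) (h' : IsMaxChain L B Y s d ℓ') : ℓ = ℓ' := by
  have : ∀ i k, k + i = d → 1 ≤ k → ℓ k = ℓ' k := by
    intro i
    induction i with
    | zero =>
      intro k hk h1
      obtain ⟨k, rfl⟩ : ∃ k', k = k' + 1 := ⟨k - 1, by omega⟩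
      exact le_antisymm (h.le_of h' (by omega) (by omega)) (h'.le_of h (by omega) (by omega))
    | succ i ih =>
      intro k hk h1
      obtain ⟨k, rfl⟩ : ∃ k', k = k' + 1 := ⟨k - 1, by omega⟩
      have he := ih (k + 2) (by omega) (by omega)
      exact le_antisymm (h.le_of h' (by omega) fun _ => he)
        (h'.le_of h (by omega) fun _ => he.symm)
  funext k
  rcases Nat.lt_or_ge d k with hk | hk
  · rw [h.off k hk, h'.off k hk]
  · rcases Nat.eq_zero_or_pos k with rfl | hk0
    · rw [h.start, h'.start]
    · exact this (d - k) k (by omega) hk0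

lemma Move.right_unique
    (h : Move d ℓ (vac L B (mult X)) (vac L B' (mult Y)) X Y)
    (h' : Move d ℓ (vac L B (mult X)) (vac L B' (mult Y')) X Y')
    (hℓ : ∀ k, 1 ≤ k → k ≤ d → 1 ≤ ℓ k ∧ ℓ k ≤ L) (hstart : ℓ 0 = s + 1)
    (hBB : ∀ n, B' n = B n - if s + 1 ≤ n then 1 else 0) : Y = Y' := by
  funext k n
  have hadd : added d ℓ (vac L B' (mult Y)) k n = added d ℓ (vac L B' (mult Y')) k n := by
    unfold added
    split_ifs with hc
    · rw [h.vac_eq hℓ hstart hBB hc.1, h'.vac_eq hℓ hstart hBB hc.1]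
    · rfl
  have h1 := h k n
  rw [hadd, h' k n] at h1
  exact (add_right_cancel h1).symm

lemma Move.left_unique
    (h : Move d ℓ (vac L B (mult X)) (vac L B' (mult Y)) X Y)
    (h' : Move d ℓ (vac L B (mult X')) (vac L B' (mult Y)) X' Y)
    (hℓ : ∀ k, 1 ≤ k → k ≤ d → 1 ≤ ℓ k ∧ ℓ k ≤ L) (hstart : ℓ 0 = s + 1)
    (hBB : ∀ n, B' n = B n - if s + 1 ≤ n then 1 else 0) : X = X' := by
  funext k n
  have hrem : removed d ℓ (vac L B (mult X)) k n = removed d ℓ (vac L B (mult X')) k n := by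
    unfold removed
    split_ifs with hc
    · have h1 := h.vac_eq hℓ hstart hBB hc.1 n
      have h2 := h'.vac_eq hℓ hstart hBB hc.1 n
      rw [show vac L B (mult X) k n = vac L B (mult X') k n by linarith]
    · rfl
  have h1 := h k n
  rw [hrem, ← h' k n] at h1
  exact add_right_cancel h1

end Inverse

/-- `c 1 ≤ ⋯ ≤ c d` are lengths at least `s` of singular strings at the nodes `1, …, d`. -/
def IsChain (L : ℕ) (B : ℕ → ℤ) (X : ℕ → ℕ → Multiset ℕ) (s d : ℕ) (c : ℕ → ℕ) : Prop :=
  c 0 = s ∧ ∀ k, k < d → c k ≤ c (k + 1) ∧ Sing L B X (k + 1) (c (k + 1))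

/-- Existence of a chain of singular strings. -/
def HasChain (L : ℕ) (B : ℕ → ℤ) (X : ℕ → ℕ → Multiset ℕ) (s d : ℕ) : Prop :=
  ∃ c, IsChain L B X s d c

section Chains

variable {d s : ℕ} {ℓ c : ℕ → ℕ} {Y : ℕ → ℕ → Multiset ℕ} {B' a' : ℕ → ℤ}

lemma IsChain.mono {d' : ℕ} (h : IsChain L B X s d c) (hd : d' ≤ d) : IsChain L B X s d' c :=
  ⟨h.1, fun k hk => h.2 k (lt_of_lt_of_le hk hd)⟩

lemma IsChain.update {n : ℕ} (h : IsChain L B X s d c) (hn : c d ≤ n)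
    (hs : Sing L B X (d + 1) n) : IsChain L B X s (d + 1) (Function.update c (d + 1) n) := by
  refine ⟨by rw [Function.update_of_ne (by omega), h.1], fun k hk => ?_⟩
  rcases Nat.lt_succ_iff_lt_or_eq.1 hk with hk | rfl
  · rw [Function.update_of_ne (by omega), Function.update_of_ne (by omega)]
    exact h.2 k hk
  · rw [Function.update_of_ne (by omega), Function.update_self]
    exact ⟨hn, hs⟩

lemma hasChain_zero (L : ℕ) (B : ℕ → ℤ) (X : ℕ → ℕ → Multiset ℕ) (d : ℕ) :
    HasChain L B X 0 d := ⟨fun _ => 0, rfl, fun _ _ => ⟨le_rfl, Or.inl rfl⟩⟩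

lemma hasChain_nil (L : ℕ) (B : ℕ → ℤ) (X : ℕ → ℕ → Multiset ℕ) (s : ℕ) :
    HasChain L B X s 0 := ⟨fun _ => s, rfl, fun k hk => absurd hk (Nat.not_lt_zero k)⟩

lemma HasChain.mono {d' : ℕ} (h : HasChain L B X s d) (hd : d' ≤ d) : HasChain L B X s d' := by
  obtain ⟨c, hc⟩ := h
  exact ⟨c, hc.mono hd⟩

lemma IsChain.pos (h : IsChain L B X (s + 1) d c) {k : ℕ} (hk : k ≤ d) : s + 1 ≤ c k := by
  induction k with
  | zero => exact h.1.ge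
  | succ k ih => exact le_trans (ih (by omega)) (h.2 k (by omega)).1

/-- The greedy chain from below. -/
lemma IsChain.exists_least (h : IsChain L B X s d c) :
    ∃ ℓ, IsChain L B X s d ℓ ∧ (∀ c', IsChain L B X s d c' → ℓ d ≤ c' d) ∧
      ∀ k n, k < d → ℓ k ≤ n → n < ℓ (k + 1) → ¬ Sing L B X (k + 1) n := by
  classical
  induction d with
  | zero => exact ⟨c, h, fun c' hc' => by rw [h.1, hc'.1], fun k n hk => by omega⟩
  | succ d ih =>
    obtain ⟨ℓ, h1, h2, h3⟩ := ih (h.mono (Nat.le_succ d))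
    have hc := h.2 d (Nat.lt_succ_self d)
    have hex : ∃ n, ℓ d ≤ n ∧ Sing L B X (d + 1) n :=
      ⟨c (d + 1), le_trans (h2 c (h.mono (Nat.le_succ d))) hc.1, hc.2⟩
    refine ⟨Function.update ℓ (d + 1) (Nat.find hex),
      h1.update (Nat.find_spec hex).1 (Nat.find_spec hex).2, fun c' hc' => ?_,
      fun k n hk hn hn' => ?_⟩
    · rw [Function.update_self]
      have hd := hc'.2 d (Nat.lt_succ_self d)
      exact Nat.find_min' hex ⟨le_trans (h2 c' (hc'.mono (Nat.le_succ d))) hd.1, hd.2⟩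
    · rw [Function.update_of_ne (by omega)] at hn
      rcases Nat.lt_succ_iff_lt_or_eq.1 hk with hk | rfl
      · rw [Function.update_of_ne (by omega)] at hn'
        exact h3 k n hk hn hn'
      · rw [Function.update_self] at hn'
        exact fun hs => Nat.find_min hex hn' ⟨hn, hs⟩

lemma exists_isMinChain (h : HasChain L B X (s + 1) d) (h' : ¬ HasChain L B X (s + 1) (d + 1)) :
    ∃ ℓ, IsMinChain L B X s d ℓ := by
  obtain ⟨c, hc⟩ := h
  obtain ⟨ℓ, h1, -, h3⟩ := hc.exists_least
  refine ⟨fun k => if k ≤ d then ℓ k else 0, ?_, ?_, ?_, ?_, ?_⟩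
  · simp [h1.1]
  · intro k hk
    simp [hk]
  · intro k hk
    rw [if_pos hk.le, if_pos (by omega)]
    exact (h1.2 k hk).1
  · intro k hk
    rw [if_pos (by omega)]
    exact (h1.2 k hk).2
  · intro k n hk hn hn' hs
    simp only [if_pos hk] at hn
    rcases Nat.lt_or_ge k d with hkd | hkd
    · simp only [show k + 1 ≤ d by omega, if_true, true_and] at hn'
      exact h3 k n hkd hn (by omega) hs
    · obtain rfl : k = d := by omega
      exact h' ⟨_, h1.update hn hs⟩

lemma IsMinChain.hasChain (h : IsMinChain L B X s d ℓ) : HasChain L B X (s + 1) d :=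
  ⟨ℓ, h.start, fun k hk => ⟨h.mono k hk, h.sing k hk⟩⟩

lemma IsMinChain.not_hasChain (h : IsMinChain L B X s d ℓ) :
    ¬ HasChain L B X (s + 1) (d + 1) := by
  rintro ⟨c, hc⟩
  have hle : ∀ k, k ≤ d → ℓ k ≤ c k := by
    intro k
    induction k with
    | zero => intro _; rw [h.start, hc.1]
    | succ k ih =>
      intro hk
      by_contra hlt
      have h1 := hc.2 k (by omega)
      exact h.nonsing k (c (k + 1)) (by omega) (le_trans (ih (by omega)) h1.1) (by omega) h1.2
  have h1 := hc.2 d (by omega)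
  exact h.nonsing d (c (d + 1)) le_rfl (le_trans (hle d le_rfl) h1.1) (by omega) h1.2

/-- The greedy chain from above. -/
lemma IsChain.exists_greatest (h : IsChain L B X s d c) (u : ℕ) (hu : c d ≤ u) :
    ∃ ℓ, IsChain L B X s d ℓ ∧ ℓ d ≤ u ∧
      (∀ k n, k + 1 < d → ℓ (k + 1) < n → n ≤ ℓ (k + 2) → ¬ Sing L B X (k + 1) n) ∧
      (∀ n, 0 < d → ℓ d < n → n ≤ u → ¬ Sing L B X d n) := by
  classical
  induction d generalizing u with
  | zero => exact ⟨c, h, hu, fun k n hk => by omega, fun n hd => by omega⟩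
  | succ d ih =>
    have hc := h.2 d (Nat.lt_succ_self d)
    let g := Nat.findGreatest (fun n => Sing L B X (d + 1) n) u
    have hg1 : c (d + 1) ≤ g := Nat.le_findGreatest hu hc.2
    have hg2 : Sing L B X (d + 1) g :=
      Nat.findGreatest_spec (P := fun n => Sing L B X (d + 1) n) hu hc.2
    have hg3 : g ≤ u := Nat.findGreatest_le u
    obtain ⟨ℓ, h1, h2, h3, h4⟩ := ih (h.mono (Nat.le_succ d)) g (le_trans hc.1 hg1)
    refine ⟨Function.update ℓ (d + 1) g, h1.update h2 hg2, by rwa [Function.update_self],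
      fun k n hk hn hn' => ?_, fun n _ hn hn' => ?_⟩
    · rw [Function.update_of_ne (by omega)] at hn
      rcases Nat.lt_or_ge (k + 1) d with hkd | hkd
      · rw [Function.update_of_ne (by omega)] at hn'
        exact h3 k n hkd hn hn'
      · obtain rfl : d = k + 1 := by omega
        rw [show k + 2 = k + 1 + 1 from rfl, Function.update_self] at hn'
        exact h4 n (by omega) hn hn'
    · rw [Function.update_self] at hn
      exact Nat.findGreatest_is_greatest hn hn'

lemma IsRC.exists_isMaxChain (hY : IsRC L B a Y) (h : HasChain L B Y s d) :
    ∃ ℓ, IsMaxChain L B Y s d ℓ := by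
  obtain ⟨c, hc⟩ := h
  obtain ⟨ℓ, h1, h2, h3, h4⟩ := hc.exists_greatest (max L (c d)) (le_max_right _ _)
  refine ⟨fun k => if k ≤ d then ℓ k + 1 else 0, ?_, ?_, ?_, ?_, ?_⟩
  · simp [h1.1]
  · intro k hk
    simp [hk]
  · intro k hk
    rw [if_pos hk.le, if_pos (by omega)]
    have := (h1.2 k hk).1
    omega
  · intro k hk
    rw [if_pos (by omega)]
    exact (h1.2 k hk).2
  · intro k n hk hn hn' hs
    rw [if_pos (by omega)] at hn
    rcases Nat.lt_or_ge (k + 1) d with hkd | hkd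
    · simp only [show k + 2 ≤ d by omega, if_true, true_and] at hn'
      exact h3 k n hkd (by omega) (by omega) hs
    · obtain rfl : d = k + 1 := by omega
      exact h4 n (by omega) (by omega) (le_trans (hY.le_of_sing hs) (le_max_left _ _)) hs

lemma IsMaxChain.hasChain (h : IsMaxChain L B Y s d ℓ) : HasChain L B Y s d := by
  refine ⟨fun k => ℓ k - 1, ?_, fun k hk => ⟨?_, h.sing k hk⟩⟩
  · simp [h.start]
  · have := h.mono k hk
    dsimp only
    omega

end Chains

lemma ncard_eq_of_relation {α β : Type*} {A : Set α} {C : Set β} (R : α → β → Prop)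
    (h1 : ∀ x ∈ A, ∃ y ∈ C, R x y) (h2 : ∀ y ∈ C, ∃ x ∈ A, R x y)
    (h3 : ∀ x ∈ A, ∀ y ∈ C, ∀ y' ∈ C, R x y → R x y' → y = y')
    (h4 : ∀ x ∈ A, ∀ x' ∈ A, ∀ y ∈ C, R x y → R x' y → x = x') : A.ncard = C.ncard := by
  choose f hf using h1
  refine Set.ncard_congr f (fun x hx => (hf x hx).1) ?_ ?_
  · intro x x' hx hx' he
    refine h4 x hx x' hx' (f x hx) (hf x hx).1 (hf x hx).2 ?_
    rw [he]
    exact (hf x' hx').2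
  · intro y hy
    obtain ⟨x, hx, hR⟩ := h2 y hy
    exact ⟨x, hx, h3 x hx _ (hf x hx).1 y hy (hf x hx).2 hR⟩

/-- The rigged configurations with a chain of singular strings at the nodes `1, …, d`. -/
def chainSet (L : ℕ) (B a : ℕ → ℤ) (s d : ℕ) : Set (ℕ → ℕ → Multiset ℕ) :=
  {X | IsRC L B a X ∧ HasChain L B X s d}

section Count

variable {d s : ℕ} {B' a' : ℕ → ℤ}

/-- The box removal bijection. -/
theorem ncard_chainSet_diff (hB : IsSource B) (hB' : IsSource B') (ha : IsTailSum a)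
    (hta : IsTailSum a') (haL : ∀ k, 1 ≤ k → a k ≤ L)
    (hstrict : B s + B (s + 2) + 1 ≤ 2 * B (s + 1))
    (hBB : ∀ n, B' n = B n - if s + 1 ≤ n then 1 else 0)
    (ha' : ∀ k, 1 ≤ k → a' k = a k - if k ≤ d then 1 else 0) :
    (chainSet L B a (s + 1) d \ chainSet L B a (s + 1) (d + 1)).ncard
      = (chainSet L B' a' s d).ncard := by
  have hℓ : ∀ {X ℓ}, IsRC L B a X → IsMinChain L B X s d ℓ →
      ∀ k, 1 ≤ k → k ≤ d → 1 ≤ ℓ k ∧ ℓ k ≤ L := by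
    intro X ℓ hX hmin k hk hkd
    refine ⟨le_of_ladder hmin.start hmin.mono hkd, ?_⟩
    obtain ⟨k, rfl⟩ : ∃ k', k = k' + 1 := ⟨k - 1, by omega⟩
    exact hX.le_of_sing (hmin.sing k (by omega))
  refine ncard_eq_of_relation (fun X Y => ∃ ℓ, IsMinChain L B X s d ℓ ∧ IsMaxChain L B' Y s d ℓ ∧
    Move d ℓ (vac L B (mult X)) (vac L B' (mult Y)) X Y) ?_ ?_ ?_ ?_
  · rintro X ⟨⟨hX, hc⟩, hn⟩
    obtain ⟨ℓ, hmin⟩ := exists_isMinChain hc fun h => hn ⟨hX, h⟩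
    obtain ⟨Y, hY, hmax, hmove⟩ := hmin.exists_move hX hB ha hstrict hBB ha'
    exact ⟨Y, ⟨hY, hmax.hasChain⟩, ℓ, hmin, hmax, hmove⟩
  · rintro Y ⟨hY, hc⟩
    obtain ⟨ℓ, hmax⟩ := hY.exists_isMaxChain hc
    obtain ⟨X, hX, hmin, hmove⟩ := hmax.exists_move hY hB' ha hta haL hBB ha'
    exact ⟨X, ⟨⟨hX, hmin.hasChain⟩, fun h => hmin.not_hasChain h.2⟩, ℓ, hmin, hmax, hmove⟩
  · rintro X ⟨⟨hX, -⟩, -⟩ Y - Y' - ⟨ℓ, h1, -, h3⟩ ⟨ℓ', h1', -, h3'⟩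
    obtain rfl := h1.unique h1'
    exact h3.right_unique h3' (hℓ hX h1) h1.start hBB
  · rintro X ⟨⟨hX, -⟩, -⟩ X' - Y - ⟨ℓ, h1, h2, h3⟩ ⟨ℓ', -, h2', h3'⟩
    obtain rfl := h2.unique h2'
    exact h3.left_unique h3' (hℓ hX h1) h1.start hBB

lemma chainSet_diff_eq_empty (hB : IsSource B) (ha : IsTailSum a)
    (hstrict : B s + B (s + 2) + 1 ≤ 2 * B (s + 1)) (hd : 1 ≤ d)
    (h0 : a d - 2 * a (d + 1) + a (d + 2) ≤ 0) :
    chainSet L B a (s + 1) d \ chainSet L B a (s + 1) (d + 1) = ∅ := by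
  refine Set.eq_empty_of_forall_notMem ?_
  rintro X ⟨⟨hX, hc⟩, hn⟩
  obtain ⟨ℓ, hmin⟩ := exists_isMinChain hc fun h => hn ⟨hX, h⟩
  have h1 := hmin.vac_pos hX hB ha hstrict le_rfl (le_max_left (ℓ d) L) (by omega)
  rw [hX.vac_eq hd (le_max_right _ _)] at h1
  omega

lemma chainSet_eq_empty (hd : 1 ≤ d) (h0 : a d = 0) : chainSet L B a (s + 1) d = ∅ := by
  refine Set.eq_empty_of_forall_notMem ?_
  rintro X ⟨hX, c, hc⟩
  obtain ⟨d, rfl⟩ : ∃ d', d = d' + 1 := ⟨d - 1, by omega⟩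
  have hpos := hc.pos le_rfl
  have hs := (hc.2 d (by omega)).2
  have hm := hs.mult_pos (by omega)
  have hle := hX.le_of_sing hs
  have hsz := hX.size (d + 1) (by omega)
  rw [h0, sum_eq_zero_iff_of_nonneg fun j _ => by positivity] at hsz
  have := hsz (c (d + 1)) (mem_range.2 (by omega))
  rcases mul_eq_zero.1 this with h | h <;> omega

lemma chainSet_succ_subset : chainSet L B a s (d + 1) ⊆ chainSet L B a s d :=
  fun _ hX => ⟨hX.1, hX.2.mono (Nat.le_succ d)⟩

end Count

section Finiteness

/-- Doubly indexed families with finitely many values and bounded support form a finite set. -/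
lemma finite_families {β : Type*} (F : Set β) (hF : F.Finite) (z : β) (K : ℕ) :
    {X : ℕ → ℕ → β | (∀ k n, X k n ∈ F) ∧ ∀ k n, K ≤ k ∨ K ≤ n → X k n = z}.Finite := by
  refine Set.Finite.of_finite_image (f := fun X (i : Fin K × Fin K) => X i.1 i.2) ?_ ?_
  · refine (Set.Finite.pi' (t := fun _ : Fin K × Fin K => F) fun _ => hF).subset ?_
    rintro _ ⟨X, hX, rfl⟩ i
    exact hX.1 _ _
  · intro X hX Y hY h
    funext k n
    by_cases hkn : K ≤ k ∨ K ≤ n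
    · rw [hX.2 k n hkn, hY.2 k n hkn]
    · push Not at hkn
      exact congrFun h (⟨k, hkn.1⟩, ⟨n, hkn.2⟩)

lemma finite_multisets (c v : ℕ) : {s : Multiset ℕ | s.card ≤ c ∧ ∀ y ∈ s, y ≤ v}.Finite := by
  refine (Multiset.finite_toSet (c • Multiset.range (v + 1)).powerset).subset ?_
  rintro s ⟨hs, hv⟩
  simp only [Set.mem_ofPred_eq, Multiset.mem_powerset]
  refine Multiset.le_iff_count.2 fun y => ?_
  by_cases hy : y ∈ s
  · rw [Multiset.count_nsmul, Multiset.count_eq_one_of_mem (Multiset.nodup_range _)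
      (Multiset.mem_range.2 (Nat.lt_succ_of_le (hv y hy))), mul_one]
    exact (Multiset.count_le_card y s).trans hs
  · rw [Multiset.count_eq_zero_of_notMem hy]
    exact Nat.zero_le _

end Finiteness

section TailSums

/-- Partitions of size at most `L`, with parts indexed from `0`. -/
structure IsShape (L : ℕ) (p : ℕ → ℕ) : Prop where
  anti : ∀ i, p (i + 1) ≤ p i
  eq_zero : ∀ i, L ≤ i → p i = 0
  sum_le : ∑ i ∈ range L, p i ≤ L

/-- The sum of the parts `p (k - 1), p k, …`. -/
def tailSum (L : ℕ) (p : ℕ → ℕ) (k : ℕ) : ℤ :=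
  ∑ i ∈ range L, if k ≤ i + 1 then (p i : ℤ) else 0

variable {p : ℕ → ℕ}

lemma IsShape.le_part (hp : IsShape L p) (i : ℕ) : p i ≤ L := by
  by_cases hi : i < L
  · exact le_trans (single_le_sum (fun _ _ => Nat.zero_le _) (mem_range.2 hi)) hp.sum_le
  · rw [hp.eq_zero i (by omega)]
    exact Nat.zero_le _

lemma IsShape.antitone (hp : IsShape L p) : Antitone p := antitone_nat_of_succ_le hp.anti

lemma tailSum_succ (hp : IsShape L p) (k : ℕ) :
    tailSum L p (k + 1) = tailSum L p (k + 2) + p k := by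
  have h1 : ((p k : ℕ) : ℤ) = ∑ i ∈ range L, if i = k then (p i : ℤ) else 0 := by
    rw [Finset.sum_ite_eq']
    split_ifs with h
    · rfl
    · rw [hp.eq_zero k (by simpa using h)]
      rfl
  unfold tailSum
  rw [h1, ← sum_add_distrib]
  refine sum_congr rfl fun i _ => ?_
  split_ifs <;> omega

lemma IsShape.isTailSum (hp : IsShape L p) : IsTailSum (tailSum L p) := by
  intro k hk
  obtain ⟨k, rfl⟩ : ∃ k', k = k' + 1 := ⟨k - 1, by omega⟩
  have h1 := tailSum_succ hp k
  have h2 := tailSum_succ hp (k + 1)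
  have h3 := hp.anti k
  simp only [add_assoc, Nat.reduceAdd] at *
  omega

lemma IsShape.tailSum_le (hp : IsShape L p) (k : ℕ) : tailSum L p k ≤ L := by
  have h : tailSum L p k ≤ ((∑ i ∈ range L, p i : ℕ) : ℤ) := by
    rw [Nat.cast_sum]
    refine sum_le_sum fun i _ => ?_
    split_ifs <;> simp
  exact h.trans (by exact_mod_cast hp.sum_le)

lemma tailSum_eq_zero {k : ℕ} (hk : L < k) : tailSum L p k = 0 := by
  refine sum_eq_zero fun i hi => if_neg ?_
  have := mem_range.1 hi
  omega

lemma IsShape.update (hp : IsShape L p) {d : ℕ} (hd : p (d + 1) < p d) :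
    IsShape L (Function.update p d (p d - 1)) := by
  have hle : ∀ i, Function.update p d (p d - 1) i ≤ p i := by
    intro i
    rcases eq_or_ne i d with rfl | h
    · simp
    · rw [Function.update_of_ne h]
  refine ⟨fun i => ?_, fun i hi => Nat.le_zero.1 (hp.eq_zero i hi ▸ hle i),
    (sum_le_sum fun i _ => hle i).trans hp.sum_le⟩
  rcases eq_or_ne i d with rfl | h
  · rw [Function.update_self, Function.update_of_ne (by omega)]
    omega
  · rw [Function.update_of_ne h]
    exact (hle _).trans (hp.anti i)

lemma IsShape.tailSum_update (hp : IsShape L p) {d : ℕ} (hd : p (d + 1) < p d) (k : ℕ) :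
    tailSum L (Function.update p d (p d - 1)) k
      = tailSum L p k - if k ≤ d + 1 then 1 else 0 := by
  have hdL : d < L := by
    by_contra h
    rw [hp.eq_zero d (by omega)] at hd
    omega
  have h1 : (if k ≤ d + 1 then (1 : ℤ) else 0)
      = ∑ i ∈ range L, if i = d then (if k ≤ d + 1 then 1 else 0) else 0 := by
    rw [Finset.sum_ite_eq', if_pos (mem_range.2 hdL)]
  unfold tailSum
  rw [h1, ← sum_sub_distrib]
  refine sum_congr rfl fun i _ => ?_
  rcases eq_or_ne i d with rfl | h
  · rw [Function.update_self, if_pos rfl]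
    split_ifs <;> omega
  · rw [Function.update_of_ne h, if_neg h, sub_zero]

/-- The source term of `N` unbounded rows and one row of length `s`. -/
def source (N s n : ℕ) : ℤ := n * N + (min n s : ℕ)

lemma isSource_source {N : ℕ} (hN : 1 ≤ N) (s : ℕ) : IsSource (fun n => source N s n) := by
  refine ⟨by simp [source], fun n => ?_, fun C => ⟨C.toNat, fun n hn => ?_⟩⟩
  · unfold source
    push_cast
    have : ((n : ℤ) + 2) * N + n * N = 2 * ((n + 1) * N) := by ring
    omega
  · unfold source
    have : (n : ℤ) * 1 ≤ n * N := mul_le_mul_of_nonneg_left (by exact_mod_cast hN) (by simp)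
    omega

lemma source_strict (N s : ℕ) :
    source N (s + 1) s + source N (s + 1) (s + 2) + 1 ≤ 2 * source N (s + 1) (s + 1) := by
  unfold source
  push_cast
  have : ((s : ℤ) + 2) * N + s * N = 2 * ((s + 1) * N) := by ring
  omega

lemma source_eq_sub (N s n : ℕ) :
    source N s n = source N (s + 1) n - if s + 1 ≤ n then 1 else 0 := by
  unfold source
  split_ifs <;> omega

end TailSums

lemma IsRC.node_eq_zero (h : IsRC L B a X) {k : ℕ} (hk : 1 ≤ k) (ha : a k = 0) (n : ℕ) :
    X k n = 0 := by
  rcases Nat.eq_zero_or_pos n with rfl | hn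
  · exact h.length_zero k
  rcases Nat.lt_or_ge L n with hL | hL
  · exact h.length_le k n hL
  have hsz := h.size k hk
  rw [ha, sum_eq_zero_iff_of_nonneg fun j _ => by positivity] at hsz
  rcases mul_eq_zero.1 (hsz n (mem_range.2 (by omega))) with h | h
  · omega
  · exact Multiset.card_eq_zero.1 (by exact_mod_cast h)

lemma IsRC.mult_le (h : IsRC L B a X) (ha : ∀ k, 1 ≤ k → a k ≤ L) (k n : ℕ) :
    mult X k n ≤ L := by
  by_cases hk : k = 0
  · simp [mult, hk, h.node_zero]
  by_cases hn : n = 0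
  · simp [mult, hn, h.length_zero]
  by_cases hL : L < n
  · simp [h.mult_eq_zero k n hL]
  have h1 := single_le_sum (f := fun j : ℕ => (j : ℤ) * (mult X k j : ℤ))
    (fun j _ => by positivity) (mem_range.2 (show n < L + 1 by omega))
  rw [h.size k (by omega)] at h1
  have h2 : (1 : ℤ) * mult X k n ≤ n * mult X k n :=
    mul_le_mul_of_nonneg_right (by omega) (by positivity)
  have := ha k (by omega)
  omega

lemma colSum_nonneg (m : ℕ → ℕ) (n : ℕ) : 0 ≤ colSum L m n :=
  sum_nonneg fun _ _ => by positivity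

lemma IsRC.colSum_le (h : IsRC L B a X) (ha : ∀ k, 1 ≤ k → a k ≤ L) (k n : ℕ) :
    colSum L (mult X k) n ≤ L := by
  by_cases hk : k = 0
  · subst hk
    rw [colSum_of_zero L h.mult_zero]
    positivity
  refine le_trans ?_ (ha k (by omega))
  rw [← h.size k (by omega)]
  refine sum_le_sum fun j _ => mul_le_mul_of_nonneg_right ?_ (by positivity)
  exact_mod_cast min_le_right n j

/-- There are finitely many rigged configurations. -/
lemma finite_isRC (B : ℕ → ℤ) (ha : ∀ k, 1 ≤ k → a k ≤ L) (ha0 : ∀ k, L < k → a k = 0) :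
    {X | IsRC L B a X}.Finite := by
  let V := ∑ n ∈ range (L + 1), (B n).natAbs
  refine (finite_families _ (finite_multisets L (V + 2 * L)) 0 (L + 1)).subset ?_
  intro X hX
  refine ⟨fun k n => ⟨hX.mult_le ha k n, fun y hy => ?_⟩, fun k n hkn => ?_⟩
  · have h1 := hX.label_le k n y hy
    have hn : n ≤ L := by
      by_contra hn
      rw [hX.length_le k n (by omega)] at hy
      simp at hy
    have h2 : (B n).natAbs ≤ V :=
      single_le_sum (f := fun n => (B n).natAbs) (fun _ _ => Nat.zero_le _)
        (mem_range.2 (show n < L + 1 by omega))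
    have h3 := hX.colSum_le ha (k - 1) n
    have h4 := hX.colSum_le ha (k + 1) n
    have h5 := colSum_nonneg (L := L) (mult X k) n
    unfold vac at h1
    split_ifs at h1 <;> omega
  · rcases hkn with h | h
    · exact hX.node_eq_zero (by omega) (ha0 k (by omega)) n
    · exact hX.length_le k n (by omega)

section Tableaux

/-- `e` is a semistandard Young tableau of shape `p` with entries in `{1, …, M}`. -/
structure IsTableau (M : ℕ) (p : ℕ → ℕ) (e : ℕ → ℕ → ℕ) : Prop where
  pos : ∀ r c, c < p r → 1 ≤ e r c
  le_bound : ∀ r c, c < p r → e r c ≤ M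
  row_weak : ∀ r c₁ c₂, c₁ ≤ c₂ → c₂ < p r → e r c₁ ≤ e r c₂
  col_strict : ∀ r₁ r₂ c, r₁ < r₂ → c < p r₂ → e r₁ c < e r₂ c
  zero_outside : ∀ r c, p r ≤ c → e r c = 0

/-- The number of boxes with entry `M`. -/
def entryCount (L M : ℕ) (e : ℕ → ℕ → ℕ) : ℕ :=
  #{x ∈ range L ×ˢ range L | e x.1 x.2 = M}

/-- The tableaux with `s` boxes (at most `s` boxes if `d = 0`) containing the largest entry,
none of them in the first `d - 1` rows. -/
def tableauSet (L M : ℕ) (p : ℕ → ℕ) (s d : ℕ) : Set (ℕ → ℕ → ℕ) :=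
  {e | IsTableau M p e ∧ (∀ r c, r + 1 < d → e r c ≠ M) ∧
    if d = 0 then entryCount L M e ≤ s else entryCount L M e = s}

variable {M s d : ℕ} {p : ℕ → ℕ} {e : ℕ → ℕ → ℕ}

lemma IsTableau.lt_of_ne_zero (he : IsTableau M p e) {r c : ℕ} (h : e r c ≠ 0) : c < p r := by
  by_contra hc
  exact h (he.zero_outside r c (by omega))

lemma IsTableau.le (he : IsTableau M p e) (r c : ℕ) : e r c ≤ M := by
  by_cases h : c < p r
  · exact he.le_bound r c h
  · rw [he.zero_outside r c (by omega)]
    exact Nat.zero_le _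

lemma finite_isTableau (hp : IsShape L p) (M : ℕ) : {e | IsTableau M p e}.Finite := by
  refine (finite_families _ (Set.finite_Iic M) 0 L).subset ?_
  intro e he
  refine ⟨fun r c => he.le r c, fun r c h => he.zero_outside r c ?_⟩
  rcases h with h | h
  · rw [hp.eq_zero r h]
    exact Nat.zero_le _
  · exact (hp.le_part r).trans h

lemma finite_tableauSet (hp : IsShape L p) : (tableauSet L M p s d).Finite :=
  (finite_isTableau hp M).subset fun _ h => h.1

lemma IsShape.lt_of_lt_part (hp : IsShape L p) {r c : ℕ} (h : c < p r) : r < L ∧ c < L := by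
  refine ⟨?_, lt_of_lt_of_le h (hp.le_part r)⟩
  by_contra hr
  rw [hp.eq_zero r (by omega)] at h
  omega

lemma IsTableau.entryCount_eq_zero_iff (he : IsTableau (M + 1) p e) (hp : IsShape L p) :
    entryCount L (M + 1) e = 0 ↔ ∀ r c, e r c ≠ M + 1 := by
  rw [entryCount, card_eq_zero, filter_eq_empty_iff]
  refine ⟨fun h r c hrc => ?_, fun h x _ => h _ _⟩
  have h1 := hp.lt_of_lt_part (he.lt_of_ne_zero (by omega : e r c ≠ 0))
  exact h (x := (r, c)) (by simp [h1]) hrc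

lemma tableauSet_zero (hp : IsShape L p) (d : ℕ) :
    tableauSet L (M + 1) p 0 d = {e | IsTableau M p e} := by
  ext e
  constructor
  · rintro ⟨he, -, hc⟩
    have h0 : entryCount L (M + 1) e = 0 := by split_ifs at hc <;> omega
    rw [he.entryCount_eq_zero_iff hp] at h0
    exact ⟨he.pos, fun r c h => Nat.lt_succ_iff.1 (lt_of_le_of_ne (he.le r c) (h0 r c)),
      he.row_weak, he.col_strict, he.zero_outside⟩
  · intro he
    have he' : IsTableau (M + 1) p e := ⟨he.pos, fun r c h => (he.le r c).trans (Nat.le_succ M),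
      he.row_weak, he.col_strict, he.zero_outside⟩
    have hne : ∀ r c, e r c ≠ M + 1 := fun r c h => by
      have := he.le r c
      omega
    have h0 := (he'.entryCount_eq_zero_iff hp).2 hne
    refine ⟨he', fun r c _ => hne r c, ?_⟩
    split_ifs <;> omega

lemma tableauSet_of_le (h : L * L ≤ s) : tableauSet L M p s 0 = {e | IsTableau M p e} := by
  ext e
  refine ⟨fun he => he.1, fun he => ⟨he, fun r c hr => by omega, ?_⟩⟩
  rw [if_pos rfl]
  refine le_trans ((card_filter_le _ _).trans ?_) h
  rw [card_product, card_range]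

lemma tableauSet_succ_subset : tableauSet L M p s (d + 1) ⊆ tableauSet L M p s d := by
  rintro e ⟨he, h1, h2⟩
  refine ⟨he, fun r c hr => h1 r c (by omega), ?_⟩
  rw [if_neg (by omega)] at h2
  split_ifs <;> omega

lemma tableauSet_diff_zero :
    tableauSet L M p (s + 1) 0 \ tableauSet L M p (s + 1) 1 = tableauSet L M p s 0 := by
  ext e
  constructor
  · rintro ⟨⟨he, h1, h2⟩, h3⟩
    refine ⟨he, h1, ?_⟩
    rw [if_pos rfl] at h2 ⊢
    by_contra h4
    exact h3 ⟨he, fun r c hr => by omega, by rw [if_neg (by omega)]; omega⟩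
  · rintro ⟨he, h1, h2⟩
    rw [if_pos rfl] at h2
    refine ⟨⟨he, h1, by rw [if_pos rfl]; omega⟩, fun h => ?_⟩
    have h3 := h.2.2
    rw [if_neg (by omega)] at h3
    omega

lemma tableauSet_eq_empty (hp : IsShape L p) (hd : L < d) :
    tableauSet L (M + 1) p (s + 1) d = ∅ := by
  refine Set.eq_empty_of_forall_notMem ?_
  rintro e ⟨he, h1, h2⟩
  rw [if_neg (by omega)] at h2
  have h0 : entryCount L (M + 1) e = 0 := by
    refine (he.entryCount_eq_zero_iff hp).2 fun r c hrc => ?_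
    have h3 := hp.lt_of_lt_part (he.lt_of_ne_zero (by omega : e r c ≠ 0))
    exact h1 r c (by omega) hrc
  omega

lemma last_of_mem_diff
    (h : e ∈ tableauSet L (M + 1) p s (d + 1) \ tableauSet L (M + 1) p s (d + 2)) :
    0 < p d ∧ e d (p d - 1) = M + 1 := by
  obtain ⟨⟨he, h1, h2⟩, h3⟩ := h
  rw [if_neg (by omega)] at h2
  have hex : ∃ r c, r + 1 < d + 2 ∧ e r c = M + 1 := by
    by_contra! h4
    exact h3 ⟨he, h4, by rw [if_neg (by omega)]; exact h2⟩
  obtain ⟨r, c, hr, hrc⟩ := hex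
  have hrd : r = d := by
    by_contra hne
    exact h1 r c (by omega) hrc
  subst hrd
  have hc := he.lt_of_ne_zero (by omega : e r c ≠ 0)
  have h5 := he.row_weak r c (p r - 1) (by omega) (by omega)
  have h6 := he.le r (p r - 1)
  omega

lemma tableauSet_diff_eq_empty (hd : p d ≤ p (d + 1)) :
    tableauSet L (M + 1) p s (d + 1) \ tableauSet L (M + 1) p s (d + 2) = ∅ := by
  refine Set.eq_empty_of_forall_notMem fun e h => ?_
  obtain ⟨h1, h2⟩ := last_of_mem_diff h
  have h3 := h.1.1.col_strict d (d + 1) (p d - 1) (by omega) (by omega)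
  have h4 := h.1.1.le (d + 1) (p d - 1)
  omega

/-- Change the entry of one box. -/
def setEntry (e : ℕ → ℕ → ℕ) (r₀ c₀ v : ℕ) : ℕ → ℕ → ℕ :=
  fun r c => if r = r₀ ∧ c = c₀ then v else e r c

lemma setEntry_setEntry (e : ℕ → ℕ → ℕ) (r₀ c₀ v w : ℕ) (h : e r₀ c₀ = w) :
    setEntry (setEntry e r₀ c₀ v) r₀ c₀ w = e := by
  funext r c
  unfold setEntry
  split_ifs with h1
  · rw [h1.1, h1.2, h]
  · rfl

lemma entryCount_setEntry {r₀ c₀ : ℕ} (hr : r₀ < L) (hc : c₀ < L) (h : e r₀ c₀ = M + 1) :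
    entryCount L (M + 1) e = entryCount L (M + 1) (setEntry e r₀ c₀ 0) + 1 := by
  unfold entryCount
  have hmem : ((r₀, c₀) : ℕ × ℕ) ∈ ({x ∈ range L ×ˢ range L | e x.1 x.2 = M + 1} : Finset _) := by
    simp [hr, hc, h]
  rw [← card_erase_add_one hmem]
  congr 2
  ext ⟨r, c⟩
  rw [mem_erase, mem_filter, mem_filter, setEntry, ne_eq, Prod.mk.injEq]
  dsimp only
  split_ifs with h1 <;> simp [h1]

lemma lt_update_iff (hd : 0 < p d) (r c : ℕ) :
    c < Function.update p d (p d - 1) r ↔ c < p r ∧ ¬ (r = d ∧ c = p d - 1) := by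
  rcases eq_or_ne r d with rfl | h
  · rw [Function.update_self]
    omega
  · rw [Function.update_of_ne h]
    omega

lemma IsTableau.removeEntry (he : IsTableau M p e) (hd : 0 < p d) :
    IsTableau M (Function.update p d (p d - 1)) (setEntry e d (p d - 1) 0) := by
  have hlt := lt_update_iff hd
  refine ⟨fun r c h => ?_, fun r c h => ?_, fun r c₁ c₂ hc h => ?_, fun r₁ r₂ c hr h => ?_,
    fun r c h => ?_⟩
  · rw [hlt] at h
    rw [setEntry, if_neg h.2]
    exact he.pos r c h.1
  · rw [hlt] at h
    rw [setEntry, if_neg h.2]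
    exact he.le_bound r c h.1
  · rw [hlt] at h
    unfold setEntry
    rw [if_neg h.2]
    split_ifs
    · exact Nat.zero_le _
    · exact he.row_weak r c₁ c₂ hc h.1
  · rw [hlt] at h
    unfold setEntry
    rw [if_neg h.2]
    split_ifs
    · exact he.pos r₂ c h.1
    · exact he.col_strict r₁ r₂ c hr h.1
  · rw [← not_lt, hlt] at h
    unfold setEntry
    split_ifs with h1
    · rfl
    · exact he.zero_outside r c (not_lt.1 fun h2 => h ⟨h2, h1⟩)

lemma IsTableau.addEntry (hp : IsShape L p) (hd : p (d + 1) < p d)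
    (he : IsTableau (M + 1) (Function.update p d (p d - 1)) e)
    (h : ∀ r c, r < d → e r c ≠ M + 1) :
    IsTableau (M + 1) p (setEntry e d (p d - 1) (M + 1)) := by
  have hlt := lt_update_iff (show 0 < p d by omega)
  refine ⟨fun r c hc => ?_, fun r c hc => ?_, fun r c₁ c₂ hc hc₂ => ?_,
    fun r₁ r₂ c hr hc => ?_, fun r c hc => ?_⟩
  · unfold setEntry
    split_ifs with h1
    · omega
    · exact he.pos r c ((hlt r c).2 ⟨hc, h1⟩)
  · unfold setEntry
    split_ifs with h1
    · exact le_rfl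
    · exact he.le r c
  · unfold setEntry
    split_ifs with h1 h2 h2
    · exact le_rfl
    · obtain ⟨rfl, rfl⟩ := h1
      omega
    · exact he.le r c₁
    · exact he.row_weak r c₁ c₂ hc ((hlt r c₂).2 ⟨hc₂, h2⟩)
  · unfold setEntry
    split_ifs with h1 h2 h2
    · omega
    · obtain ⟨rfl, rfl⟩ := h1
      have := hp.antitone (show r₁ + 1 ≤ r₂ by omega)
      omega
    · exact lt_of_le_of_ne (he.le r₁ c) (h r₁ c (by omega))
    · exact he.col_strict r₁ r₂ c hr ((hlt r₂ c).2 ⟨hc, h2⟩)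
  · rw [setEntry, if_neg (by rintro ⟨rfl, rfl⟩; omega)]
    refine he.zero_outside r c (not_lt.1 fun h1 => ?_)
    have := ((hlt r c).1 h1).1
    omega

theorem ncard_tableauSet_diff (hp : IsShape L p) (hd : p (d + 1) < p d) :
    (tableauSet L (M + 1) p (s + 1) (d + 1) \ tableauSet L (M + 1) p (s + 1) (d + 2)).ncard
      = (tableauSet L (M + 1) (Function.update p d (p d - 1)) s (d + 1)).ncard := by
  have hL := hp.lt_of_lt_part (show p d - 1 < p d by omega)
  refine Set.ncard_congr (fun e _ => setEntry e d (p d - 1) 0) ?_ ?_ ?_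
  · intro e h
    have h1 := last_of_mem_diff h
    obtain ⟨⟨he, h2, h3⟩, -⟩ := h
    rw [if_neg (by omega)] at h3
    refine ⟨he.removeEntry (by omega), fun r c hr => ?_, ?_⟩
    · unfold setEntry
      split_ifs
      · omega
      · exact h2 r c hr
    · rw [if_neg (by omega)]
      have := entryCount_setEntry hL.1 hL.2 h1.2
      omega
  · intro e e' h h' heq
    rw [← setEntry_setEntry e d (p d - 1) 0 _ (last_of_mem_diff h).2, heq,
      setEntry_setEntry e' d (p d - 1) 0 _ (last_of_mem_diff h').2]
  · rintro e ⟨he, h2, h3⟩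
    rw [if_neg (by omega)] at h3
    have h0 : e d (p d - 1) = 0 := he.zero_outside _ _ (by rw [Function.update_self])
    have h4 : setEntry (setEntry e d (p d - 1) (M + 1)) d (p d - 1) 0 = e :=
      setEntry_setEntry _ _ _ _ _ h0
    have h5 : setEntry e d (p d - 1) (M + 1) d (p d - 1) = M + 1 := by simp [setEntry]
    refine ⟨setEntry e d (p d - 1) (M + 1), ⟨⟨IsTableau.addEntry hp hd he
      fun r c hr => h2 r c (by omega), fun r c hr => ?_, ?_⟩, fun h => ?_⟩, h4⟩
    · rw [setEntry, if_neg (by omega)]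
      exact h2 r c hr
    · rw [if_neg (by omega), entryCount_setEntry hL.1 hL.2 h5, h4, h3]
    · exact h.2.1 d (p d - 1) (by omega) h5

end Tableaux

section Induction

variable {N s d : ℕ} {p : ℕ → ℕ}

lemma finite_chainSet (hp : IsShape L p) : (chainSet L B (tailSum L p) s d).Finite :=
  (finite_isRC B (fun k _ => hp.tailSum_le k) fun _ hk => tailSum_eq_zero hk).subset
    fun _ h => h.1

lemma ncard_eq_diff_add {α : Type*} {A C : Set α} (hA : A.Finite) (h : C ⊆ A) :
    A.ncard = (A \ C).ncard + C.ncard :=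
  (Set.ncard_sdiff_add_ncard_of_subset h hA).symm

/-- Both sides of the bijection satisfy the same recursion. -/
lemma ncard_chainSet_eq_ncard_tableauSet
    (h0 : ∀ p, IsShape L p → {X | IsRC L (source (N + 1) 0) (tailSum L p) X}.ncard
      = {e | IsTableau N p e}.ncard) (s d : ℕ) (hp : IsShape L p) :
    (chainSet L (source (N + 1) s) (tailSum L p) s d).ncard
      = (tableauSet L (N + 1) p s d).ncard := by
  induction s generalizing p d with
  | zero =>
    rw [tableauSet_zero hp, ← h0 p hp]
    congr 1
    ext X
    exact ⟨fun h => h.1, fun h => ⟨h, hasChain_zero _ _ _ _⟩⟩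
  | succ s ih =>
    obtain ⟨j, hj⟩ : ∃ j, L + 1 ≤ d + j := ⟨L + 1, by omega⟩
    induction j generalizing d with
    | zero =>
      rw [tableauSet_eq_empty hp (by omega), chainSet_eq_empty (by omega)
        (tailSum_eq_zero (by omega)), Set.ncard_empty, Set.ncard_empty]
    | succ j ihj =>
      rw [ncard_eq_diff_add (finite_chainSet hp) (chainSet_succ_subset (d := d)),
        ncard_eq_diff_add (finite_tableauSet hp) (tableauSet_succ_subset (d := d)),
        ihj (d + 1) (by omega)]
      congr 1
      rcases Nat.eq_zero_or_pos d with rfl | hd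
      · rw [tableauSet_diff_zero, ← ih 0 hp]
        exact ncard_chainSet_diff (isSource_source (by omega) _) (isSource_source (by omega) _)
          hp.isTailSum hp.isTailSum (fun k _ => hp.tailSum_le k) (source_strict _ _)
          (source_eq_sub _ _) fun k hk => by rw [if_neg (by omega), sub_zero]
      · obtain ⟨d, rfl⟩ : ∃ d', d = d' + 1 := ⟨d - 1, by omega⟩
        have h1 := tailSum_succ hp d
        have h2 := tailSum_succ hp (d + 1)
        rcases Nat.lt_or_ge (p (d + 1)) (p d) with hlt | hge
        · rw [ncard_tableauSet_diff hp hlt, ← ih (d + 1) (hp.update hlt)]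
          exact ncard_chainSet_diff (isSource_source (by omega) _) (isSource_source (by omega) _)
            hp.isTailSum (hp.update hlt).isTailSum (fun k _ => hp.tailSum_le k)
            (source_strict _ _) (source_eq_sub _ _) fun k _ => hp.tailSum_update hlt k
        · rw [tableauSet_diff_eq_empty hge, chainSet_diff_eq_empty (isSource_source (by omega) _)
            hp.isTailSum (source_strict _ _) (by omega), Set.ncard_empty, Set.ncard_empty]
          simp only [add_assoc, Nat.reduceAdd] at *
          omega

lemma IsRC.congr_source {B' : ℕ → ℤ} (h : IsRC L B a X) (hB : ∀ n, n ≤ L → B n = B' n) :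
    IsRC L B' a X := by
  refine ⟨h.node_zero, h.length_zero, h.length_le, h.size, fun k n y hy => ?_⟩
  have h1 := h.label_le k n y hy
  have hn : n ≤ L := by
    by_contra hn
    rw [h.length_le k n (by omega)] at hy
    simp at hy
  unfold vac at h1 ⊢
  rwa [← hB n hn]

lemma tailSum_nonneg (k : ℕ) : 0 ≤ tailSum L p k :=
  sum_nonneg fun i _ => by split_ifs <;> simp

lemma IsShape.eq_zero_of_head (hp : IsShape L p) (h : p 0 = 0) (i : ℕ) : p i = 0 :=
  Nat.le_zero.1 (h ▸ hp.antitone (Nat.zero_le i))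

/-- With a single box in the source there is only the trivial rigged configuration. -/
lemma IsRC.head_eq_zero (hp : IsShape L p) (hX : IsRC L (source 1 0) (tailSum L p) X) :
    p 0 = 0 := by
  by_contra h0
  let r : ℕ → ℤ := fun k => colSum L (mult X k) 1
  have hr0 : r 0 = 0 := colSum_of_zero L hX.mult_zero 1
  have hr : ∀ k, 0 ≤ r k := fun k => colSum_nonneg _ _
  have hv := fun k hk => hX.vac_nonneg (isSource_source le_rfl 0) hp.isTailSum (k := k) hk 1
  have h1 : 1 ≤ r 1 := by
    have h2 : tailSum L p 1 ≤ L * r 1 := by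
      rw [← hX.size 1 le_rfl]
      simp only [r, colSum, mul_sum]
      refine sum_le_sum fun j hj => ?_
      rw [← mul_assoc]
      refine mul_le_mul_of_nonneg_right ?_ (by positivity)
      have := mem_range.1 hj
      rcases Nat.eq_zero_or_pos j with rfl | hj0
      · simp
      · rw [min_eq_left (by omega)]
        push_cast
        omega
    have h3 := tailSum_succ hp 0
    have h4 := tailSum_nonneg (L := L) (p := p) 2
    have h5 : 0 ≤ r 1 := hr 1
    by_contra h6
    have h7 : r 1 = 0 := by omega
    rw [h7, mul_zero] at h2
    simp only [zero_add] at h3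
    omega
  have hstep : ∀ k, r (k + 1) ≤ r (k + 2) ∧ 1 ≤ r (k + 1) := by
    intro k
    induction k with
    | zero =>
      have h2 := hv 1 le_rfl
      simp only [vac, if_true, Nat.sub_self, source] at h2
      simp only [r] at *
      norm_num at h2 ⊢
      omega
    | succ k ih =>
      have h2 := hv (k + 2) (by omega)
      simp only [vac, if_neg (show ¬ k + 2 = 1 by omega), zero_add,
        show k + 2 - 1 = k + 1 by omega] at h2
      simp only [r, add_assoc, Nat.reduceAdd] at *
      omega
  have h2 := (hstep L).2
  have h3 : r (L + 1) = 0 := by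
    refine colSum_of_zero L (fun n => ?_) 1
    rw [mult, hX.node_eq_zero (by omega) (tailSum_eq_zero (by omega)), Multiset.card_zero]
  omega

lemma ncard_isRC_source_one (hp : IsShape L p) :
    {X | IsRC L (source 1 0) (tailSum L p) X}.ncard = {e | IsTableau 0 p e}.ncard := by
  by_cases h0 : p 0 = 0
  · have hp0 := hp.eq_zero_of_head h0
    have ha : ∀ k, tailSum L p k = 0 := fun k => by simp [tailSum, hp0]
    have h1 : {X | IsRC L (source 1 0) (tailSum L p) X} = {fun _ _ => 0} := by
      ext X
      constructor
      · intro h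
        funext k n
        rcases Nat.eq_zero_or_pos k with rfl | hk
        · exact h.node_zero n
        · exact h.node_eq_zero hk (ha k) n
      · rintro rfl
        exact ⟨fun _ => rfl, fun _ => rfl, fun _ _ _ => rfl, fun k _ => by simp [mult, ha],
          fun k n y hy => by simp at hy⟩
    have h2 : {e | IsTableau 0 p e} = {fun _ _ => 0} := by
      ext e
      constructor
      · intro h
        funext r c
        exact h.zero_outside r c (by rw [hp0]; exact Nat.zero_le _)
      · rintro rfl
        exact ⟨fun r c h => by simp [hp0] at h, fun _ _ _ => le_rfl, fun _ _ _ _ _ => le_rfl,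
          fun r₁ r₂ c _ h => by simp [hp0] at h, fun _ _ _ => rfl⟩
    rw [h1, h2, Set.ncard_singleton, Set.ncard_singleton]
  · have h1 : {X | IsRC L (source 1 0) (tailSum L p) X} = ∅ :=
      Set.eq_empty_of_forall_notMem fun X h => h0 (IsRC.head_eq_zero hp h)
    have h2 : {e | IsTableau 0 p e} = ∅ := by
      refine Set.eq_empty_of_forall_notMem fun e h => ?_
      have h3 := IsTableau.pos h 0 0 (by omega)
      have h4 := IsTableau.le h 0 0
      omega
    rw [h1, h2, Set.ncard_empty, Set.ncard_empty]

/-- Rigged configurations are equinumerous with semistandard tableaux. -/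
theorem ncard_isRC_eq_ncard_isTableau (N : ℕ) (hp : IsShape L p) :
    {X | IsRC L (source (N + 1) 0) (tailSum L p) X}.ncard = {e | IsTableau N p e}.ncard := by
  induction N generalizing p with
  | zero => exact ncard_isRC_source_one hp
  | succ N ih =>
    have h1 := ncard_chainSet_eq_ncard_tableauSet (fun p hp => ih hp) (L * L + L) 0 hp
    rw [tableauSet_of_le (by omega)] at h1
    rw [← h1]
    congr 1
    have hs : ∀ n, n ≤ L → source (N + 1 + 1) 0 n = source (N + 1) (L * L + L) n := by
      intro n hn
      unfold source
      rw [min_eq_left (hn.trans (Nat.le_add_left _ _))]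
      push_cast
      simp
      ring
    ext X
    exact ⟨fun h => ⟨IsRC.congr_source h hs, hasChain_nil _ _ _ _⟩,
      fun h => h.1.congr_source fun n hn => (hs n hn).symm⟩

end Induction

section Partitions

variable {q m : ℕ → ℕ} {i j n : ℕ}

lemma _root_.IsPartition.antitone (hq : IsPartition q) : Antitone q := antitone_nat_of_succ_le hq.1

lemma conj_eq_of_forall_iff {c : ℕ} (h : ∀ i, j ≤ q i ↔ i < c) : conj q j = c := by
  have h1 : {i | j ≤ q i} = Set.Iio c := Set.ext h
  rw [conj, h1, Nat.card_coe_set_eq, Set.ncard_Iio_nat]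

lemma lt_conj_iff (hq : IsPartition q) (hj : 1 ≤ j) : i < conj q j ↔ j ≤ q i := by
  classical
  obtain ⟨K, hK⟩ := hq.2
  have hex : ∃ i, q i < j := ⟨K, by omega⟩
  have h : ∀ i, j ≤ q i ↔ i < Nat.find hex := by
    intro i
    constructor
    · intro h1
      by_contra h2
      have h3 := hq.antitone (not_lt.1 h2)
      have h4 := Nat.find_spec hex
      omega
    · intro h1
      exact not_lt.1 (Nat.find_min hex h1)
  rw [conj_eq_of_forall_iff h, h]

lemma conj_eq_zero (hq : IsPartition q) (h0 : q 0 < j) : conj q j = 0 := by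
  by_contra h
  have := (lt_conj_iff hq (by omega)).1 (Nat.pos_of_ne_zero h)
  omega

lemma conj_succ_le (hq : IsPartition q) (hj : 1 ≤ j) : conj q (j + 1) ≤ conj q j := by
  by_contra! h
  have h1 := (lt_conj_iff hq (by omega)).1 h
  have h2 := (lt_conj_iff hq hj).2 (show j ≤ q (conj q j) by omega)
  omega

/-- The number of parts of size at least `j` in the partition with multiplicities `m`. -/
def countGE (L : ℕ) (m : ℕ → ℕ) (j : ℕ) : ℕ := ∑ t ∈ range (L + 1), if j ≤ t then m t else 0

lemma countGE_antitone (L : ℕ) (m : ℕ → ℕ) : Antitone (countGE L m) := by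
  intro j j' h
  refine sum_le_sum fun t _ => ?_
  split_ifs <;> omega

lemma countGE_eq_zero (h : L < j) : countGE L m j = 0 := by
  refine sum_eq_zero fun t ht => if_neg ?_
  have := mem_range.1 ht
  omega

lemma countGE_succ (hj : j ≤ L) : countGE L m j = countGE L m (j + 1) + m j := by
  have h1 : m j = ∑ t ∈ range (L + 1), if t = j then m t else 0 := by
    rw [Finset.sum_ite_eq', if_pos (mem_range.2 (by omega))]
  unfold countGE
  rw [h1, ← sum_add_distrib]
  refine sum_congr rfl fun t _ => ?_
  split_ifs <;> omega

lemma sum_countGE (L : ℕ) (m : ℕ → ℕ) (n : ℕ) :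
    ((∑ j ∈ Icc 1 n, countGE L m j : ℕ) : ℤ) = colSum L m n := by
  induction n with
  | zero => simp [colSum_zero]
  | succ n ih =>
    rw [sum_Icc_succ_top (by omega), Nat.cast_add, ih, countGE, colSum, colSum, Nat.cast_sum,
      ← sum_add_distrib]
    refine sum_congr rfl fun t _ => ?_
    split_ifs with h
    · rw [min_eq_left h, min_eq_left (by omega)]
      push_cast
      ring
    · rw [min_eq_right (by omega), min_eq_right (by omega)]
      simp

lemma countGE_mstat (hq : IsPartition q) (hL : q 0 ≤ L) (hj : 1 ≤ j) :
    countGE L (mstat q) j = conj q j := by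
  obtain ⟨t, ht⟩ : ∃ t, L + 1 ≤ j + t := ⟨L + 1, by omega⟩
  induction t generalizing j with
  | zero => rw [countGE_eq_zero (by omega), conj_eq_zero hq (by omega)]
  | succ t ih =>
    rcases Nat.lt_or_ge L j with h | h
    · rw [countGE_eq_zero h, conj_eq_zero hq (by omega)]
    · rw [countGE_succ h, ih (by omega) (by omega), mstat]
      have := conj_succ_le hq hj
      omega

lemma Qstat_eq_colSum (hq : IsPartition q) (hL : q 0 ≤ L) (n : ℕ) :
    (Qstat q n : ℤ) = colSum L (mstat q) n := by
  rw [← sum_countGE, Qstat]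
  congr 1
  exact sum_congr rfl fun j hj => (countGE_mstat hq hL (mem_Icc.1 hj).1).symm

lemma psize_eq_sum_range {K : ℕ} (h : ∀ i, K ≤ i → q i = 0) : psize q = ∑ i ∈ range K, q i := by
  refine finsum_eq_sum_of_support_subset q fun i hi => ?_
  by_contra hK
  exact hi (h i (by simpa using hK))

lemma psize_eq_Qstat (hq : IsPartition q) (hL : q 0 ≤ L) : psize q = Qstat q L := by
  obtain ⟨K, hK⟩ := hq.2
  have h0 : ∀ i, K ≤ i → q i = 0 := fun i hi => Nat.le_zero.1 (hK ▸ hq.antitone hi)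
  rw [psize_eq_sum_range h0, Qstat]
  have h1 : ∀ i ∈ range K, q i = #{j ∈ Icc 1 L | j ≤ q i} := by
    intro i _
    have h2 : ({j ∈ Icc 1 L | j ≤ q i} : Finset ℕ) = Icc 1 (q i) := by
      ext j
      have := hq.antitone (Nat.zero_le i)
      simp only [mem_filter, mem_Icc]
      omega
    rw [h2, Nat.card_Icc, Nat.add_sub_cancel]
  have h2 : ∀ j ∈ Icc 1 L, conj q j = #{i ∈ range K | j ≤ q i} := by
    intro j hj
    have h3 : ({i ∈ range K | j ≤ q i} : Finset ℕ) = range (conj q j) := by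
      ext i
      rw [mem_filter, mem_range, mem_range, lt_conj_iff hq (mem_Icc.1 hj).1]
      refine ⟨fun h => h.2, fun h => ⟨?_, h⟩⟩
      by_contra hi
      have := h0 i (by omega)
      have := (mem_Icc.1 hj).1
      omega
    rw [h3, card_range]
  rw [sum_congr rfl h1, sum_congr rfl h2]
  exact sum_card_bipartiteAbove_eq_sum_card_bipartiteBelow fun i j => j ≤ q i

lemma part_le_psize (hq : IsPartition q) (i : ℕ) : q i ≤ psize q := by
  obtain ⟨K, hK⟩ := hq.2
  have h0 : ∀ i, K ≤ i → q i = 0 := fun i hi => Nat.le_zero.1 (hK ▸ hq.antitone hi)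
  rw [psize_eq_sum_range h0]
  by_cases hi : i < K
  · exact single_le_sum (fun _ _ => Nat.zero_le _) (mem_range.2 hi)
  · rw [h0 i (by omega)]
    exact Nat.zero_le _

lemma psize_eq_sum_mul_mstat (hq : IsPartition q) (hL : q 0 ≤ L) :
    (psize q : ℤ) = ∑ j ∈ range (L + 1), (j : ℤ) * (mstat q j : ℤ) := by
  rw [psize_eq_Qstat hq hL, Qstat_eq_colSum hq hL, colSum_of_le _ le_rfl]

/-- The partition with parts at most `L` and multiplicities `m`. -/
def partOf (L : ℕ) (m : ℕ → ℕ) (i : ℕ) : ℕ := #{j ∈ Icc 1 L | i < countGE L m j}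

lemma le_partOf_iff (L : ℕ) (m : ℕ → ℕ) (i : ℕ) (hj : 1 ≤ j) :
    j ≤ partOf L m i ↔ i < countGE L m j := by
  constructor
  · intro h
    by_contra h1
    have h2 : ({j ∈ Icc 1 L | i < countGE L m j} : Finset ℕ) ⊆ Icc 1 (j - 1) := by
      intro t ht
      rw [mem_filter, mem_Icc] at ht
      rw [mem_Icc]
      refine ⟨ht.1.1, ?_⟩
      by_contra h3
      have := countGE_antitone L m (show j ≤ t by omega)
      omega
    have h3 := card_le_card h2
    rw [Nat.card_Icc] at h3
    unfold partOf at h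
    omega
  · intro h
    have hjL : j ≤ L := by
      by_contra h1
      rw [countGE_eq_zero (by omega)] at h
      omega
    have h2 : Icc 1 j ⊆ ({j ∈ Icc 1 L | i < countGE L m j} : Finset ℕ) := by
      intro t ht
      rw [mem_Icc] at ht
      rw [mem_filter, mem_Icc]
      exact ⟨⟨ht.1, by omega⟩, lt_of_lt_of_le h (countGE_antitone L m ht.2)⟩
    have h3 := card_le_card h2
    rw [Nat.card_Icc] at h3
    unfold partOf
    omega

lemma conj_partOf (L : ℕ) (m : ℕ → ℕ) (hj : 1 ≤ j) : conj (partOf L m) j = countGE L m j :=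
  conj_eq_of_forall_iff fun i => le_partOf_iff L m i hj

lemma partOf_le (L : ℕ) (m : ℕ → ℕ) (i : ℕ) : partOf L m i ≤ L := by
  refine (card_filter_le _ _).trans ?_
  rw [Nat.card_Icc, Nat.add_sub_cancel]

lemma isPartition_partOf (L : ℕ) (m : ℕ → ℕ) : IsPartition (partOf L m) := by
  refine ⟨fun i => card_le_card fun j => ?_, countGE L m 0, ?_⟩
  · simp only [mem_filter]
    exact fun h => ⟨h.1, by omega⟩
  · refine card_eq_zero.2 (filter_eq_empty_iff.2 fun j _ => not_lt.2 ?_)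
    exact countGE_antitone L m (Nat.zero_le j)

lemma mstat_partOf (hm : ∀ n, L < n → m n = 0) (hn : 1 ≤ n) : mstat (partOf L m) n = m n := by
  rw [mstat, conj_partOf L m hn, conj_partOf L m (by omega)]
  rcases Nat.lt_or_ge L n with h | h
  · rw [countGE_eq_zero h, hm n h, Nat.zero_sub]
  · rw [countGE_succ h, Nat.add_sub_cancel_left]

lemma Qstat_partOf (L : ℕ) (m : ℕ → ℕ) (n : ℕ) : (Qstat (partOf L m) n : ℤ) = colSum L m n := by
  rw [← sum_countGE, Qstat]
  congr 1
  exact sum_congr rfl fun j hj => conj_partOf L m (mem_Icc.1 hj).1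

lemma partOf_eq_of_mstat (hq : IsPartition q) (hL : q 0 ≤ L) (hm : ∀ n, 1 ≤ n → m n = mstat q n) :
    partOf L m = q := by
  have h1 : ∀ i j, 1 ≤ j → (j ≤ partOf L m i ↔ j ≤ q i) := by
    intro i j hj
    rw [le_partOf_iff L m i hj, ← lt_conj_iff hq hj, ← countGE_mstat hq hL hj]
    have h2 : countGE L m j = countGE L (mstat q) j := by
      refine sum_congr rfl fun t _ => ?_
      split_ifs
      · exact hm t (by omega)
      · rfl
    rw [h2]
  funext i
  refine eq_of_forall_le_iff fun j => ?_
  rcases Nat.eq_zero_or_pos j with rfl | hj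
  · simp
  · exact h1 i j hj

lemma partOf_zero (h : ∀ n, m n = 0) : partOf L m = fun _ => 0 := by
  funext i
  simp [partOf, countGE, h]

lemma sum_range_shift {p : ℕ → ℕ} (hp : ∀ i, L ≤ i → p i = 0) (k : ℕ) :
    ∑ t ∈ range L, p (t + k) = p k + ∑ t ∈ range L, p (t + (k + 1)) := by
  have h1 := sum_range_succ (fun t => p (t + k)) L
  have h2 := sum_range_succ' (fun t => p (t + k)) L
  rw [hp (L + k) (by omega)] at h1
  simp only [add_right_comm _ 1 k, zero_add, ← add_assoc] at *
  omega

lemma tailSum_eq_tailsum {p : ℕ → ℕ} (hp : IsShape L p) (k : ℕ) :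
    tailSum L p (k + 1) = (tailsum p k : ℤ) := by
  have h1 : tailsum p k = ∑ t ∈ range L, p (t + k) := by
    refine finsum_eq_sum_of_support_subset _ fun t ht => ?_
    by_contra hL
    exact ht (hp.eq_zero _ (by simp at hL; omega))
  rw [h1]
  obtain ⟨j, hj⟩ : ∃ j, L ≤ k + j := ⟨L, by omega⟩
  clear h1
  induction j generalizing k with
  | zero =>
    rw [tailSum_eq_zero (by omega), sum_eq_zero fun t _ => hp.eq_zero _ (by omega)]
    rfl
  | succ j ih =>
    rw [sum_range_shift hp.eq_zero, tailSum_succ hp, ih (k + 1) (by omega)]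
    push_cast
    ring

lemma exists_isShape {p : ℕ → ℕ} (hp : IsPartition p) : ∃ L, IsShape L p := by
  obtain ⟨K, hK⟩ := hp.2
  have h0 : ∀ i, K ≤ i → p i = 0 := fun i hi => Nat.le_zero.1 (hK ▸ hp.antitone hi)
  refine ⟨max K (∑ i ∈ range K, p i), hp.1, fun i hi => h0 i ((le_max_left _ _).trans hi), ?_⟩
  rw [← psize_eq_sum_range fun i hi => h0 i ((le_max_left _ _).trans hi), psize_eq_sum_range h0]
  exact le_max_right _ _

end Partitions

section Fibers

lemma ncard_multisets (M V : ℕ) :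
    {t : Multiset ℕ | t.card = M ∧ ∀ y ∈ t, y ≤ V}.ncard = (V + M).choose M := by
  have h1 : {t : Multiset ℕ | t.card = M ∧ ∀ y ∈ t, y ≤ V}
      = (fun t : Sym (Fin (V + 1)) M => (t : Multiset (Fin (V + 1))).map Fin.val) '' Set.univ := by
    ext t
    simp only [Set.image_univ, Set.mem_range]
    constructor
    · rintro ⟨ht, hV⟩
      refine ⟨⟨t.map (Fin.ofNat (V + 1)), by rw [Multiset.card_map, ht]⟩, ?_⟩
      rw [Sym.coe_mk, Multiset.map_map]
      conv_rhs => rw [← Multiset.map_id t]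
      refine Multiset.map_congr rfl fun y hy => ?_
      simpa using Nat.lt_succ_of_le (hV y hy)
    · rintro ⟨u, rfl⟩
      refine ⟨by simp, fun y hy => ?_⟩
      obtain ⟨z, -, rfl⟩ := Multiset.mem_map.1 hy
      omega
  rw [h1, Set.ncard_image_of_injective, Set.ncard_univ, Sym.natCard_sym_eq_choose, Nat.card_fin]
  · congr 1
    omega
  · exact (Multiset.map_injective Fin.val_injective).comp Sym.coe_injective

lemma ncard_families {K : ℕ} (T : ℕ → ℕ → Set (Multiset ℕ))
    (hT : ∀ k n, K ≤ k ∨ K ≤ n → T k n = {0}) :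
    {X : ℕ → ℕ → Multiset ℕ | ∀ k n, X k n ∈ T k n}.ncard
      = ∏ k ∈ range K, ∏ n ∈ range K, (T k n).ncard := by
  have h1 : {X : ℕ → ℕ → Multiset ℕ | ∀ k n, X k n ∈ T k n}
      ≃ ∀ i : Fin K × Fin K, T i.1 i.2 :=
    { toFun := fun X i => ⟨X.1 i.1 i.2, X.2 _ _⟩
      invFun := fun Y => ⟨fun k n => if h : k < K ∧ n < K then Y (⟨k, h.1⟩, ⟨n, h.2⟩) else 0, by
        intro k n
        dsimp only
        split_ifs with h
        · exact (Y (⟨k, h.1⟩, ⟨n, h.2⟩)).2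
        · rw [hT k n (by omega)]
          rfl⟩
      left_inv := by
        rintro ⟨X, hX⟩
        ext1
        funext k n
        dsimp only
        split_ifs with h
        · rfl
        · have h2 := hX k n
          rw [hT k n (by omega)] at h2
          exact h2.symm
      right_inv := by
        intro Y
        funext i
        ext1
        simp }
  rw [← Nat.card_coe_set_eq, Nat.card_congr h1, Nat.card_pi, Fintype.prod_prod_type,
    Finset.prod_range]
  refine prod_congr rfl fun k _ => ?_
  rw [Finset.prod_range]
  exact prod_congr rfl fun n _ => Nat.card_coe_set_eq _

variable {N : ℕ} {p : ℕ → ℕ} {ν : ℕ → ℕ → ℕ}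

/-- The collection of partitions underlying a rigged configuration. -/
def shapes (L : ℕ) (X : ℕ → ℕ → Multiset ℕ) (k : ℕ) : ℕ → ℕ := partOf L (mult X k)

lemma Padm_shapes (k n : ℕ) :
    Padm N (shapes L X) k n = vac L (source (N + 1) 0) (mult X) k n := by
  unfold Padm vac shapes source
  rw [Qstat_partOf, Qstat_partOf, Qstat_partOf]
  simp

lemma IsRC.isAdmissible_shapes (hp : IsShape L p)
    (hX : IsRC L (source (N + 1) 0) (tailSum L p) X) : IsAdmissible p N (shapes L X) := by
  refine ⟨partOf_zero hX.mult_zero, fun k _ => isPartition_partOf _ _, fun k hk => ?_,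
    fun k n hk _ => ?_⟩
  · obtain ⟨k, rfl⟩ : ∃ k', k = k' + 1 := ⟨k - 1, by omega⟩
    zify
    rw [shapes, psize_eq_Qstat (isPartition_partOf _ _) (partOf_le _ _ _), Qstat_partOf,
      hX.colSum_eq hk le_rfl, tailSum_eq_tailsum hp, Nat.add_sub_cancel]
  · rw [Padm_shapes]
    exact hX.vac_nonneg (isSource_source (by omega) 0) hp.isTailSum hk n

lemma IsAdmissible.psize_eq (hν : IsAdmissible p N ν) (hp : IsShape L p) {k : ℕ} (hk : 1 ≤ k) :
    (psize (ν k) : ℤ) = tailSum L p k := by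
  obtain ⟨k, rfl⟩ : ∃ k', k = k' + 1 := ⟨k - 1, by omega⟩
  rw [hν.2.2.1 _ hk, tailSum_eq_tailsum hp, Nat.add_sub_cancel]

lemma IsAdmissible.part_le (hν : IsAdmissible p N ν) (hp : IsShape L p) {k : ℕ} (hk : 1 ≤ k) :
    ν k 0 ≤ L := by
  have h1 := part_le_psize (hν.2.1 k hk) 0
  have h2 := IsAdmissible.psize_eq hν hp hk
  have h3 := hp.tailSum_le k
  omega

lemma IsAdmissible.mstat_eq_zero (hν : IsAdmissible p N ν) (hp : IsShape L p) {k n : ℕ}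
    (hk : 1 ≤ k) (hn : 1 ≤ n) (h : L < k ∨ L < n) : mstat (ν k) n = 0 := by
  have h0 : ν k 0 < n := by
    rcases h with h | h
    · have h1 := part_le_psize (hν.2.1 k hk) 0
      have h2 := IsAdmissible.psize_eq hν hp hk
      rw [tailSum_eq_zero h] at h2
      omega
    · exact lt_of_le_of_lt (IsAdmissible.part_le hν hp hk) h
  rw [mstat, conj_eq_zero (hν.2.1 k hk) h0, Nat.zero_sub]

/-- The prescribed multiplicities over an admissible collection. -/
noncomputable def multOf (ν : ℕ → ℕ → ℕ) (k n : ℕ) : ℕ :=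
  if k = 0 ∨ n = 0 then 0 else mstat (ν k) n

/-- The rigged configurations over an admissible collection. -/
lemma isRC_and_shapes_eq_iff (hp : IsShape L p) (hν : IsAdmissible p N ν) :
    (IsRC L (source (N + 1) 0) (tailSum L p) X ∧ shapes L X = ν) ↔
      ∀ k n, (X k n).card = multOf ν k n ∧ ∀ y ∈ X k n, y ≤ (Padm N ν k n).toNat := by
  constructor
  · rintro ⟨hX, rfl⟩ k n
    unfold multOf
    split_ifs with h
    · have h1 : X k n = 0 := by
        rcases h with rfl | rfl
        · exact hX.node_zero n
        · exact hX.length_zero k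
      simp [h1]
    · push Not at h
      refine ⟨?_, fun y hy => ?_⟩
      · rw [shapes, mstat_partOf (hX.mult_eq_zero k) (by omega)]
        rfl
      · rw [Padm_shapes]
        have := hX.label_le k n y hy
        omega
  · intro h
    have hm : ∀ k n, mult X k n = multOf ν k n := fun k n => (h k n).1
    have hm0 : ∀ n, mult X 0 n = 0 := fun n => by rw [hm, multOf, if_pos (Or.inl rfl)]
    have hm1 : ∀ k, mult X k 0 = 0 := fun k => by rw [hm, multOf, if_pos (Or.inr rfl)]
    have hmk : ∀ k, 1 ≤ k → ∀ n, 1 ≤ n → mult X k n = mstat (ν k) n := fun k hk n hn => by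
      rw [hm, multOf, if_neg (by omega)]
    have hs : shapes L X = ν := by
      funext k
      rcases Nat.eq_zero_or_pos k with rfl | hk
      · rw [hν.1, shapes, partOf_zero hm0]
      · exact partOf_eq_of_mstat (hν.2.1 k hk) (IsAdmissible.part_le hν hp hk) (hmk k hk)
    refine ⟨⟨fun n => Multiset.card_eq_zero.1 (hm0 n), fun k => Multiset.card_eq_zero.1 (hm1 k),
      fun k n hn => Multiset.card_eq_zero.1 ?_, fun k hk => ?_, fun k n y hy => ?_⟩, hs⟩
    · rcases Nat.eq_zero_or_pos k with rfl | hk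
      · exact hm0 n
      · exact (hmk k hk n (by omega)).trans
          (IsAdmissible.mstat_eq_zero hν hp hk (by omega) (Or.inr hn))
    · rw [← IsAdmissible.psize_eq hν hp hk,
        psize_eq_sum_mul_mstat (hν.2.1 k hk) (IsAdmissible.part_le hν hp hk)]
      refine sum_congr rfl fun j _ => ?_
      rcases Nat.eq_zero_or_pos j with rfl | hj
      · simp
      · rw [hmk k hk j hj]
    · have hpos := Multiset.card_pos_iff_exists_mem.2 ⟨y, hy⟩
      have hk : 1 ≤ k := by
        rcases Nat.eq_zero_or_pos k with rfl | hk
        · exact absurd (hm0 n) hpos.ne'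
        · exact hk
      have hn : 1 ≤ n := by
        rcases Nat.eq_zero_or_pos n with rfl | hn
        · exact absurd (hm1 k) hpos.ne'
        · exact hn
      have h1 := (h k n).2 y hy
      have h2 := hν.2.2.2 k n hk hn
      rw [← Padm_shapes, hs]
      omega

lemma finprod_range {f : ℕ → ℕ} (h : ∀ i, L ≤ i → f i = 1) :
    ∏ᶠ i, f i = ∏ i ∈ range L, f i := by
  refine finprod_eq_prod_of_mulSupport_subset f fun i hi => ?_
  by_contra hL
  exact hi (h i (by simpa using hL))

/-- The number of rigged configurations over an admissible collection. -/
lemma ncard_fiber (hp : IsShape L p) (hν : IsAdmissible p N ν) :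
    {X | IsRC L (source (N + 1) 0) (tailSum L p) X ∧ shapes L X = ν}.ncard
      = ∏ᶠ (k : ℕ) (n : ℕ),
          Nat.choose ((Padm N ν (k + 1) (n + 1)).toNat + mstat (ν (k + 1)) (n + 1))
            (mstat (ν (k + 1)) (n + 1)) := by
  have h0 : ∀ k n, L + 1 ≤ k ∨ L + 1 ≤ n → multOf ν k n = 0 := by
    intro k n h
    unfold multOf
    split_ifs with h1
    · rfl
    · exact IsAdmissible.mstat_eq_zero hν hp (by omega) (by omega) (by omega)
  have h1 : ∀ k n, L ≤ k ∨ L ≤ n → mstat (ν (k + 1)) (n + 1) = 0 := fun k n h =>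
    IsAdmissible.mstat_eq_zero hν hp (by omega) (by omega) (by omega)
  have h2 : {X | IsRC L (source (N + 1) 0) (tailSum L p) X ∧ shapes L X = ν}
      = {X | ∀ k n, X k n ∈ {t : Multiset ℕ | t.card = multOf ν k n ∧
          ∀ y ∈ t, y ≤ (Padm N ν k n).toNat}} :=
    Set.ext fun X => isRC_and_shapes_eq_iff hp hν
  rw [h2, ncard_families (K := L + 1) _ fun k n h => ?_]
  · simp only [ncard_multisets]
    rw [prod_range_succ', finprod_range (L := L)]
    · conv_rhs => rw [← mul_one (∏ i ∈ range L, _)]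
      congr 1
      · refine prod_congr rfl fun k _ => ?_
        rw [prod_range_succ', finprod_range (L := L)]
        · simp [multOf]
        · intro n hn
          rw [h1 k n (Or.inr hn), Nat.choose_zero_right]
      · exact prod_eq_one fun n _ => by simp [multOf]
    · intro k hk
      rw [finprod_range (L := 0)]
      · simp
      · intro n _
        rw [h1 k n (Or.inl hk), Nat.choose_zero_right]
  · ext t
    rw [Set.mem_ofPred_eq, h0 k n h, Multiset.card_eq_zero, Set.mem_singleton_iff]
    exact ⟨fun h => h.1, fun h => ⟨h, by simp [h]⟩⟩

lemma exists_isRC_of_isAdmissible (hp : IsShape L p) (hν : IsAdmissible p N ν) :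
    ∃ X, IsRC L (source (N + 1) 0) (tailSum L p) X ∧ shapes L X = ν := by
  refine ⟨fun k n => Multiset.replicate (multOf ν k n) 0,
    (isRC_and_shapes_eq_iff hp hν).2 fun k n => ⟨Multiset.card_replicate _ _, fun y hy => ?_⟩⟩
  rw [Multiset.eq_of_mem_replicate hy]
  exact Nat.zero_le _

/-- Counting rigged configurations according to their underlying collections. -/
theorem finsum_isAdmissible_eq_ncard (hp : IsShape L p) :
    ∑ᶠ ν ∈ {ν : ℕ → ℕ → ℕ | IsAdmissible p N ν},
        ∏ᶠ (k : ℕ) (n : ℕ),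
          Nat.choose ((Padm N ν (k + 1) (n + 1)).toNat + mstat (ν (k + 1)) (n + 1))
            (mstat (ν (k + 1)) (n + 1))
      = {X | IsRC L (source (N + 1) 0) (tailSum L p) X}.ncard := by
  classical
  have hfin : {X | IsRC L (source (N + 1) 0) (tailSum L p) X}.Finite :=
    finite_isRC _ (fun k _ => hp.tailSum_le k) fun _ hk => tailSum_eq_zero hk
  have hA : {ν : ℕ → ℕ → ℕ | IsAdmissible p N ν}.Finite :=
    (hfin.image (shapes L)).subset fun ν hν => exists_isRC_of_isAdmissible hp hν
  rw [finsum_mem_eq_finite_toFinset_sum _ hA, Set.ncard_eq_toFinset_card _ hfin,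
    card_eq_sum_card_fiberwise (f := shapes L) (t := hA.toFinset) fun X hX => by
      rw [Set.Finite.coe_toFinset] at hX ⊢
      exact IsRC.isAdmissible_shapes hp hX]
  refine sum_congr rfl fun ν hν => ?_
  rw [← ncard_fiber hp ((Set.Finite.mem_toFinset hA).1 hν), ← Set.ncard_coe_finset]
  congr 1
  ext X
  simp

lemma natCard_SSYT (p : ℕ → ℕ) (N : ℕ) : Nat.card (SSYT p N) = {e | IsTableau N p e}.ncard := by
  rw [← Nat.card_coe_set_eq]
  exact Nat.card_congr
    { toFun := fun T => ⟨T.entry, T.pos, T.le_bound, T.row_weak, T.col_strict, T.zero_outside⟩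
      invFun := fun e => ⟨e.1, e.2.pos, e.2.le_bound, e.2.row_weak, e.2.col_strict,
        e.2.zero_outside⟩
      left_inv := fun _ => rfl
      right_inv := fun _ => rfl }

end Fibers

end RiggedConfiguration

/-- For a partition `λ` and a positive integer `N`, the number of semistandard Young
tableaux of shape `λ` with entries in `{1, …, N}` equals
`∑_ν ∏_{k,n ≥ 1} C(P_n^{(k)}(ν,N) + m_n(ν^{(k)}), m_n(ν^{(k)}))`, the sum over all
admissible collections `ν` for `(λ, N)`. -/
theorem card_ssyt_eq_sum_over_admissible
    (p : ℕ → ℕ) (hp : IsPartition p) (N : ℕ) (hN : 0 < N) :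
    Nat.card (SSYT p N) =
      ∑ᶠ ν ∈ {ν : ℕ → ℕ → ℕ | IsAdmissible p N ν},
        ∏ᶠ (k : ℕ) (n : ℕ),
          Nat.choose ((Padm N ν (k + 1) (n + 1)).toNat + mstat (ν (k + 1)) (n + 1))
            (mstat (ν (k + 1)) (n + 1)) := by
  obtain ⟨L, hL⟩ := RiggedConfiguration.exists_isShape hp
  rw [RiggedConfiguration.natCard_SSYT, RiggedConfiguration.finsum_isAdmissible_eq_ncard hL,
    RiggedConfiguration.ncard_isRC_eq_ncard_isTableau N hL]
end

section
/- (KOH identity.) Let k and N be positive integers. Then [N+k−1, k]_q = ∑_{ν} q^{2·n(ν)} ∏_{n ≥ 1} [n(N+1) − 2·Q_n(ν) + m_n(ν), m_n(ν)]_q, where the sum is over all partitions ν of k satisfying 2·Q_n(ν) ≤ n(N+1) for all n ≥ 1, and [a+b, b]_q denotes the ordinary q-Gaussian coefficient ∏_{i=1}^{b} (1 − q^{a+i})/(1 − q^i). -/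
open scoped BigOperators
open Polynomial

/-- `n(ν) = ∑ᵢ (i-1) νᵢ`. -/
noncomputable def nstat (p : ℕ → ℕ) : ℕ := ∑ᶠ i, i * p i

/-- The ordinary `q`-Gaussian coefficient
`[a + b, b]_q = ∏_{i=1}^{b} (1 - q^{a+i}) / (1 - q^i)`, as a polynomial in `q`. -/
noncomputable def qGauss (a b : ℕ) : Polynomial ℚ :=
  (∏ i ∈ Finset.Icc 1 b, (1 - (X : Polynomial ℚ) ^ (a + i))) /
    (∏ i ∈ Finset.Icc 1 b, (1 - (X : Polynomial ℚ) ^ i))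

/-- The complete homogeneous symmetric polynomial of degree `r` evaluated at
`1, q, …, q ^ (A - 1)`; for `A = a + 1` it is the Gaussian coefficient `[a + r, r]_q`. -/
noncomputable def qHom : ℕ → ℕ → ℚ[X]
  | _, 0 => 1
  | 0, _ + 1 => 0
  | A + 1, r + 1 => X ^ (r + 1) * qHom A (r + 1) + qHom (A + 1) r
termination_by A r => A + r

@[simp] lemma qHom_zero_right (A : ℕ) : qHom A 0 = 1 := by rw [qHom]

@[simp] lemma qHom_zero_succ (r : ℕ) : qHom 0 (r + 1) = 0 := by rw [qHom]

lemma qHom_succ_succ (A r : ℕ) :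
    qHom (A + 1) (r + 1) = X ^ (r + 1) * qHom A (r + 1) + qHom (A + 1) r := by rw [qHom]

lemma qHom_succ_eq_sum (A r : ℕ) :
    qHom (A + 1) r = ∑ i ∈ Finset.range (r + 1), X ^ i * qHom A i := by
  induction r with
  | zero => simp
  | succ r ih => rw [Finset.sum_range_succ, qHom_succ_succ, ih, add_comm]

lemma qHom_mul_prod (a r : ℕ) :
    qHom (a + 1) r * ∏ i ∈ Finset.Icc 1 r, (1 - (X : ℚ[X]) ^ i) =
      ∏ i ∈ Finset.Icc 1 r, (1 - (X : ℚ[X]) ^ (a + i)) := by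
  induction a generalizing r with
  | zero =>
    have h : qHom 1 r = 1 := by
      induction r with
      | zero => simp
      | succ r ih => rw [qHom_succ_succ, ih]; simp
    simp [h]
  | succ a iha =>
    induction r with
    | zero => simp
    | succ r ihr =>
      have hshift : ∏ i ∈ Finset.Icc 1 (r + 1), (1 - (X : ℚ[X]) ^ (a + i)) =
          (1 - X ^ (a + 1)) * ∏ i ∈ Finset.Icc 1 r, (1 - (X : ℚ[X]) ^ (a + 1 + i)) := by
        simp only [← Finset.Ico_add_one_right_eq_Icc]
        rw [Finset.prod_eq_prod_Ico_succ_bot (by omega),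
          Finset.prod_Ico_add' (fun i => 1 - (X : ℚ[X]) ^ (a + i)) 1 (r + 1) 1 |>.symm]
        simp only [add_assoc, add_comm 1]
      have h1 := iha (r + 1)
      rw [hshift] at h1
      rw [Finset.prod_Icc_succ_top (by omega)] at h1 ⊢
      rw [Finset.prod_Icc_succ_top (by omega), ← ihr, qHom_succ_succ]
      rw [← ihr] at h1
      linear_combination X ^ (r + 1) * h1

lemma qGauss_eq_qHom (a r : ℕ) : qGauss a r = qHom (a + 1) r := by
  rw [qGauss, ← qHom_mul_prod]
  refine mul_div_cancel_right₀ _ (Finset.prod_ne_zero_iff.2 fun i hi => ?_)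
  have hi : i ≠ 0 := by have := (Finset.mem_Icc.1 hi).1; omega
  intro h
  have := congrArg (Polynomial.eval 0) h
  simp [hi] at this

/-- For `b ≤ d`, the generating polynomial `∑ q ^ (∑ i * x i)` of the sequences
`x 0, …, x (M - 2)` with sum `k`, `x 0 ≤ b` and `x i + x (i + 1) ≤ d`. The convention at `M = 0`
makes the recursion uniform. -/
noncomputable def adjGen (d : ℕ) : ℕ → ℕ → ℕ → ℚ[X]
  | 0, b, k => if b = d ∧ k = 0 then 1 else 0
  | M + 1, 0, k => X ^ k * adjGen d M d k
  | M + 1, b + 1, k => adjGen d (M + 1) b k +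
      if b + 1 ≤ k then X ^ (k - (b + 1)) * adjGen d M (d - (b + 1)) (k - (b + 1)) else 0
termination_by M b => (M, b)

lemma adjGen_zero (d b k : ℕ) : adjGen d 0 b k = if b = d ∧ k = 0 then 1 else 0 := by rw [adjGen]

lemma adjGen_succ_zero (d M k : ℕ) : adjGen d (M + 1) 0 k = X ^ k * adjGen d M d k := by
  rw [adjGen]

lemma adjGen_succ_succ (d M b k : ℕ) : adjGen d (M + 1) (b + 1) k = adjGen d (M + 1) b k +
    if b + 1 ≤ k then X ^ (k - (b + 1)) * adjGen d M (d - (b + 1)) (k - (b + 1)) else 0 := by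
  rw [adjGen]

lemma adjGen_eq_zero {d M b k : ℕ} (hb : b ≤ d) (h : d * M < d - b + 2 * k) :
    adjGen d M b k = 0 := by
  induction M generalizing b k with
  | zero => rw [adjGen_zero, if_neg (by omega)]
  | succ M ihM =>
    induction b with
    | zero => rw [adjGen_succ_zero, ihM le_rfl (by rw [mul_add] at h; omega), mul_zero]
    | succ b ihb =>
      rw [adjGen_succ_succ, ihb (by omega) (by omega), zero_add]
      split_ifs with hk
      · rw [ihM (by omega) (by rw [mul_add] at h; omega), mul_zero]
      · rfl

lemma adjGen_one {d b : ℕ} (hb : b ≤ d) (k : ℕ) : adjGen d 1 b k = if k = 0 then 1 else 0 := by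
  induction b with
  | zero =>
    rw [adjGen_succ_zero, adjGen_zero]
    split_ifs <;> simp_all
  | succ b ih =>
    rw [adjGen_succ_succ, ih (by omega), adjGen_zero, if_neg (by omega : ¬ (_ ∧ _))]
    simp

lemma adjGen_eq_qHom {d b k : ℕ} (hk : k ≤ b) (hb : b ≤ d) (M : ℕ) :
    adjGen d (M + 1) b k = qHom M k := by
  induction M generalizing b k with
  | zero =>
    rw [zero_add, adjGen_one hb]
    cases k <;> simp
  | succ M ih =>
    have key : ∀ c ≤ k, adjGen d (M + 2) c k + ∑ i ∈ Finset.range (k - c), X ^ i * qHom M i =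
        qHom (M + 1) k := by
      intro c hc
      induction c with
      | zero =>
        rw [adjGen_succ_zero, ih (hk.trans hb) le_rfl, qHom_succ_eq_sum, Finset.sum_range_succ,
          Nat.sub_zero, add_comm]
      | succ c ihc =>
        rw [← ihc (by omega), adjGen_succ_succ, if_pos hc, ih (by omega) (by omega),
          show k - c = k - (c + 1) + 1 by omega, Finset.sum_range_succ]
        ring
    induction b, hk using Nat.le_induction with
    | base => simpa using key k le_rfl
    | succ b hkb ihb => rw [adjGen_succ_succ, ihb (by omega), if_neg (by omega), add_zero]

/-- The contribution to `adjGen (d + 1) M b k` of the configurations with `r` pairs of maximal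
weight `d + 1`. -/
noncomputable def adjTerm (d M b k r : ℕ) : ℚ[X] :=
  if (d + 1) * r ≤ k then
    X ^ ((d + 1) * (r * (r - 1)) + 2 * r * (k - (d + 1) * r) + (d + 1 - b) * r) *
      qHom ((d + 1) * M + 1 - (d + 1 - b) - 2 * k) r *
        adjGen d (M - 2 * r) (min b d) (k - (d + 1) * r)
  else 0

lemma adjTerm_eq_zero {d M b k r : ℕ} (h : k < r) : adjTerm d M b k r = 0 := by
  rw [adjTerm, if_neg]
  nlinarith

/-- The part of the difference of consecutive `adjTerm`s keeping `r` maximal pairs. -/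
noncomputable def adjKeep (d M b k r : ℕ) : ℚ[X] :=
  if b + 1 + (d + 1) * r ≤ k ∧ b + 1 ≤ d then
    X ^ ((d + 1) * (r * (r - 1)) + 2 * r * (k - (d + 1) * r) + (d - b) * r +
        (k - (d + 1) * r - (b + 1))) *
      qHom ((d + 1) * (M + 1) + 1 - (d - b) - 2 * k) r *
        adjGen d (M - 2 * r) (d - (b + 1)) (k - (d + 1) * r - (b + 1))
  else 0

/-- The part of the difference of consecutive `adjTerm`s dropping from `r + 1` to `r` maximal
pairs. -/
noncomputable def adjDrop (d M b k r : ℕ) : ℚ[X] :=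
  if (d + 1) * (r + 1) ≤ k then
    X ^ ((d + 1) * ((r + 1) * r) + 2 * (r + 1) * (k - (d + 1) * (r + 1)) + (d - b) * (r + 1)) *
      qHom ((d + 1) * (M + 1) + 1 - (d - b) - 2 * k) r *
        adjGen d (M + 1 - 2 * (r + 1)) b (k - (d + 1) * (r + 1))
  else 0

lemma two_mul_le_of_weight {d M b k r : ℕ} (hb : b ≤ d)
    (h : d + 1 - b + 2 * k ≤ (d + 1) * M) (hr : (d + 1) * r ≤ k) : 2 * r + 1 ≤ M := by
  by_contra hlt
  have : (d + 1) * M ≤ (d + 1) * (2 * r) := Nat.mul_le_mul_left _ (by omega)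
  have : (d + 1) * (2 * r) = 2 * ((d + 1) * r) := by ring
  omega

lemma adjTerm_succ_zero {d M b k : ℕ} (hb : b ≤ d) :
    adjTerm d (M + 1) (b + 1) k 0 = adjTerm d (M + 1) b k 0 + adjKeep d M b k 0 := by
  simp only [adjTerm, adjKeep, mul_zero, Nat.zero_le, if_true, qHom_zero_right, Nat.sub_zero,
    add_zero, zero_mul, pow_zero, mul_one, one_mul, zero_add]
  by_cases hbd : b + 1 ≤ d
  · rw [min_eq_left hbd, min_eq_left hb, adjGen_succ_succ]
    simp [hbd]
  · have : b = d := by omega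
    subst this
    simp

lemma adjTerm_succ_succ {d M b k : ℕ} (hb : b ≤ d)
    (h : d - b + 2 * k ≤ (d + 1) * (M + 1)) (s : ℕ) :
    adjTerm d (M + 1) (b + 1) k (s + 1) =
      adjTerm d (M + 1) b k (s + 1) + adjKeep d M b k (s + 1) + adjDrop d M b k s := by
  by_cases hs : (d + 1) * (s + 1) ≤ k
  swap
  · rw [adjTerm, adjTerm, adjKeep, adjDrop, if_neg hs, if_neg hs, if_neg hs, if_neg (by omega)]
    simp
  obtain ⟨A, hA⟩ : ∃ A, (d + 1) * (M + 1) + 1 - (d - b) - 2 * k = A + 1 :=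
    ⟨(d + 1) * (M + 1) - (d - b) - 2 * k, by omega⟩
  have hA' : (d + 1) * (M + 1) + 1 - (d + 1 - b) - 2 * k = A := by omega
  rw [adjTerm, adjTerm, adjKeep, adjDrop, if_pos hs, if_pos hs, if_pos hs, hA',
    show d + 1 - (b + 1) = d - b by omega, hA, qHom_succ_succ]
  obtain ⟨k', rfl⟩ := Nat.exists_eq_add_of_le hs
  rw [Nat.add_sub_cancel_left, Nat.add_sub_cancel, min_eq_left hb,
    show d + 1 - b = (d - b) + 1 by omega]
  by_cases hbd : b + 1 ≤ d
  · have hM : 2 * (s + 1) + 1 ≤ M + 1 :=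
      two_mul_le_of_weight hbd (by omega) hs
    obtain ⟨M', rfl⟩ : ∃ M', M = M' + 2 * (s + 1) := ⟨M - 2 * (s + 1), by omega⟩
    rw [min_eq_left hbd, show M' + 2 * (s + 1) + 1 - 2 * (s + 1) = M' + 1 by omega,
      Nat.add_sub_cancel, adjGen_succ_succ]
    by_cases hk : b + 1 ≤ k'
    · rw [if_pos hk, if_pos ⟨by omega, hbd⟩]
      ring
    · rw [if_neg hk, if_neg (by omega)]
      ring
  · have : b = d := by omega
    subst this
    rw [min_eq_right (by omega), if_neg (by omega)]
    ring

lemma adjTerm_reflect {d M b k : ℕ} (hb : b ≤ d)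
    (h : d - b + 2 * k ≤ (d + 1) * (M + 1)) (r : ℕ) :
    (if b + 1 ≤ k then X ^ (k - (b + 1)) * adjTerm d M (d + 1 - (b + 1)) (k - (b + 1)) r else 0) =
      adjKeep d M b k r + adjDrop d M b k r := by
  have hmul : (d + 1) * (r + 1) = (d + 1) * r + (d + 1) := by ring
  by_cases hk : b + 1 + (d + 1) * r ≤ k
  swap
  · rw [adjTerm, adjKeep, adjDrop]
    split_ifs <;> first | omega | simp
  obtain ⟨k', rfl⟩ := Nat.exists_eq_add_of_le hk
  have hM : 2 * r + 1 ≤ M := by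
    by_contra hlt
    have : (d + 1) * M ≤ (d + 1) * (2 * r) := Nat.mul_le_mul_left _ (by omega)
    have : (d + 1) * (2 * r) = 2 * ((d + 1) * r) := by ring
    rw [mul_add (d + 1) M 1] at h
    omega
  obtain ⟨M', rfl⟩ := Nat.exists_eq_add_of_le hM
  have hrr : (r + 1) * r = r * (r - 1) + 2 * r := by
    cases r
    · rfl
    · simp only [Nat.add_sub_cancel]; ring
  rw [adjTerm, if_pos (by omega), if_pos (by omega), adjKeep, adjDrop, hrr,
    show b + 1 + (d + 1) * r + k' - (b + 1) - (d + 1) * r = k' by omega,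
    show b + 1 + (d + 1) * r + k' - (d + 1) * r - (b + 1) = k' by omega,
    show b + 1 + (d + 1) * r + k' - (b + 1) = (d + 1) * r + k' by omega,
    show b + 1 + (d + 1) * r + k' - (d + 1) * r = b + 1 + k' by omega,
    show 2 * r + 1 + M' - 2 * r = M' + 1 by omega,
    show 2 * r + 1 + M' + 1 - 2 * (r + 1) = M' by omega]
  have hA : (d + 1) * (2 * r + 1 + M') + 1 - (d + 1 - (d + 1 - (b + 1))) - 2 * ((d + 1) * r + k') =
      (d + 1) * (2 * r + 1 + M' + 1) + 1 - (d - b) - 2 * (b + 1 + (d + 1) * r + k') := by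
    rw [mul_add (d + 1) _ 1]
    omega
  rw [hA]
  generalize qHom _ r = W
  rw [show d + 1 - (d + 1 - (b + 1)) = b + 1 by omega, show d + 1 - (b + 1) = d - b by omega,
    min_eq_left (Nat.sub_le _ _)]
  obtain ⟨e, rfl⟩ := Nat.exists_eq_add_of_le hb
  rw [Nat.add_sub_cancel_left]
  cases e with
  | zero =>
    rw [if_neg (by omega), adjGen_succ_zero, if_pos (by rw [hmul]; omega), hmul,
      show b + 1 + (b + 0 + 1) * r + k' - ((b + 0 + 1) * r + (b + 0 + 1)) = k' by omega]
    simp only [add_zero]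
    ring
  | succ e =>
    rw [if_pos ⟨by omega, by omega⟩, adjGen_succ_succ, show b + (e + 1) - (b + 1) = e by omega,
      show b + (e + 1) - (e + 1) = b by omega]
    by_cases hk' : e + 1 ≤ k'
    · obtain ⟨j, rfl⟩ := Nat.exists_eq_add_of_le hk'
      rw [if_pos hk', if_pos (by rw [hmul]; omega), hmul,
        show b + 1 + (b + (e + 1) + 1) * r + (e + 1 + j) -
          ((b + (e + 1) + 1) * r + (b + (e + 1) + 1)) = j by omega, Nat.add_sub_cancel_left]
      ring
    · rw [if_neg hk', if_neg (by rw [hmul]; omega)]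
      ring

theorem adjGen_succ_eq_sum {d M b k K : ℕ} (hb : b ≤ d + 1) (hK : k < K)
    (h : d + 1 - b + 2 * k ≤ (d + 1) * M) :
    adjGen (d + 1) M b k = ∑ r ∈ Finset.range K, adjTerm d M b k r := by
  induction M generalizing b k with
  | zero =>
    obtain rfl : b = d + 1 := by omega
    obtain rfl : k = 0 := by omega
    rw [Finset.sum_eq_single_of_mem 0 (by simpa using hK)
      (fun r _ hr => adjTerm_eq_zero (by omega))]
    simp [adjTerm, adjGen_zero]
  | succ M ihM =>
    induction b with
    | zero =>
      have hM : 2 * k ≤ (d + 1) * M := by rw [mul_add] at h; omega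
      rw [adjGen_succ_zero, ihM le_rfl hK (by omega), Finset.mul_sum]
      refine Finset.sum_congr rfl fun r _ => ?_
      rw [adjTerm, adjTerm]
      split_ifs with hr
      · have hMr : 2 * r + 1 ≤ M + 1 := two_mul_le_of_weight (Nat.zero_le d) h hr
        obtain ⟨k', rfl⟩ := Nat.exists_eq_add_of_le hr
        rw [show M + 1 - 2 * r = M - 2 * r + 1 by omega, Nat.zero_min, adjGen_succ_zero,
          min_eq_right (Nat.le_succ d), Nat.add_sub_cancel_left,
          show (d + 1) * (M + 1) + 1 - (d + 1 - 0) - 2 * ((d + 1) * r + k') =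
            (d + 1) * M + 1 - (d + 1 - (d + 1)) - 2 * ((d + 1) * r + k') by
              rw [mul_add (d + 1) M 1]; omega]
        simp only [Nat.sub_zero, Nat.sub_self]
        ring
      · simp
    | succ b ihb =>
      have hb' : b ≤ d := by omega
      have h' : d - b + 2 * k ≤ (d + 1) * (M + 1) := by omega
      have hlow : adjGen (d + 1) (M + 1) b k = ∑ r ∈ Finset.range K, adjTerm d (M + 1) b k r := by
        by_cases hA : d + 1 - b + 2 * k ≤ (d + 1) * (M + 1)
        · exact ihb (by omega) hA
        · rw [adjGen_eq_zero (by omega) (by omega)]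
          refine (Finset.sum_eq_zero fun r _ => ?_).symm
          rw [adjTerm]
          split_ifs
          · cases r with
            | zero =>
              rw [adjGen_eq_zero (min_le_right _ _), mul_zero]
              rw [min_eq_left hb', Nat.mul_zero, Nat.mul_zero, Nat.sub_zero, Nat.sub_zero]
              rw [add_mul] at hA
              omega
            | succ r =>
              rw [show (d + 1) * (M + 1) + 1 - (d + 1 - b) - 2 * k = 0 by omega]
              simp
          · rfl
      have hhigh : (if b + 1 ≤ k then
            X ^ (k - (b + 1)) * adjGen (d + 1) M (d + 1 - (b + 1)) (k - (b + 1)) else 0) =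
          ∑ r ∈ Finset.range K, (adjKeep d M b k r + adjDrop d M b k r) := by
        rw [← Finset.sum_congr rfl fun r _ => adjTerm_reflect hb' h' r]
        split_ifs with hk
        · rw [ihM (by omega) (by omega) (by rw [mul_add] at h'; omega), Finset.mul_sum]
        · simp
      rw [adjGen_succ_succ, hlow, hhigh]
      obtain ⟨K, rfl⟩ : ∃ K', K = K' + 1 := ⟨K - 1, by omega⟩
      have hdrop : adjDrop d M b k K = 0 := by
        rw [adjDrop, if_neg]
        nlinarith
      rw [Finset.sum_range_succ' (adjTerm d (M + 1) (b + 1) k), adjTerm_succ_zero hb',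
        Finset.sum_congr rfl fun s _ => adjTerm_succ_succ hb' h' s, Finset.sum_add_distrib,
        Finset.sum_add_distrib, Finset.sum_add_distrib, Finset.sum_range_succ (adjDrop d M b k),
        hdrop, Finset.sum_range_succ' (adjTerm d (M + 1) b k),
        Finset.sum_range_succ' (adjKeep d M b k)]
      ring

lemma IsPartition.antitone_s8 {p : ℕ → ℕ} (hp : IsPartition p) : Antitone p :=
  antitone_nat_of_succ_le hp.1

lemma IsPartition.exists_forall_eq_zero {p : ℕ → ℕ} (hp : IsPartition p) :
    ∃ L, ∀ i, L ≤ i → p i = 0 := by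
  obtain ⟨L, hL⟩ := hp.2
  exact ⟨L, fun i hi => Nat.le_zero.1 (hL ▸ hp.antitone_s8 hi)⟩

lemma psize_eq_sum_range {p : ℕ → ℕ} {L : ℕ} (hL : ∀ i, L ≤ i → p i = 0) :
    psize p = ∑ i ∈ Finset.range L, p i := by
  refine finsum_eq_sum_of_support_subset _ fun i hi => ?_
  simp only [Finset.coe_range, Set.mem_Iio]
  by_contra h
  exact hi (hL i (not_lt.1 h))

lemma nstat_eq_sum_range {p : ℕ → ℕ} {L : ℕ} (hL : ∀ i, L ≤ i → p i = 0) :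
    nstat p = ∑ i ∈ Finset.range L, i * p i := by
  refine finsum_eq_sum_of_support_subset _ fun i hi => ?_
  simp only [Finset.coe_range, Set.mem_Iio]
  by_contra h
  exact hi (by simp [hL i (not_lt.1 h)])

lemma conj_eq_sum_range {p : ℕ → ℕ} {L : ℕ} (hL : ∀ i, L ≤ i → p i = 0) {j : ℕ} (hj : 1 ≤ j) :
    conj p j = ∑ i ∈ Finset.range L, if j ≤ p i then 1 else 0 := by
  have h : {i : ℕ | j ≤ p i} = ((Finset.range L).filter fun i => j ≤ p i : Finset ℕ) := by
    ext i
    simp only [Set.mem_ofPred_eq, Finset.coe_filter, Finset.mem_range]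
    refine ⟨fun hi => ⟨?_, hi⟩, fun hi => hi.2⟩
    by_contra h
    have := hL i (not_lt.1 h)
    omega
  rw [conj, h, Nat.card_coe_set_eq, Set.ncard_coe_finset, Finset.card_filter]

lemma IsPartition.conj_eq_zero {p : ℕ → ℕ} (hp : IsPartition p) {j : ℕ} (hj : p 0 < j) :
    conj p j = 0 := by
  have h : {i : ℕ | j ≤ p i} = ∅ := by
    ext i
    have := hp.antitone_s8 (Nat.zero_le i)
    simp only [Set.mem_ofPred_eq, Set.mem_empty_iff_false, iff_false]
    omega
  rw [conj, h]
  simp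

lemma Qstat_succ (p : ℕ → ℕ) (n : ℕ) : Qstat p (n + 1) = Qstat p n + conj p (n + 1) :=
  Finset.sum_Icc_succ_top (by omega) _

lemma IsPartition.Qstat_eq_psize {p : ℕ → ℕ} (hp : IsPartition p) {n : ℕ} (hn : p 0 ≤ n) :
    Qstat p n = psize p := by
  obtain ⟨L, hL⟩ := hp.exists_forall_eq_zero
  rw [Qstat, Finset.sum_congr rfl fun j hj => conj_eq_sum_range hL (Finset.mem_Icc.1 hj).1,
    Finset.sum_comm, psize_eq_sum_range hL]
  refine Finset.sum_congr rfl fun i _ => ?_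
  have h : (Finset.Icc 1 n).filter (fun j => j ≤ p i) = Finset.Icc 1 (p i) := by
    ext j
    have := hp.antitone_s8 (Nat.zero_le i)
    simp only [Finset.mem_filter, Finset.mem_Icc]
    omega
  rw [← Finset.card_filter, h, Nat.card_Icc, Nat.add_sub_cancel]

/-- Prepend the part `c` to a sequence of parts. -/
def consPart (c : ℕ) (p : ℕ → ℕ) : ℕ → ℕ
  | 0 => c
  | i + 1 => p i

lemma consPart_injective (c : ℕ) : Function.Injective (consPart c) :=
  fun _ _ h => funext fun i => congrFun h (i + 1)

lemma IsPartition.consPart {p : ℕ → ℕ} (hp : IsPartition p) {c : ℕ} (hc : p 0 ≤ c) :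
    IsPartition (consPart c p) := by
  refine ⟨fun i => ?_, hp.2.imp' (· + 1) fun _ h => h⟩
  cases i with
  | zero => exact hc
  | succ i => exact hp.1 i

lemma consPart_eq_zero {p : ℕ → ℕ} {L : ℕ} (hL : ∀ i, L ≤ i → p i = 0) (c i : ℕ)
    (hi : L + 1 ≤ i) : consPart c p i = 0 := by
  obtain ⟨i, rfl⟩ : ∃ j, i = j + 1 := ⟨i - 1, by omega⟩
  exact hL i (by omega)

lemma IsPartition.psize_consPart {p : ℕ → ℕ} (hp : IsPartition p) (c : ℕ) :
    psize (_root_.consPart c p) = c + psize p := by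
  obtain ⟨L, hL⟩ := hp.exists_forall_eq_zero
  rw [psize_eq_sum_range (consPart_eq_zero hL c), psize_eq_sum_range hL, Finset.sum_range_succ',
    add_comm]
  rfl

lemma IsPartition.nstat_consPart {p : ℕ → ℕ} (hp : IsPartition p) (c : ℕ) :
    nstat (_root_.consPart c p) = nstat p + psize p := by
  obtain ⟨L, hL⟩ := hp.exists_forall_eq_zero
  rw [nstat_eq_sum_range (consPart_eq_zero hL c), psize_eq_sum_range hL, nstat_eq_sum_range hL,
    Finset.sum_range_succ', zero_mul, add_zero, ← Finset.sum_add_distrib]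
  exact Finset.sum_congr rfl fun i _ => add_one_mul i (p i)

lemma IsPartition.conj_consPart {p : ℕ → ℕ} (hp : IsPartition p) (c : ℕ) {j : ℕ} (hj : 1 ≤ j) :
    conj (_root_.consPart c p) j = conj p j + if j ≤ c then 1 else 0 := by
  obtain ⟨L, hL⟩ := hp.exists_forall_eq_zero
  rw [conj_eq_sum_range (consPart_eq_zero hL c) hj, conj_eq_sum_range hL hj,
    Finset.sum_range_succ']
  rfl

lemma IsPartition.iterate_consPart {p : ℕ → ℕ} (hp : IsPartition p) {c : ℕ} (hc : p 0 ≤ c)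
    (r : ℕ) : IsPartition ((_root_.consPart c)^[r] p) ∧ (_root_.consPart c)^[r] p 0 ≤ c := by
  induction r with
  | zero => exact ⟨hp, hc⟩
  | succ r ih =>
    rw [Function.iterate_succ_apply']
    exact ⟨ih.1.consPart ih.2, le_rfl⟩

lemma psize_iterate_consPart {p : ℕ → ℕ} {c : ℕ} (hp : IsPartition p) (hc : p 0 ≤ c)
    (r : ℕ) :
    psize ((consPart c)^[r] p) = c * r + psize p := by
  induction r with
  | zero => simp
  | succ r ih =>
    rw [Function.iterate_succ_apply', (hp.iterate_consPart hc r).1.psize_consPart, ih]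
    ring

lemma two_mul_nstat_iterate_consPart {p : ℕ → ℕ} {c : ℕ} (hp : IsPartition p) (hc : p 0 ≤ c)
    (r : ℕ) :
    2 * nstat ((consPart c)^[r] p) = c * (r * (r - 1)) + 2 * r * psize p + 2 * nstat p := by
  induction r with
  | zero => simp
  | succ r ih =>
    rw [Function.iterate_succ_apply', (hp.iterate_consPart hc r).1.nstat_consPart, mul_add, ih,
      psize_iterate_consPart hp hc]
    cases r with
    | zero => simp; ring
    | succ r => simp only [Nat.add_sub_cancel]; ring

lemma conj_iterate_consPart {p : ℕ → ℕ} {c : ℕ} (hp : IsPartition p)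
    (hc : p 0 ≤ c) (r : ℕ) {j : ℕ} (hj : 1 ≤ j) :
    conj ((consPart c)^[r] p) j = conj p j + if j ≤ c then r else 0 := by
  induction r with
  | zero => simp
  | succ r ih =>
    rw [Function.iterate_succ_apply', (hp.iterate_consPart hc r).1.conj_consPart c hj, ih]
    split_ifs <;> rfl

lemma Qstat_iterate_consPart {p : ℕ → ℕ} {c : ℕ} (hp : IsPartition p)
    (hc : p 0 ≤ c) (r : ℕ) {n : ℕ} (hn : n ≤ c) :
    Qstat ((consPart c)^[r] p) n = n * r + Qstat p n := by
  induction n with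
  | zero => simp [Qstat]
  | succ n ih =>
    rw [Qstat_succ, Qstat_succ, ih (by omega), conj_iterate_consPart hp hc r (by omega),
      if_pos hn]
    ring

lemma IsPartition.exists_eq_iterate_consPart {p : ℕ → ℕ} (hp : IsPartition p) {c : ℕ}
    (hc : p 0 ≤ c + 1) :
    ∃ r μ, IsPartition μ ∧ μ 0 ≤ c ∧ p = (_root_.consPart (c + 1))^[r] μ := by
  obtain ⟨L, hL⟩ := hp.2
  induction L generalizing p with
  | zero => exact ⟨0, p, hp, by omega, rfl⟩
  | succ L ih =>
    by_cases h0 : p 0 ≤ c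
    · exact ⟨0, p, hp, h0, rfl⟩
    · obtain ⟨r, μ, hμ, hμc, h⟩ := ih (p := fun i => p (i + 1)) ⟨fun i => hp.1 (i + 1), L, hL⟩
        ((hp.1 0).trans hc) hL
      refine ⟨r + 1, μ, hμ, hμc, ?_⟩
      rw [Function.iterate_succ_apply', ← h]
      funext i
      cases i with
      | zero => simp only [_root_.consPart]; omega
      | succ i => rfl

open Classical in
/-- The partitions of `k` with all parts at most `d`. -/
noncomputable def boundedPartitions : ℕ → ℕ → Finset (ℕ → ℕ)
  | 0, k => if k = 0 then {fun _ => 0} else ∅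
  | d + 1, k => ((Finset.range (k + 1)).filter fun r => (d + 1) * r ≤ k).biUnion fun r =>
      (boundedPartitions d (k - (d + 1) * r)).image (consPart (d + 1))^[r]

lemma mem_boundedPartitions {d k : ℕ} {p : ℕ → ℕ} :
    p ∈ boundedPartitions d k ↔ IsPartition p ∧ psize p = k ∧ p 0 ≤ d := by
  classical
  induction d generalizing k p with
  | zero =>
    have h0 : IsPartition p → p 0 ≤ 0 → p = fun _ => 0 := fun hp h => funext fun i =>
      Nat.le_zero.1 ((hp.antitone_s8 (Nat.zero_le i)).trans h)
    have hz : IsPartition (fun _ => 0) := ⟨fun _ => le_rfl, 0, rfl⟩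
    have hs : psize (fun _ => 0) = 0 := by simp [psize]
    rw [boundedPartitions]
    split_ifs with hk
    · rw [Finset.mem_singleton]
      refine ⟨?_, fun h => h0 h.1 h.2.2⟩
      rintro rfl
      exact ⟨hz, hs.trans hk.symm, le_rfl⟩
    · simp only [Finset.notMem_empty, false_iff]
      rintro ⟨hp, hk', hp0⟩
      rw [h0 hp hp0, hs] at hk'
      exact hk hk'.symm
  | succ d ih =>
    rw [boundedPartitions]
    simp only [Finset.mem_biUnion, Finset.mem_filter, Finset.mem_range, Finset.mem_image, ih]
    constructor
    · rintro ⟨r, ⟨_, hr⟩, μ, ⟨hμ, hμk, hμd⟩, rfl⟩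
      have hμd' : μ 0 ≤ d + 1 := by omega
      refine ⟨(hμ.iterate_consPart hμd' r).1, ?_, (hμ.iterate_consPart hμd' r).2⟩
      rw [psize_iterate_consPart hμ hμd', hμk]
      omega
    · rintro ⟨hp, hpk, hpd⟩
      obtain ⟨r, μ, hμ, hμd, rfl⟩ := hp.exists_eq_iterate_consPart hpd
      rw [psize_iterate_consPart hμ (by omega)] at hpk
      have : r ≤ (d + 1) * r := Nat.le_mul_of_pos_left r (by omega)
      exact ⟨r, ⟨by omega, by omega⟩, μ, ⟨hμ, by omega, hμd⟩, rfl⟩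

lemma sum_boundedPartitions_succ {R : Type*} [AddCommMonoid R] (d k : ℕ) (f : (ℕ → ℕ) → R) :
    ∑ p ∈ boundedPartitions (d + 1) k, f p = ∑ r ∈ Finset.range (k + 1),
      if (d + 1) * r ≤ k then
        ∑ p ∈ boundedPartitions d (k - (d + 1) * r), f ((consPart (d + 1))^[r] p) else 0 := by
  classical
  rw [boundedPartitions, Finset.sum_biUnion, Finset.sum_filter]
  · refine Finset.sum_congr rfl fun r _ => ?_
    rw [Finset.sum_image ((consPart_injective (d + 1)).iterate r).injOn]
  · have key : ∀ r, ∀ p ∈ (boundedPartitions d (k - (d + 1) * r)).image (consPart (d + 1))^[r],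
        conj p (d + 1) = r := by
      intro r p hp
      obtain ⟨μ, hμ, rfl⟩ := Finset.mem_image.1 hp
      obtain ⟨hμ, -, hμd⟩ := mem_boundedPartitions.1 hμ
      rw [conj_iterate_consPart hμ (by omega) r (by omega), if_pos le_rfl,
        hμ.conj_eq_zero (by omega), zero_add]
    intro r _ s _ hrs
    refine Finset.disjoint_left.2 fun p hp hp' => hrs ?_
    rw [← key r p hp, key s p hp']

/-- The summand of the KOH identity, with the conditions and factors restricted to `n ≤ d`. -/
noncomputable def kohWeight (d M : ℕ) (p : ℕ → ℕ) : ℚ[X] :=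
  if ∀ n ∈ Finset.Icc 1 d, 2 * Qstat p n ≤ n * M then
    X ^ (2 * nstat p) * ∏ n ∈ Finset.Icc 1 d, qHom (n * M + 1 - 2 * Qstat p n) (mstat p n)
  else 0

lemma kohWeight_iterate_consPart {d M r : ℕ} {p : ℕ → ℕ} (hp : IsPartition p) (hpd : p 0 ≤ d)
    (h : 2 * ((d + 1) * r + psize p) ≤ (d + 1) * M) :
    kohWeight (d + 1) M ((consPart (d + 1))^[r] p) =
      X ^ ((d + 1) * (r * (r - 1)) + 2 * r * psize p) *
        qHom ((d + 1) * M + 1 - 2 * ((d + 1) * r + psize p)) r * kohWeight d (M - 2 * r) p := by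
  have hpd' : p 0 ≤ d + 1 := by omega
  have hM : 2 * r ≤ M := by
    refine Nat.le_of_mul_le_mul_left (?_ : (d + 1) * (2 * r) ≤ (d + 1) * M) (by omega)
    rw [mul_left_comm]
    omega
  obtain ⟨M, rfl⟩ := Nat.exists_eq_add_of_le hM
  rw [Nat.add_sub_cancel_left]
  have hQ : ∀ n ∈ Finset.Icc 1 d, Qstat ((consPart (d + 1))^[r] p) n = n * r + Qstat p n :=
    fun n hn => Qstat_iterate_consPart hp hpd' r (by have := Finset.mem_Icc.1 hn; omega)
  have hQtop : Qstat ((consPart (d + 1))^[r] p) (d + 1) = (d + 1) * r + psize p := by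
    rw [Qstat_iterate_consPart hp hpd' r le_rfl, hp.Qstat_eq_psize hpd']
  have hm : ∀ n ∈ Finset.Icc 1 d, mstat ((consPart (d + 1))^[r] p) n = mstat p n := by
    intro n hn
    have := Finset.mem_Icc.1 hn
    rw [mstat, mstat, conj_iterate_consPart hp hpd' r (by omega),
      conj_iterate_consPart hp hpd' r (by omega), if_pos (by omega), if_pos (by omega)]
    omega
  have hmtop : mstat ((consPart (d + 1))^[r] p) (d + 1) = r := by
    rw [mstat, conj_iterate_consPart hp hpd' r (by omega),
      conj_iterate_consPart hp hpd' r (by omega), if_pos le_rfl, if_neg (by omega),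
      hp.conj_eq_zero (by omega), hp.conj_eq_zero (by omega)]
    omega
  have hlin : ∀ n, n * (2 * r + M) = 2 * (n * r) + n * M := fun n => by ring
  have hcond : (∀ n ∈ Finset.Icc 1 (d + 1),
      2 * Qstat ((consPart (d + 1))^[r] p) n ≤ n * (2 * r + M)) ↔
        ∀ n ∈ Finset.Icc 1 d, 2 * Qstat p n ≤ n * M := by
    constructor
    · intro H n hn
      have h1 := H n (Finset.Icc_subset_Icc_right (Nat.le_succ d) hn)
      rw [hQ n hn, hlin] at h1
      omega
    · intro H n hn
      by_cases hnd : n = d + 1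
      · rw [hnd, hQtop]
        exact h
      · have hn' : n ∈ Finset.Icc 1 d := by
          rw [Finset.mem_Icc] at hn ⊢
          omega
        have h1 := H n hn'
        rw [hQ n hn', hlin]
        omega
  rw [kohWeight, kohWeight, if_congr hcond rfl rfl]
  split_ifs
  · rw [Finset.prod_Icc_succ_top (by omega), hQtop, hmtop,
      two_mul_nstat_iterate_consPart hp hpd',
      Finset.prod_congr rfl fun n hn => by
        rw [hQ n hn, hm n hn, hlin, show 2 * (n * r) + n * M + 1 - 2 * (n * r + Qstat p n) =
          n * M + 1 - 2 * Qstat p n by omega]]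
    ring
  · rw [mul_zero]

lemma adjGen_self_eq_sum (d M k : ℕ) :
    adjGen d M d k = ∑ p ∈ boundedPartitions d k, kohWeight d M p := by
  induction d generalizing M k with
  | zero =>
    have h : adjGen 0 M 0 k = if k = 0 then 1 else 0 := by
      induction M with
      | zero => simp [adjGen_zero]
      | succ M ih =>
        rw [adjGen_succ_zero, ih]
        split_ifs with hk <;> simp [hk]
    rw [h, boundedPartitions]
    split_ifs <;> simp [kohWeight, nstat]
  | succ d ih =>
    by_cases hk : 2 * k ≤ (d + 1) * M
    · rw [adjGen_succ_eq_sum le_rfl (Nat.lt_succ_self k) (by omega), sum_boundedPartitions_succ]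
      refine Finset.sum_congr rfl fun r _ => ?_
      rw [adjTerm]
      split_ifs with hr
      · rw [min_eq_right (Nat.le_succ d), ih, Finset.mul_sum]
        refine Finset.sum_congr rfl fun p hp => ?_
        obtain ⟨hp, hpk, hpd⟩ := mem_boundedPartitions.1 hp
        have hk' : (d + 1) * r + psize p = k := by omega
        rw [kohWeight_iterate_consPart hp hpd (by rwa [hk']), hk', hpk]
        simp
      · rfl
    · rw [adjGen_eq_zero le_rfl (by omega)]
      refine (Finset.sum_eq_zero fun p hp => ?_).symm
      obtain ⟨hp, hpk, hpd⟩ := mem_boundedPartitions.1 hp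
      rw [kohWeight, if_neg]
      intro H
      have := H (d + 1) (by simp)
      rw [hp.Qstat_eq_psize hpd, hpk] at this
      exact hk this

lemma finprod_qGauss_eq {d M : ℕ} {p : ℕ → ℕ} (hp : IsPartition p) (hpd : p 0 ≤ d)
    (h : ∀ n ∈ Finset.Icc 1 d, 2 * Qstat p n ≤ n * M) :
    ∏ᶠ n : ℕ, qGauss ((n + 1) * M - 2 * Qstat p (n + 1)) (mstat p (n + 1)) =
      ∏ n ∈ Finset.Icc 1 d, qHom (n * M + 1 - 2 * Qstat p n) (mstat p n) := by
  rw [finprod_eq_prod_of_mulSupport_subset (s := Finset.range d), Finset.range_eq_Ico,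
    Finset.prod_Ico_add' (fun n => qGauss (n * M - 2 * Qstat p n) (mstat p n)),
    zero_add, Finset.Ico_add_one_right_eq_Icc]
  · refine Finset.prod_congr rfl fun n hn => ?_
    rw [qGauss_eq_qHom, Nat.sub_add_comm (h n hn)]
  · intro n hn
    simp only [Finset.coe_range, Set.mem_Iio]
    by_contra hnd
    refine hn ?_
    change qGauss _ (mstat p (n + 1)) = 1
    rw [mstat, hp.conj_eq_zero (by omega), Nat.zero_sub, qGauss_eq_qHom, qHom_zero_right]

/-- **The KOH identity.** For positive integers `k` and `N`,
`[N+k-1, k]_q = ∑_ν q^{2·n(ν)} ∏_{n ≥ 1} [n(N+1) - 2·Q_n(ν) + m_n(ν), m_n(ν)]_q`,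
the sum over all partitions `ν` of `k` with `2·Q_n(ν) ≤ n(N+1)` for all `n ≥ 1`. -/
theorem KOH_identity (k N : ℕ) (hk : 0 < k) (hN : 0 < N) :
    qGauss (N - 1) k =
      ∑ᶠ ν ∈ {ν : ℕ → ℕ | IsPartition ν ∧ psize ν = k ∧
          ∀ n, 1 ≤ n → 2 * Qstat ν n ≤ n * (N + 1)},
        (X : Polynomial ℚ) ^ (2 * nstat ν) *
          ∏ᶠ n : ℕ,
            qGauss ((n + 1) * (N + 1) - 2 * Qstat ν (n + 1)) (mstat ν (n + 1)) := by
  classical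
  have hset : {ν : ℕ → ℕ | IsPartition ν ∧ psize ν = k ∧
      ∀ n, 1 ≤ n → 2 * Qstat ν n ≤ n * (N + 1)} =
      ((boundedPartitions k k).filter fun ν =>
        ∀ n ∈ Finset.Icc 1 k, 2 * Qstat ν n ≤ n * (N + 1) : Finset (ℕ → ℕ)) := by
    ext ν
    simp only [Set.mem_ofPred_eq, Finset.coe_filter, mem_boundedPartitions, Finset.mem_Icc]
    constructor
    · rintro ⟨hν, hνk, h⟩
      obtain ⟨L, hL⟩ := hν.exists_forall_eq_zero
      refine ⟨⟨hν, hνk, ?_⟩, fun n hn => h n hn.1⟩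
      rw [← hνk, psize_eq_sum_range (L := L + 1) (fun i hi => hL i (by omega))]
      exact Finset.single_le_sum (fun _ _ => Nat.zero_le _) (by simp)
    · rintro ⟨⟨hν, hνk, hν0⟩, h⟩
      refine ⟨hν, hνk, fun n hn => ?_⟩
      by_cases hnk : n ≤ k
      · exact h n ⟨hn, hnk⟩
      · have hk' := h k ⟨hk, le_rfl⟩
        rw [hν.Qstat_eq_psize hν0] at hk'
        rw [hν.Qstat_eq_psize (by omega)]
        exact hk'.trans (Nat.mul_le_mul_right _ (by omega))
  rw [qGauss_eq_qHom, Nat.sub_add_cancel hN, ← adjGen_eq_qHom le_rfl le_rfl, adjGen_self_eq_sum,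
    hset, finsum_mem_coe_finset, Finset.sum_filter]
  refine Finset.sum_congr rfl fun ν hν => ?_
  obtain ⟨hν, -, hν0⟩ := mem_boundedPartitions.1 hν
  rw [kohWeight]
  split_ifs with h
  · rw [finprod_qGauss_eq hν hν0 h]
  · rfl
end

section
/- Let m and n be nonnegative integers. Then the ordinary q-Gaussian coefficient [m+n, n]_q is a symmetric and unimodal polynomial in q of degree mn. -/
open scoped BigOperators
open Polynomial

namespace GaussianBinomial

/-! ### An `sl₂`-action on polynomials in countably many variables -/

/-- The raising derivation `x_i ↦ (m - i) x_{i+1}`. -/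
noncomputable def raising (m : ℕ) : Derivation ℚ (MvPolynomial ℕ ℚ) (MvPolynomial ℕ ℚ) :=
  MvPolynomial.mkDerivation ℚ fun i => ((m : ℚ) - i) • MvPolynomial.X (i + 1)

/-- The lowering derivation `x_i ↦ i x_{i-1}`. -/
noncomputable def lowering : Derivation ℚ (MvPolynomial ℕ ℚ) (MvPolynomial ℕ ℚ) :=
  MvPolynomial.mkDerivation ℚ fun i => (i : ℚ) • MvPolynomial.X (i - 1)

/-- The diagonal derivation `x_i ↦ (2i - m) x_i`. -/
noncomputable def diagonal (m : ℕ) : Derivation ℚ (MvPolynomial ℕ ℚ) (MvPolynomial ℕ ℚ) :=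
  MvPolynomial.mkDerivation ℚ fun i => (2 * (i : ℚ) - m) • MvPolynomial.X i

theorem lie_raising_lowering (m : ℕ) : ⁅raising m, lowering⁆ = diagonal m := by
  refine MvPolynomial.derivation_ext fun i => ?_
  rcases i with _ | i
  · simp [Derivation.commutator_apply, raising, lowering, diagonal]
  · simp only [Derivation.commutator_apply, raising, lowering, diagonal,
      MvPolynomial.mkDerivation_X, Derivation.map_smul, smul_smul, Nat.add_sub_cancel, ← sub_smul]
    congr 1
    push_cast
    ring

/-- Exponents of monomials of degree `n` in `x_0, …, x_m` whose index sum is `k`. -/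
def exponents (m n : ℕ) (k : ℤ) : Set (ℕ →₀ ℕ) :=
  {s | (∀ i, m < i → s i = 0) ∧ s.degree = n ∧ (Finsupp.weight (fun i : ℕ => i) s : ℤ) = k}

/-- The polynomials spanned by monomials of degree `n` in `x_0, …, x_m` with index sum `k`. -/
noncomputable def weightSpace (m n : ℕ) (k : ℤ) : Submodule ℚ (MvPolynomial ℕ ℚ) :=
  MvPolynomial.restrictSupport ℚ (exponents m n k)

theorem exponents_of_neg (m n : ℕ) {k : ℤ} (hk : k < 0) : exponents m n k = ∅ := by
  ext s
  simp only [exponents, Set.mem_ofPred_eq, Set.mem_empty_iff_false, iff_false]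
  omega

theorem sub_single_add_single {s : ℕ →₀ ℕ} {i : ℕ} (hi : s i ≠ 0) :
    s - Finsupp.single i 1 + Finsupp.single i 1 = s :=
  tsub_add_cancel_of_le (Finsupp.single_le_iff.mpr (Nat.one_le_iff_ne_zero.mpr hi))

theorem map_monomial_of_shift {D : Derivation ℚ (MvPolynomial ℕ ℚ) (MvPolynomial ℕ ℚ)}
    {c : ℕ → ℚ} {g : ℕ → ℕ}
    (hD : D = MvPolynomial.mkDerivation ℚ fun i => c i • MvPolynomial.X (g i)) (s : ℕ →₀ ℕ) :
    D (MvPolynomial.monomial s 1) = s.sum fun i a =>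
      MvPolynomial.monomial (s - Finsupp.single i 1 + Finsupp.single (g i) 1) ((a : ℚ) * c i) := by
  rw [hD, MvPolynomial.mkDerivation_monomial, one_smul]
  refine Finset.sum_congr rfl fun i _ => ?_
  simp only
  rw [smul_eq_mul, MvPolynomial.X, MvPolynomial.smul_monomial, MvPolynomial.monomial_mul]
  simp

theorem mem_weightSpace_of_shift {D : Derivation ℚ (MvPolynomial ℕ ℚ) (MvPolynomial ℕ ℚ)}
    {c : ℕ → ℚ} {g : ℕ → ℕ} {m n : ℕ} {d : ℤ}
    (hD : D = MvPolynomial.mkDerivation ℚ fun i => c i • MvPolynomial.X (g i))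
    (hg : ∀ i, i ≤ m → c i ≠ 0 → g i ≤ m ∧ (g i : ℤ) = i + d) {k : ℤ}
    {p : MvPolynomial ℕ ℚ} (hp : p ∈ weightSpace m n k) : D p ∈ weightSpace m n (k + d) := by
  rw [weightSpace, MvPolynomial.restrictSupport_eq_span] at hp
  induction hp using Submodule.span_induction with
  | zero => simp
  | add x y _ _ hx hy => rw [map_add]; exact add_mem hx hy
  | smul a x _ hx => rw [Derivation.map_smul]; exact Submodule.smul_mem _ _ hx
  | mem x hx =>
    obtain ⟨s, ⟨hs, hn, hk⟩, rfl⟩ := hx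
    simp only
    rw [map_monomial_of_shift hD]
    refine Submodule.sum_mem _ fun i hi => ?_
    rw [weightSpace, MvPolynomial.monomial_mem_restrictSupport]
    by_cases hc : c i = 0
    · right; simp [hc]
    have hsi : s i ≠ 0 := Finsupp.mem_support_iff.mp hi
    have him : i ≤ m := by
      by_contra h
      exact hsi (hs i (by omega))
    obtain ⟨hgm, hgd⟩ := hg i him hc
    obtain ⟨t, rfl⟩ : ∃ t, s = t + Finsupp.single i 1 :=
      ⟨s - Finsupp.single i 1, (sub_single_add_single hsi).symm⟩
    left
    rw [add_tsub_cancel_right]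
    refine ⟨fun l hl => ?_, ?_, ?_⟩
    · have := hs l hl
      simp only [Finsupp.add_apply, Nat.add_eq_zero_iff] at this ⊢
      exact ⟨this.1, Finsupp.single_eq_of_ne (by omega)⟩
    · simpa using hn
    · simp only [map_add, Finsupp.weight_single, smul_eq_mul, one_mul, Nat.cast_add] at hk ⊢
      omega

theorem raising_mem {m n : ℕ} {k : ℤ} {p : MvPolynomial ℕ ℚ} (hp : p ∈ weightSpace m n k) :
    raising m p ∈ weightSpace m n (k + 1) := by
  refine mem_weightSpace_of_shift rfl (fun i hi hc => ⟨?_, by simp⟩) hp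
  have : i ≠ m := by rintro rfl; simp at hc
  omega

theorem lowering_mem {m n : ℕ} {k : ℤ} {p : MvPolynomial ℕ ℚ} (hp : p ∈ weightSpace m n k) :
    lowering p ∈ weightSpace m n (k - 1) := by
  refine mem_weightSpace_of_shift (d := -1) rfl (fun i hi hc => ?_) hp
  have : i ≠ 0 := by rintro rfl; simp at hc
  omega

theorem diagonal_apply {m n : ℕ} {k : ℤ} {p : MvPolynomial ℕ ℚ} (hp : p ∈ weightSpace m n k) :
    diagonal m p = (2 * (k : ℚ) - m * n) • p := by
  rw [weightSpace, MvPolynomial.restrictSupport_eq_span] at hp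
  induction hp using Submodule.span_induction with
  | zero => simp
  | add x y _ _ hx hy => rw [map_add, hx, hy, smul_add]
  | smul a x _ hx => rw [Derivation.map_smul, hx, smul_comm]
  | mem x hx =>
    obtain ⟨s, ⟨-, rfl, rfl⟩, rfl⟩ := hx
    simp only
    rw [map_monomial_of_shift (D := diagonal m) (g := id) rfl, MvPolynomial.smul_monomial]
    have : ∀ i ∈ s.support, s - Finsupp.single i 1 + Finsupp.single (id i) 1 = s := fun i hi =>
      sub_single_add_single (Finsupp.mem_support_iff.mp hi)
    rw [Finsupp.sum, Finset.sum_congr rfl fun i hi => by rw [this i hi], ← map_sum]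
    congr 1
    rw [Finsupp.weight_apply, Finsupp.degree_apply, Finsupp.sum]
    push_cast
    rw [smul_eq_mul, mul_one, Finset.mul_sum, Finset.mul_sum, ← Finset.sum_sub_distrib]
    refine Finset.sum_congr rfl fun i _ => ?_
    simp
    ring

theorem lowering_iterate_mem {m n : ℕ} {k : ℤ} {p : MvPolynomial ℕ ℚ}
    (hp : p ∈ weightSpace m n k) (j : ℕ) : lowering^[j] p ∈ weightSpace m n (k - j) := by
  induction j with
  | zero => simpa using hp
  | succ j ih =>
    rw [Function.iterate_succ_apply']
    convert lowering_mem ih using 1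
    push_cast
    ring_nf

theorem raising_lowering_iterate {m n : ℕ} {k : ℤ} {p : MvPolynomial ℕ ℚ}
    (hp : p ∈ weightSpace m n k) (h0 : raising m p = 0) (j : ℕ) :
    raising m (lowering^[j + 1] p) = ((j + 1) * (2 * (k : ℚ) - m * n - j)) • lowering^[j] p := by
  have key (q : MvPolynomial ℕ ℚ) :
      raising m (lowering q) = lowering (raising m q) + diagonal m q := by
    rw [← lie_raising_lowering, Derivation.commutator_apply]; ring
  induction j with
  | zero => simp [key, h0, diagonal_apply hp]
  | succ j ih =>
    rw [Function.iterate_succ_apply', key, ih, Derivation.map_smul, ← Function.iterate_succ_apply' lowering,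
      diagonal_apply (lowering_iterate_mem hp _), ← add_smul]
    congr 1
    push_cast
    ring

theorem eq_zero_of_raising_eq_zero {m n : ℕ} {k : ℤ} (hk : 2 * k < m * n) {p : MvPolynomial ℕ ℚ}
    (hp : p ∈ weightSpace m n k) (h0 : raising m p = 0) : p = 0 := by
  have hvanish : lowering^[k.toNat + 1] p = 0 := by
    have := lowering_iterate_mem hp (k.toNat + 1)
    rw [weightSpace, exponents_of_neg m n (by omega), MvPolynomial.mem_restrictSupport_iff] at this
    simpa using this
  have hstep (j : ℕ) (h : lowering^[j + 1] p = 0) : lowering^[j] p = 0 := by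
    have := raising_lowering_iterate hp h0 j
    rw [h, map_zero, eq_comm, smul_eq_zero] at this
    refine this.resolve_left (mul_ne_zero (by positivity) ?_)
    have : (2 * k : ℚ) < m * n := by exact_mod_cast hk
    have : (0 : ℚ) ≤ j := by positivity
    linarith
  have hdown (j : ℕ) : lowering^[j] p = 0 → p = 0 := by
    induction j with
    | zero => simp
    | succ j ih => exact fun h => ih (hstep j h)
  exact hdown _ hvanish

/-! ### Counting monomials -/

/-- The generating polynomial, by index sum, of the monomials of degree `n` in `x_0, …, x_m`. -/
noncomputable def indexSumPoly (m n : ℕ) : ℚ[X] :=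
  ∑ s ∈ Finset.finsuppAntidiag (Finset.range (m + 1)) n, X ^ Finsupp.weight (fun i : ℕ => i) s

theorem mem_finsuppAntidiag_range {m n : ℕ} {s : ℕ →₀ ℕ} :
    s ∈ Finset.finsuppAntidiag (Finset.range (m + 1)) n ↔
      (∀ i, m < i → s i = 0) ∧ s.degree = n := by
  rw [Finset.mem_finsuppAntidiag, and_comm]
  have h1 : s.support ⊆ Finset.range (m + 1) ↔ ∀ i, m < i → s i = 0 := by
    simp only [Finset.subset_iff, Finsupp.mem_support_iff, Finset.mem_range]
    exact forall_congr' fun i => by grind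
  rw [h1]
  refine and_congr_right fun h => ?_
  rw [Finsupp.degree_apply, Finset.sum_subset (h1.mpr h) (by simp)]

theorem exponents_natCast (m n k : ℕ) :
    exponents m n k = ↑((Finset.finsuppAntidiag (Finset.range (m + 1)) n).filter
      fun s => Finsupp.weight (fun i : ℕ => i) s = k) := by
  ext s
  simp only [exponents, Set.mem_ofPred_eq, Finset.coe_filter, mem_finsuppAntidiag_range, and_assoc,
    Nat.cast_inj]

theorem coeff_indexSumPoly (m n k : ℕ) :
    (indexSumPoly m n).coeff k = Module.finrank ℚ (weightSpace m n k) := by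
  rw [weightSpace, exponents_natCast,
    Module.finrank_eq_card_basis (MvPolynomial.basisRestrictSupport ℚ _), ← Nat.card_eq_fintype_card,
    Nat.card_coe_set_eq, Set.ncard_coe_finset, indexSumPoly, Polynomial.finsetSum_coeff, Finset.card_filter]
  push_cast
  exact Finset.sum_congr rfl fun s _ => by simp [Polynomial.coeff_X_pow, eq_comm]

instance (m n k : ℕ) : Module.Finite ℚ (weightSpace m n k) := by
  rw [weightSpace, exponents_natCast]
  exact Module.Finite.of_basis (MvPolynomial.basisRestrictSupport ℚ _)

theorem coeff_indexSumPoly_le_succ {m n k : ℕ} (hk : 2 * k < m * n) :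
    (indexSumPoly m n).coeff k ≤ (indexSumPoly m n).coeff (k + 1) := by
  rw [coeff_indexSumPoly, coeff_indexSumPoly, Nat.cast_le]
  let f : weightSpace m n k →ₗ[ℚ] weightSpace m n (k + 1 : ℕ) :=
    (raising m).toLinearMap.restrict fun p hp => by simpa using raising_mem hp
  refine LinearMap.finrank_le_finrank_of_injective (f := f) ?_
  rw [injective_iff_map_eq_zero]
  intro p hp
  exact Subtype.ext (eq_zero_of_raising_eq_zero (by exact_mod_cast hk) p.2
    (congrArg Subtype.val hp))

theorem indexSumPoly_zero_right (m : ℕ) : indexSumPoly m 0 = 1 := by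
  simp [indexSumPoly]

theorem indexSumPoly_zero_left (n : ℕ) : indexSumPoly 0 n = 1 := by
  have : Finset.finsuppAntidiag (Finset.range (0 + 1)) n = {Finsupp.single 0 n} := by
    ext s
    rw [mem_finsuppAntidiag_range, Finset.mem_singleton]
    constructor
    · rintro ⟨h, rfl⟩
      have hs : s = Finsupp.single 0 (s 0) := by
        ext i
        rcases i with _ | i
        · simp
        · simp [h (i + 1) (by omega)]
      rw [hs]
      simp
    · rintro rfl
      exact ⟨fun i hi => Finsupp.single_eq_of_ne (by omega), by simp⟩
  rw [indexSumPoly, this]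
  simp [Finsupp.weight_single]

theorem indexSumPoly_succ_succ (m n : ℕ) :
    indexSumPoly (m + 1) (n + 1) =
      indexSumPoly m (n + 1) + X ^ (m + 1) * indexSumPoly (m + 1) n := by
  rw [indexSumPoly, ← Finset.sum_filter_add_sum_filter_not _ (fun s => s (m + 1) = 0)]
  congr 1
  · refine Finset.sum_congr ?_ fun _ _ => rfl
    ext s
    simp only [Finset.mem_filter, mem_finsuppAntidiag_range]
    constructor
    · rintro ⟨⟨h, hn⟩, h0⟩
      refine ⟨fun i hi => ?_, hn⟩
      rcases Nat.lt_or_eq_of_le (Nat.succ_le_of_lt hi) with h' | rfl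
      exacts [h i h', h0]
    · rintro ⟨h, hn⟩
      exact ⟨⟨fun i hi => h i (by omega), hn⟩, h _ (by omega)⟩
  · rw [indexSumPoly, Finset.mul_sum]
    symm
    refine Finset.sum_bij (fun s _ => s + Finsupp.single (m + 1) 1) ?_ ?_ ?_ ?_
    · intro s hs
      simp only [Finset.mem_filter, mem_finsuppAntidiag_range] at hs ⊢
      refine ⟨⟨fun i hi => ?_, by simp [hs.2]⟩, by simp⟩
      rw [Finsupp.add_apply, hs.1 i hi, Finsupp.single_eq_of_ne (by omega), add_zero]
    · intro s _ t _ h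
      exact add_right_cancel h
    · intro s hs
      simp only [Finset.mem_filter, mem_finsuppAntidiag_range] at hs
      obtain ⟨⟨h, hn⟩, h0⟩ := hs
      have hs := sub_single_add_single h0
      refine ⟨s - Finsupp.single (m + 1) 1, ?_, hs⟩
      rw [mem_finsuppAntidiag_range]
      refine ⟨fun i hi => by simp [h i hi], ?_⟩
      rw [← hs] at hn
      simpa using hn
    · intro s _
      rw [map_add, Finsupp.weight_single, one_smul, pow_add _ _ (m + 1), mul_comm]

/-! ### The product formula -/

/-- The product `∏_{i=1}^{b} (1 - q^{a+i})`. -/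
noncomputable def qProd (a b : ℕ) : ℚ[X] := ∏ i ∈ Finset.Icc 1 b, (1 - (X : ℚ[X]) ^ (a + i))

theorem qProd_succ (a b : ℕ) : qProd a (b + 1) = qProd a b * (1 - X ^ (a + (b + 1))) :=
  Finset.prod_Icc_succ_top (by omega) _

theorem qProd_succ_left (a b : ℕ) : qProd a (b + 1) = (1 - X ^ (a + 1)) * qProd (a + 1) b := by
  induction b with
  | zero => simp [qProd]
  | succ b ih =>
    rw [qProd_succ, ih, qProd_succ (a + 1) b]
    ring

theorem indexSumPoly_mul_qProd (m n : ℕ) : indexSumPoly m n * qProd 0 n = qProd m n := by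
  induction n generalizing m with
  | zero => simp [indexSumPoly_zero_right, qProd]
  | succ n ihn =>
    induction m with
    | zero => rw [indexSumPoly_zero_left, one_mul]
    | succ m ihm =>
      rw [indexSumPoly_succ_succ, add_mul, ihm, qProd_succ 0, qProd_succ (m + 1),
        qProd_succ_left m, ← ihn (m + 1)]
      ring

theorem one_sub_X_pow_ne_zero {k : ℕ} (hk : k ≠ 0) : (1 - X ^ k : ℚ[X]) ≠ 0 := by
  intro h
  simpa [hk] using congrArg (Polynomial.eval 0) h

theorem natDegree_one_sub_X_pow (k : ℕ) : (1 - X ^ k : ℚ[X]).natDegree = k := by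
  rw [← natDegree_neg, neg_sub, ← C_1, natDegree_X_pow_sub_C]

theorem reverse_one_sub_X_pow {k : ℕ} (hk : k ≠ 0) :
    (1 - X ^ k : ℚ[X]).reverse = -(1 - X ^ k) := by
  ext i
  rw [coeff_reverse, natDegree_one_sub_X_pow, coeff_neg, coeff_sub, coeff_sub, coeff_one,
    coeff_one, coeff_X_pow, coeff_X_pow]
  rcases le_or_gt i k with h | h
  · rw [revAt_le h]
    grind
  · rw [revAt_eq_self_of_lt h]
    grind

theorem qProd_ne_zero (a b : ℕ) : qProd a b ≠ 0 :=
  Finset.prod_ne_zero_iff.mpr fun i hi =>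
    one_sub_X_pow_ne_zero (by have := (Finset.mem_Icc.mp hi).1; omega)

theorem natDegree_qProd (a b : ℕ) : (qProd a b).natDegree = a * b + (qProd 0 b).natDegree := by
  induction b with
  | zero => simp [qProd]
  | succ b ih =>
    rw [qProd_succ, qProd_succ, natDegree_mul (qProd_ne_zero _ _) (one_sub_X_pow_ne_zero (by omega)),
      natDegree_mul (qProd_ne_zero _ _) (one_sub_X_pow_ne_zero (by omega)), ih,
      natDegree_one_sub_X_pow, natDegree_one_sub_X_pow]
    ring

theorem reverse_qProd (a b : ℕ) : (qProd a b).reverse = (-1) ^ b * qProd a b := by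
  induction b with
  | zero => simpa [qProd] using reverse_C (1 : ℚ)
  | succ b ih =>
    rw [qProd_succ, reverse_mul_of_domain, ih, reverse_one_sub_X_pow (by omega)]
    ring

theorem natDegree_indexSumPoly (m n : ℕ) : (indexSumPoly m n).natDegree = m * n := by
  have h := indexSumPoly_mul_qProd m n
  have hne : indexSumPoly m n ≠ 0 := fun h0 => qProd_ne_zero m n (by rw [← h, h0, zero_mul])
  have := congrArg natDegree h
  rw [natDegree_mul hne (qProd_ne_zero 0 n), natDegree_qProd m] at this
  exact Nat.add_right_cancel this

theorem reverse_indexSumPoly (m n : ℕ) : (indexSumPoly m n).reverse = indexSumPoly m n := by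
  have h := congrArg reverse (indexSumPoly_mul_qProd m n)
  rw [reverse_mul_of_domain, reverse_qProd, reverse_qProd, ← indexSumPoly_mul_qProd m n,
    mul_left_comm] at h
  exact mul_right_cancel₀ (qProd_ne_zero 0 n) (mul_left_cancel₀ (by simp) h)

theorem qGauss_eq_indexSumPoly (m n : ℕ) : qGauss m n = indexSumPoly m n := by
  have h : qGauss m n = qProd m n / qProd 0 n := by simp [qGauss, qProd]
  rw [h, ← indexSumPoly_mul_qProd, mul_div_cancel_right₀ _ (qProd_ne_zero 0 n)]

end GaussianBinomial

open GaussianBinomial in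
/-- The ordinary `q`-Gaussian coefficient `[m+n, n]_q` is a symmetric and unimodal
polynomial in `q` of degree `m·n`. -/
theorem qGauss_symmetric_unimodal (m n : ℕ) :
    qGauss m n ≠ 0 ∧
      (qGauss m n).natDegree = m * n ∧
      (∀ i, i ≤ m * n → (qGauss m n).coeff i = (qGauss m n).coeff (m * n - i)) ∧
      (∀ i j, i ≤ j → j ≤ m * n / 2 → (qGauss m n).coeff i ≤ (qGauss m n).coeff j) := by
  rw [qGauss_eq_indexSumPoly]
  refine ⟨fun h => ?_, natDegree_indexSumPoly m n, fun i hi => ?_, fun i j hij hj => ?_⟩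
  · exact qProd_ne_zero m n (by rw [← indexSumPoly_mul_qProd, h, zero_mul])
  · conv_lhs => rw [← reverse_indexSumPoly]
    rw [coeff_reverse, natDegree_indexSumPoly, revAt_le hi]
  · induction j, hij using Nat.le_induction with
    | base => exact le_rfl
    | succ j _ ih => exact (ih (by omega)).trans (coeff_indexSumPoly_le_succ (by omega))
end
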